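/- Let s ≥ 2 and let (X_n)_{n≥0} be a dyadic digital (T,s)-sequence with T(m) ≤ (1/10)·log₂ m, and put P̈_m = (n/2^m, X_n)_{n=0}^{2^m-1} ⊂ [0,1)^{s+1}. Then for every w ∈ ℝ, 2^{-(s+1)m} ∑_{T ∈ Q^{s+1}(2^m)} vol{ Y ∈ [0,1)^{s+1} : D(P̈_m ⊕ T, Y)/M_{s+1,2}(P̈_m) < w } → Φ(w) as m → ∞. -/

import Mathlib

open MeasureTheory Filter

noncomputable section

attribute [local instance] Classical.propDecidable

/-- The `a`-th binary digit (`a ≥ 1`) of the dyadic expansion of `x ∈ [0,1)`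
(the finite expansion is used for dyadic rationals). -/
def bdigit (a : ℕ) (x : ℝ) : ℕ := (⌊x * 2 ^ a⌋).toNat % 2

/-- Digitwise addition modulo 2 of dyadic expansions: `x ⊕ y`. -/
def xorReal (x y : ℝ) : ℝ :=
  ∑' a : ℕ, (((bdigit (a + 1) x + bdigit (a + 1) y) % 2 : ℕ) : ℝ) / 2 ^ (a + 1)

/-- Coordinatewise digitwise addition `⊕` on vectors. -/
def xorVec {s : ℕ} (X Y : Fin s → ℝ) : Fin s → ℝ := fun i => xorReal (X i) (Y i)

/-- Local discrepancy `D(P, Y)` of a finite point set `P` in `[0,1)^s`. -/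
def Dloc {N s : ℕ} (P : Fin N → Fin s → ℝ) (Y : Fin s → ℝ) : ℝ :=
  (∑ n : Fin N, if ∀ i, 0 ≤ P n i ∧ P n i < Y i then (1 : ℝ) else 0) -
    (N : ℝ) * ∏ i, Y i

/-- `P` is a `(t,m,s)`-net in base 2: every elementary dyadic box of volume
`2^(t-m)` contains exactly `2^t` of the points. -/
def IsNet (t m s : ℕ) (P : Fin (2 ^ m) → Fin s → ℝ) : Prop :=
  ∀ d a : Fin s → ℕ, (∀ i, a i < 2 ^ d i) → (∑ i, d i) + t = m →
    (Finset.univ.filter fun n => ∀ i,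
        (a i : ℝ) / 2 ^ d i ≤ P n i ∧ P n i < ((a i : ℝ) + 1) / 2 ^ d i).card = 2 ^ t

/-- The digits `x_{n,i,j}` of the `n`-th point of the dyadic digital net with
generating matrices `C`. -/
def netDig (m s : ℕ) (C : Fin s → Matrix (Fin m) (Fin m) (ZMod 2)) (n : ℕ) :
    Fin s → Fin m → ZMod 2 :=
  fun i j => ∑ r : Fin m, C i j r * (if n.testBit r then 1 else 0)

/-- The `n`-th point of the dyadic digital net with generating matrices `C`. -/
def netPoint (m s : ℕ) (C : Fin s → Matrix (Fin m) (Fin m) (ZMod 2)) (n : ℕ) :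
    Fin s → ℝ :=
  fun i => ∑ j : Fin m, ((netDig m s C n i j).val : ℝ) / 2 ^ ((j : ℕ) + 1)

/-- The unit cube `[0,1]^s`. -/
def cube (s : ℕ) : Set (Fin s → ℝ) := Set.univ.pi fun _ => Set.Icc (0 : ℝ) 1

/-- The point of `Q^s(2^m)` with coordinates `T i / 2^m`. -/
def Qpt {s : ℕ} (m : ℕ) (T : Fin s → Fin (2 ^ m)) : Fin s → ℝ :=
  fun i => ((T i : ℕ) : ℝ) / 2 ^ m

/-- `M_{s,p}(P) = (2^{-sm} ∑_{T ∈ Q^s(2^m)} ∫_{[0,1]^s} |D(P ⊕ T, Y)|^p dY)^{1/p}`. -/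
def Msp (s m : ℕ) (p : ℝ) {N : ℕ} (P : Fin N → Fin s → ℝ) : ℝ :=
  ((2 : ℝ) ^ (-(s * m : ℤ)) * ∑ T : Fin s → Fin (2 ^ m),
      ∫ Y in cube s, |Dloc (fun n => xorVec (P n) (Qpt m T)) Y| ^ p) ^ (1 / p)

/-- The standard normal distribution function `Φ`. -/
def PhiCDF (w : ℝ) : ℝ :=
  (Real.sqrt (2 * Real.pi))⁻¹ * ∫ u in Set.Iio w, Real.exp (-u ^ 2 / 2)

/-- `χ_p`, the `p`-th absolute moment of the standard Gaussian. -/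
def chiMoment (p : ℝ) : ℝ :=
  (Real.sqrt (2 * Real.pi))⁻¹ * ∫ u : ℝ, |u| ^ p * Real.exp (-u ^ 2 / 2)

/-- Digits `y_{n,i,j}` of the points of the dyadic digital sequence generated by
the `ℕ × ℕ` matrices `C` over `F_2`. -/
def seqDig (s : ℕ) (C : Fin s → ℕ → ℕ → ZMod 2) (n : ℕ) : Fin s → ℕ → ZMod 2 :=
  fun i j => ∑ r ∈ Finset.range (n + 1), C i j r * (if n.testBit r then 1 else 0)

/-- The `n`-th point of the dyadic digital sequence generated by `C`. -/
def seqPoint (s : ℕ) (C : Fin s → ℕ → ℕ → ZMod 2) (n : ℕ) : Fin s → ℝ :=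
  fun i => ∑' j : ℕ, ((seqDig s C n i j).val : ℝ) / 2 ^ (j + 1)

/-- The digital sequence generated by `C` is a dyadic digital `(T,s)`-sequence:
for all `m ≥ 1` and `k ≥ 0` the block `X_{k2^m}, …, X_{k2^m+2^m-1}` is a
`(T(m),m,s)`-net in base 2. -/
def IsTSeq (s : ℕ) (Tf : ℕ → ℕ) (C : Fin s → ℕ → ℕ → ZMod 2) : Prop :=
  (∀ m, Tf m ≤ m) ∧
  ∀ m, 1 ≤ m → ∀ k : ℕ,
    IsNet (Tf m) m s fun n : Fin (2 ^ m) => seqPoint s C (k * 2 ^ m + (n : ℕ))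

/-- The dual net `P_m^⊥` of the digital net generated by `C`. -/
def dualNet (m s : ℕ) (C : Fin s → Matrix (Fin m) (Fin m) (ZMod 2)) :
    Finset (Fin s → Fin m → ZMod 2) :=
  Finset.univ.filter fun mm => ∀ n : Fin (2 ^ m),
    (∑ i, ∑ j, mm i j * netDig m s C (n : ℕ) i j) = 0

/-- `ρ(b)`: the position of the last nonzero digit (`ρ(0) = 0`). -/
def rhoF {m : ℕ} (b : Fin m → ZMod 2) : ℕ :=
  (Finset.univ.filter fun j => b j ≠ 0).sup fun j => (j : ℕ) + 1

/-- The 1-indexed component `𝔪_{i,a}` (as `0` or `1`), with the convention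
`𝔪_{i,0} = 0`. -/
def mAt {m : ℕ} (b : Fin m → ZMod 2) (a : ℕ) : ℕ :=
  if h : 1 ≤ a ∧ a ≤ m then (b ⟨a - 1, by omega⟩).val else 0

/-- The 1-indexed digit of a digit array, with the convention that digit `0`
and digits beyond `m` are `0`. -/
def dAt {m : ℕ} (y : Fin m → Fin 2) (a : ℕ) : ℕ :=
  if h : 1 ≤ a ∧ a ≤ m then (y ⟨a - 1, by omega⟩).val else 0

/-- `κ(A)`: the number of nonzero entries of `A`. -/
def kapF {s : ℕ} (A : Fin s → ℕ) : ℕ := (Finset.univ.filter fun i => A i ≠ 0).card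

/-- `a₀(A) = a₁ + ⋯ + a_s`. -/
def a0F {s : ℕ} (A : Fin s → ℕ) : ℕ := ∑ i, A i

/-- `Λ_A(T ⊕ Y^{(m)})` as a function of the digit arrays `t`, `y` of `T`, `Y`:
`∑_{𝔪 ∈ P^{⊥,*}, ρ(𝔪_i) ≤ a_i} e(∑_i (∑_j 𝔪_{i,j}(t_{i,j}+y_{i,j}) + 𝔪_{i,a_i}))`,
where `e(n) = exp(πin) = (-1)^n`. -/
def LamF (m s : ℕ) (C : Fin s → Matrix (Fin m) (Fin m) (ZMod 2)) (A : Fin s → ℕ)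
    (t y : Fin s → Fin m → Fin 2) : ℝ :=
  ∑ mm ∈ (dualNet m s C).filter fun mm => mm ≠ 0 ∧ ∀ i, rhoF (mm i) ≤ A i,
    (-1 : ℝ) ^
      (∑ i, ((∑ j, (mm i j).val * ((t i j : ℕ) + (y i j : ℕ))) + mAt (mm i) (A i)))

/-- The Rademacher function `r_A(Y)` as a function of the digit array of `Y`. -/
def rademF {m s : ℕ} (A : Fin s → ℕ) (y : Fin s → Fin m → Fin 2) : ℝ :=
  ∏ i, (-1 : ℝ) ^ dAt (y i) (A i)

/-- `Ψ_A = (-1)^{κ(A)} 2^{m-s-a₀(A)} r_A(Y) Λ_A(T ⊕ Y^{(m)})` at digit level. -/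
def PsiF (m s : ℕ) (C : Fin s → Matrix (Fin m) (Fin m) (ZMod 2)) (A : Fin s → ℕ)
    (t y : Fin s → Fin m → Fin 2) : ℝ :=
  (-1 : ℝ) ^ kapF A * (2 : ℝ) ^ ((m : ℤ) - (s : ℤ) - (a0F A : ℤ)) *
    rademF A y * LamF m s C A t y

/-- `V₀ = 10 log₂ m`. -/
def V0 (m : ℕ) : ℝ := 10 * Real.logb 2 m

/-- `I_{m,s,k} = {A ∈ I_m^s : max_i a_i = k, a₀(A) ∈ (m - t_m, m + V₀)}`. -/
def IndexSet (m s tm k : ℕ) : Finset (Fin s → ℕ) :=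
  (Fintype.piFinset fun _ : Fin s => Finset.range (m + 1)).filter fun A =>
    Finset.univ.sup A = k ∧ ((m : ℝ) - tm < a0F A ∧ (a0F A : ℝ) < m + V0 m)

/-- `I_{m,s,m+1} = {A ∈ I_m^s : a₀(A) ≥ m + V₀}`. -/
def IndexTail (m s : ℕ) : Finset (Fin s → ℕ) :=
  (Fintype.piFinset fun _ : Fin s => Finset.range (m + 1)).filter fun A =>
    (m : ℝ) + V0 m ≤ (a0F A : ℝ)

/-- `𝔇_k(T,Y) = ∑_{A ∈ I_{m,s,k}} Ψ_A` at digit level. -/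
def DDk (m s tm : ℕ) (C : Fin s → Matrix (Fin m) (Fin m) (ZMod 2)) (k : ℕ)
    (t y : Fin s → Fin m → Fin 2) : ℝ :=
  ∑ A ∈ IndexSet m s tm k, PsiF m s C A t y

/-- `R(T,Y) = ∑_{A ∈ I_{m,s,m+1}} Ψ_A` at digit level. -/
def Rtail (m s : ℕ) (C : Fin s → Matrix (Fin m) (Fin m) (ZMod 2))
    (t y : Fin s → Fin m → Fin 2) : ℝ :=
  ∑ A ∈ IndexTail m s, PsiF m s C A t y

/-- `E^{(m)}_{Y,T}(f)`: the average of `f` over all digit arrays. -/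
def Em (m s : ℕ) (f : (Fin s → Fin m → Fin 2) → (Fin s → Fin m → Fin 2) → ℝ) : ℝ :=
  (2 : ℝ) ^ (-(2 * s * m : ℤ)) *
    ∑ t : Fin s → Fin m → Fin 2, ∑ y : Fin s → Fin m → Fin 2, f t y

/-- Keep the first `k` digits of `t`, replace the remaining ones by those of `t'`. -/
def mergeDig {m s : ℕ} (k : ℕ) (t t' : Fin s → Fin m → Fin 2) :
    Fin s → Fin m → Fin 2 :=
  fun i j => if (j : ℕ) < k then t i j else t' i j

/-- The conditional expectation `E^{(m)}_{Y,T}(f | F_k)` with respect to the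
σ-field `F_k` generated by the dyadic cubes of side `2^{-k}`: the average of `f`
over the digits of index `> k`, as a function of the digit arrays `t`, `y`. -/
def EmCond (m s k : ℕ)
    (f : (Fin s → Fin m → Fin 2) → (Fin s → Fin m → Fin 2) → ℝ)
    (t y : Fin s → Fin m → Fin 2) : ℝ :=
  (2 : ℝ) ^ (-(2 * s * m : ℤ)) *
    ∑ t' : Fin s → Fin m → Fin 2, ∑ y' : Fin s → Fin m → Fin 2,
      f (mergeDig k t t') (mergeDig k y y')

/-- `Θ_{A₁,A₂,k} = E^{(m)}_{Y,T}(Ψ_{A₁}Ψ_{A₂} | F_{k-1}) - E^{(m)}_{Y,T}(Ψ_{A₁}Ψ_{A₂})`. -/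
def ThetaF (m s : ℕ) (C : Fin s → Matrix (Fin m) (Fin m) (ZMod 2))
    (A1 A2 : Fin s → ℕ) (k : ℕ) (t y : Fin s → Fin m → Fin 2) : ℝ :=
  EmCond m s (k - 1) (fun t' y' => PsiF m s C A1 t' y' * PsiF m s C A2 t' y') t y -
    Em m s fun t' y' => PsiF m s C A1 t' y' * PsiF m s C A2 t' y'

/-- `Υ_{d₁,d₂,d₃,J,k}` for a partition `J = (J₁,J₂,J₃)` of `{1,…,s}` and
`k = (k₁,k₂)`. -/
def Ups (m s tm : ℕ) (C : Fin s → Matrix (Fin m) (Fin m) (ZMod 2))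
    (J1 J2 J3 : Finset (Fin s)) (k1 k2 : ℕ) : ℝ :=
  ∑ A1 ∈ IndexSet m s tm k1, ∑ A2 ∈ IndexSet m s tm k1,
    ∑ A3 ∈ IndexSet m s tm k2, ∑ A4 ∈ IndexSet m s tm k2,
      (Em m s fun t y => ThetaF m s C A1 A2 k1 t y * ThetaF m s C A3 A4 k2 t y) *
        (if (Finset.univ.filter fun i => A1 i = A2 i) = J1 ∧
            (Finset.univ.filter fun i => A1 i < A2 i) = J2 ∧
            (Finset.univ.filter fun i => A2 i < A1 i) = J3 ∧
            (Finset.univ.filter fun i => A3 i = A4 i) = J1 ∧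
            (Finset.univ.filter fun i => A3 i < A4 i) = J2 ∧
            (Finset.univ.filter fun i => A4 i < A3 i) = J3 then (1 : ℝ) else 0)

/-- The array of the first `m` dyadic digits of the coordinates of `Y`. -/
def digitsOf (m s : ℕ) (Y : Fin s → ℝ) : Fin s → Fin m → Fin 2 :=
  fun i j => ⟨bdigit ((j : ℕ) + 1) (Y i), by unfold bdigit; omega⟩

/-- Truncation `y^{(m)}` to the first `m` dyadic digits. -/
def truncR (m : ℕ) (y : ℝ) : ℝ :=
  ∑ j ∈ Finset.range m, (bdigit (j + 1) y : ℝ) / 2 ^ (j + 1)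

/-- The elementary interval `Π_a` (`Π_0 = [0,1)`, `Π_a = [2^{-a}, 2^{1-a})`). -/
def PiBox (a : ℕ) : Set ℝ :=
  if a = 0 then Set.Ico 0 1 else Set.Ico ((2 : ℝ) ^ (-(a : ℤ))) ((2 : ℝ) ^ (1 - (a : ℤ)))

/-- `λ_A(Y) = 1_{Π_A}(Y) - vol(Π_A)`. -/
def lamA {s : ℕ} (A : Fin s → ℕ) (Y : Fin s → ℝ) : ℝ :=
  (if ∀ i, Y i ∈ PiBox (A i) then (1 : ℝ) else 0) - (2 : ℝ) ^ (-(a0F A : ℤ))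

/-- The micro-local discrepancy `λ_A(P_m^{(m)} ⊕ T ⊕ Y^{(m)})`. -/
def lamNet (m s : ℕ) (C : Fin s → Matrix (Fin m) (Fin m) (ZMod 2))
    (T Y : Fin s → ℝ) (A : Fin s → ℕ) : ℝ :=
  ∑ n : Fin (2 ^ m),
    lamA A fun i =>
      xorReal (xorReal (truncR m (netPoint m s C (n : ℕ) i)) (T i)) (truncR m (Y i))

/-- The Rademacher function `r_A(Y)` for a real point `Y`. -/
def rademReal {s : ℕ} (A : Fin s → ℕ) (Y : Fin s → ℝ) : ℝ :=
  ∏ i, if A i = 0 then (1 : ℝ) else 1 - 2 * (bdigit (A i) (Y i) : ℝ)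

/-- The truncated discrepancy
`D^{(m)}(P_m ⊕ T, Y) = 2^{-s} ∑_{A ∈ I_m^s} (-1)^{κ(A)} λ_A(P_m^{(m)} ⊕ T ⊕ Y^{(m)}) r_A(Y)`. -/
def Dm (m s : ℕ) (C : Fin s → Matrix (Fin m) (Fin m) (ZMod 2)) (T Y : Fin s → ℝ) : ℝ :=
  (2 : ℝ) ^ (-(s : ℤ)) *
    ∑ A ∈ Fintype.piFinset fun _ : Fin s => Finset.range (m + 1),
      (-1 : ℝ) ^ kapF A * lamNet m s C T Y A * rademReal A Y

/-- `𝔼_{Y,T,m}(f) = 2^{-sm} ∑_{T ∈ Q^s(2^m)} ∫_{[0,1]^s} f(T,Y) dY`. -/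
def EE (m s : ℕ) (f : (Fin s → ℝ) → (Fin s → ℝ) → ℝ) : ℝ :=
  (2 : ℝ) ^ (-(s * m : ℤ)) * ∑ T : Fin s → Fin (2 ^ m), ∫ Y in cube s, f (Qpt m T) Y

namespace DigitalCLT

open scoped BigOperators Topology

section

section Rademacher

/-- The sign `(-1)^x` of a binary digit. -/
def sgn (x : ZMod 2) : ℝ := if x = 0 then 1 else -1

lemma sgn_mul_self (x : ZMod 2) : sgn x * sgn x = 1 := by
  unfold sgn; split_ifs <;> norm_num

lemma zmod_two_cases (x : ZMod 2) : x = 0 ∨ x = 1 := by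
  revert x; exact Fin.forall_fin_two.mpr ⟨Or.inl rfl, Or.inr rfl⟩

lemma sgn_zero : sgn 0 = 1 := if_pos rfl

lemma sgn_one : sgn 1 = -1 := if_neg one_ne_zero

lemma sgn_add_one (x : ZMod 2) : sgn (x + 1) = -sgn x := by
  rcases zmod_two_cases x with h | h <;> subst h
  · rw [zero_add, sgn_zero, sgn_one]
  · rw [CharTwo.add_self_eq_zero, sgn_zero, sgn_one, neg_neg]

lemma sgn_eq (x : ZMod 2) : sgn x = 1 ∨ sgn x = -1 := by
  unfold sgn; split_ifs <;> simp

/-- The digit vector with a single digit `1`. -/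
def unitDigit {ι : Type*} (a : ι) : ι → ZMod 2 := fun b => if b = a then 1 else 0

lemma sgn_flip_self {ι : Type*} (a : ι) (y : ι → ZMod 2) : sgn ((y + unitDigit a) a) = -sgn (y a) := by
  simp [unitDigit, sgn_add_one]

lemma sgn_flip_of_ne {ι : Type*} {a b : ι} (h : b ≠ a) (y : ι → ZMod 2) :
    sgn ((y + unitDigit a) b) = sgn (y b) := by
  simp [unitDigit, h]

variable {ι : Type*} [Fintype ι] [DecidableEq ι]

/-- Flipping a digit does not change averages. -/
lemma expect_flip {M : Type*} [AddCommMonoid M] [Module ℚ≥0 M] (a : ι) (f : (ι → ZMod 2) → M) :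
    𝔼 y : ι → ZMod 2, f (y + unitDigit a) = 𝔼 y, f y :=
  Fintype.expect_equiv (Equiv.addRight (unitDigit a)) _ _ fun _ => rfl

lemma expect_eq_zero_of_flip {𝕜 : Type*} [RCLike 𝕜] (a : ι) (f : (ι → ZMod 2) → 𝕜)
    (h : ∀ y, f (y + unitDigit a) = -f y) : 𝔼 y, f y = 0 := by
  have h1 := expect_flip a f
  simp_rw [h, Finset.expect_neg_distrib] at h1
  have h2 : (2 : 𝕜) * 𝔼 y, f y = 0 := by linear_combination -h1
  simpa using h2

lemma expect_sgn_mul_sgn (a b : ι) :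
    𝔼 y : ι → ZMod 2, sgn (y a) * sgn (y b) = if a = b then 1 else 0 := by
  split_ifs with h
  · subst h; simp_rw [sgn_mul_self]; simp
  · refine expect_eq_zero_of_flip a _ fun y => ?_
    rw [sgn_flip_self, sgn_flip_of_ne (Ne.symm h)]; ring

lemma expect_sgn_four {a b c d : ι} (hab : a ≠ b) (hcd : c ≠ d) :
    𝔼 y : ι → ZMod 2, (sgn (y a) * sgn (y b)) * (sgn (y c) * sgn (y d)) =
      (if a = c ∧ b = d then 1 else 0) + if a = d ∧ b = c then 1 else 0 := by
  by_cases h1 : a = c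
  · subst h1
    have : ∀ y : ι → ZMod 2, (sgn (y a) * sgn (y b)) * (sgn (y a) * sgn (y d)) =
        sgn (y b) * sgn (y d) := fun y => by
      linear_combination (sgn (y b) * sgn (y d)) * sgn_mul_self (y a)
    simp_rw [this, expect_sgn_mul_sgn]
    simp [hcd]
  by_cases h2 : a = d
  · subst h2
    have : ∀ y : ι → ZMod 2, (sgn (y a) * sgn (y b)) * (sgn (y c) * sgn (y a)) =
        sgn (y b) * sgn (y c) := fun y => by
      linear_combination (sgn (y b) * sgn (y c)) * sgn_mul_self (y a)
    simp_rw [this, expect_sgn_mul_sgn]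
    simp [h1]
  rw [if_neg (by tauto), if_neg (by tauto), add_zero]
  refine expect_eq_zero_of_flip a _ fun y => ?_
  rw [sgn_flip_self, sgn_flip_of_ne (Ne.symm hab), sgn_flip_of_ne (Ne.symm h1),
    sgn_flip_of_ne (Ne.symm h2)]
  ring

lemma quad_offdiag_le (k : ι → ι → ℝ) (hk : ∀ a, k a a = 0) :
    𝔼 y : ι → ZMod 2, (∑ a, ∑ b, k a b * (sgn (y a) * sgn (y b))) ^ 2 ≤
      2 * ∑ a, ∑ b, k a b ^ 2 := by
  have h1 : 𝔼 y : ι → ZMod 2, (∑ a, ∑ b, k a b * (sgn (y a) * sgn (y b))) ^ 2 =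
      ∑ a, ∑ b, ∑ c, ∑ d, k a b * k c d *
        𝔼 y : ι → ZMod 2, (sgn (y a) * sgn (y b)) * (sgn (y c) * sgn (y d)) := by
    simp_rw [Finset.mul_expect, ← Finset.expect_sum_comm]
    refine Finset.expect_congr rfl fun y _ => ?_
    rw [sq, Finset.sum_mul]
    refine Finset.sum_congr rfl fun a _ => ?_
    rw [Finset.sum_mul]
    refine Finset.sum_congr rfl fun b _ => ?_
    rw [Finset.mul_sum]
    refine Finset.sum_congr rfl fun c _ => ?_
    rw [Finset.mul_sum]
    refine Finset.sum_congr rfl fun d _ => ?_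
    ring
  have h2 : ∀ a b c d, k a b * k c d *
        𝔼 y : ι → ZMod 2, (sgn (y a) * sgn (y b)) * (sgn (y c) * sgn (y d)) =
      (if c = a then if d = b then k a b * k c d else 0 else 0) +
        if c = b then if d = a then k a b * k c d else 0 else 0 := by
    intro a b c d
    by_cases hab : a = b
    · subst hab; simp [hk]
    by_cases hcd : c = d
    · subst hcd; simp [hk]
    rw [expect_sgn_four hab hcd]
    have e1 : (a = c ∧ b = d) ↔ (c = a ∧ d = b) := by tauto
    have e2 : (a = d ∧ b = c) ↔ (c = b ∧ d = a) := by tauto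
    simp only [e1, e2, mul_add, mul_ite, mul_one, mul_zero, ite_and]
  rw [h1]
  simp_rw [h2, Finset.sum_add_distrib]
  have h3 : ∀ a b, (∑ c, ∑ d, if c = a then if d = b then k a b * k c d else 0 else 0) =
      k a b ^ 2 := by
    intro a b
    rw [Finset.sum_eq_single a (by intro c _ hc; simp [hc]) (by simp)]
    simp [sq]
  have h4 : ∀ a b, (∑ c, ∑ d, if c = b then if d = a then k a b * k c d else 0 else 0) =
      k a b * k b a := by
    intro a b
    rw [Finset.sum_eq_single b (by intro c _ hc; simp [hc]) (by simp)]
    simp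
  simp_rw [h3, h4]
  have h5 : ∑ a, ∑ b, k a b * k b a ≤ ∑ a, ∑ b, (k a b ^ 2 + k b a ^ 2) / 2 :=
    Finset.sum_le_sum fun a _ => Finset.sum_le_sum fun b _ => by
      nlinarith [sq_nonneg (k a b - k b a)]
  have h6 : ∑ a, ∑ b, (k a b ^ 2 + k b a ^ 2) / 2 = ∑ a, ∑ b, k a b ^ 2 := by
    simp_rw [add_div, Finset.sum_add_distrib]
    rw [Finset.sum_comm (f := fun a b => k b a ^ 2 / 2), ← Finset.sum_add_distrib]
    refine Finset.sum_congr rfl fun a _ => ?_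
    rw [← Finset.sum_add_distrib]
    exact Finset.sum_congr rfl fun b _ => by ring
  linarith

lemma quad_var_le (k : ι → ι → ℝ) :
    𝔼 y : ι → ZMod 2, (∑ a, ∑ b, k a b * (sgn (y a) * sgn (y b)) - ∑ a, k a a) ^ 2 ≤
      2 * ∑ a, ∑ b, k a b ^ 2 := by
  have h := quad_offdiag_le (fun a b => if a = b then 0 else k a b) (by simp)
  refine le_trans (le_of_eq ?_) (h.trans ?_)
  · refine Finset.expect_congr rfl fun y _ => ?_
    congr 1
    rw [← Finset.sum_sub_distrib]
    refine Finset.sum_congr rfl fun a _ => ?_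
    rw [← Finset.add_sum_erase _ _ (Finset.mem_univ a),
      ← Finset.add_sum_erase Finset.univ
        (fun b => (if a = b then 0 else k a b) * (sgn (y a) * sgn (y b))) (Finset.mem_univ a),
      sgn_mul_self]
    simp only [if_true, zero_add, mul_one, add_sub_cancel_left]
    refine Finset.sum_congr rfl fun b hb => ?_
    rw [if_neg (Finset.ne_of_mem_erase hb).symm]
  · refine mul_le_mul_of_nonneg_left (Finset.sum_le_sum fun a _ => Finset.sum_le_sum fun b _ => ?_)
      zero_le_two
    split_ifs
    · simpa using sq_nonneg (k a b)
    · rfl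

lemma expect_quad (k : ι → ι → ℝ) :
    𝔼 y : ι → ZMod 2, ∑ a, ∑ b, k a b * (sgn (y a) * sgn (y b)) = ∑ a, k a a := by
  simp_rw [Finset.expect_sum_comm, ← Finset.mul_expect, expect_sgn_mul_sgn]
  simp

lemma quad_sq_le (k : ι → ι → ℝ) :
    𝔼 y : ι → ZMod 2, (∑ a, ∑ b, k a b * (sgn (y a) * sgn (y b))) ^ 2 ≤
      (∑ a, k a a) ^ 2 + 2 * ∑ a, ∑ b, k a b ^ 2 := by
  have h := quad_var_le k
  have h2 : 𝔼 y : ι → ZMod 2, (∑ a, ∑ b, k a b * (sgn (y a) * sgn (y b)) - ∑ a, k a a) ^ 2 =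
      𝔼 y : ι → ZMod 2, (∑ a, ∑ b, k a b * (sgn (y a) * sgn (y b))) ^ 2 - (∑ a, k a a) ^ 2 := by
    simp_rw [sub_sq, Finset.expect_add_distrib, Finset.expect_sub_distrib, ← Finset.expect_mul,
      ← Finset.mul_expect, expect_quad]
    simp; ring
  linarith

lemma expect_linear_pow_four_le (u : ι → ℝ) :
    𝔼 y : ι → ZMod 2, (∑ a, u a * sgn (y a)) ^ 4 ≤ 3 * (∑ a, u a ^ 2) ^ 2 := by
  have h := quad_sq_le fun a b => u a * u b
  have e : ∑ a, ∑ b, (u a * u b) ^ 2 = (∑ a, u a ^ 2) ^ 2 := by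
    rw [sq (∑ a, u a ^ 2), Finset.sum_mul_sum]; simp_rw [mul_pow]
  rw [e] at h
  calc _ = 𝔼 y : ι → ZMod 2, (∑ a, ∑ b, u a * u b * (sgn (y a) * sgn (y b))) ^ 2 := by
        refine Finset.expect_congr rfl fun y _ => ?_
        have : (∑ a, u a * sgn (y a)) ^ 4 = ((∑ a, u a * sgn (y a)) * ∑ a, u a * sgn (y a)) ^ 2 := by
          ring
        rw [this, Finset.sum_mul_sum]
        congr 1
        exact Finset.sum_congr rfl fun a _ => Finset.sum_congr rfl fun b _ => by ring
    _ ≤ _ := h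
    _ = _ := by simp_rw [← sq]; ring

lemma exp_sgn_mul_I (w : ℝ) (x : ZMod 2) :
    Complex.exp (((w * sgn x : ℝ) : ℂ) * Complex.I) =
      (Real.cos w : ℂ) + (sgn x : ℂ) * ((Real.sin w : ℂ) * Complex.I) := by
  rw [Complex.exp_mul_I]
  rcases sgn_eq x with h | h <;> rw [h] <;> push_cast <;> simp

lemma expect_exp_linear (w : ι → ℝ) :
    𝔼 y : ι → ZMod 2, Complex.exp (((∑ a, w a * sgn (y a) : ℝ) : ℂ) * Complex.I) =
      ∏ a, (Real.cos (w a) : ℂ) := by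
  have key : ∀ s : Finset ι, 𝔼 y : ι → ZMod 2,
      ∏ a ∈ s, Complex.exp (((w a * sgn (y a) : ℝ) : ℂ) * Complex.I) =
      ∏ a ∈ s, (Real.cos (w a) : ℂ) := by
    intro s
    induction s using Finset.induction_on with
    | empty => simp
    | insert a s ha ih =>
      simp_rw [Finset.prod_insert ha, exp_sgn_mul_I (w a), add_mul, Finset.expect_add_distrib]
      rw [← Finset.mul_expect, ih, add_eq_left]
      refine expect_eq_zero_of_flip a _ fun y => ?_
      rw [sgn_flip_self]
      have : ∏ b ∈ s, Complex.exp (((w b * sgn ((y + unitDigit a) b) : ℝ) : ℂ) * Complex.I) =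
          ∏ b ∈ s, Complex.exp (((w b * sgn (y b) : ℝ) : ℂ) * Complex.I) :=
        Finset.prod_congr rfl fun b hb => by
          rw [sgn_flip_of_ne (ne_of_mem_of_not_mem hb ha)]
      rw [this]; push_cast; ring
  rw [← key]
  refine Finset.expect_congr rfl fun y _ => ?_
  rw [← Complex.exp_sum]; push_cast; rw [Finset.sum_mul]

end Rademacher

end

section

lemma abs_cos_sub_exp_le (u : ℝ) : |Real.cos u - Real.exp (-(u ^ 2 / 2))| ≤ 2 * u ^ 4 := by
  by_cases hu : |u| ≤ 1
  · have h1 := Real.cos_bound hu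
    have hu2 : u ^ 2 ≤ 1 := by rw [← sq_abs]; exact pow_le_one₀ (abs_nonneg u) hu
    have h2 := Real.abs_exp_sub_one_sub_id_le (x := -(u ^ 2 / 2)) (by
      rw [abs_neg, abs_of_nonneg (by positivity)]; linarith)
    have h3 : |u| ^ 4 = u ^ 4 := by rw [show 4 = 2 * 2 from rfl, pow_mul, sq_abs, ← pow_mul]
    rw [h3] at h1
    rw [abs_le] at *
    constructor <;> nlinarith [sq_nonneg (u ^ 2)]
  · have hu2 : 1 ≤ u ^ 2 := by rw [← sq_abs]; exact one_le_pow₀ (not_le.mp hu).le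
    have h1 := Real.abs_cos_le_one u
    have h2 : Real.exp (-(u ^ 2 / 2)) ≤ 1 := Real.exp_le_one_iff.mpr (by linarith)
    have h3 := (Real.exp_pos (-(u ^ 2 / 2))).le
    rw [abs_le] at *
    constructor <;> nlinarith

lemma abs_prod_sub_prod_le {ι : Type*} (s : Finset ι) (f g : ι → ℝ) (hf : ∀ i ∈ s, |f i| ≤ 1)
    (hg : ∀ i ∈ s, |g i| ≤ 1) : |∏ i ∈ s, f i - ∏ i ∈ s, g i| ≤ ∑ i ∈ s, |f i - g i| := by
  induction s using Finset.induction_on with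
  | empty => simp
  | insert a s ha ih =>
    have ih' := ih (fun i hi => hf i (Finset.mem_insert_of_mem hi))
      fun i hi => hg i (Finset.mem_insert_of_mem hi)
    rw [Finset.prod_insert ha, Finset.prod_insert ha, Finset.sum_insert ha]
    have e : f a * ∏ i ∈ s, f i - g a * ∏ i ∈ s, g i =
        (f a - g a) * ∏ i ∈ s, f i + g a * (∏ i ∈ s, f i - ∏ i ∈ s, g i) := by ring
    rw [e]
    refine (abs_add_le _ _).trans (add_le_add ?_ ?_)
    · rw [abs_mul, Finset.abs_prod]
      exact mul_le_of_le_one_right (abs_nonneg _) (Finset.prod_le_one (fun _ _ => abs_nonneg _)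
        fun i hi => hf i (Finset.mem_insert_of_mem hi))
    · rw [abs_mul]
      exact (mul_le_of_le_one_left (abs_nonneg _) (hg a (Finset.mem_insert_self a s))).trans ih'

lemma abs_exp_neg_sub_exp_neg_le {x y : ℝ} (hx : 0 ≤ x) (hy : 0 ≤ y) :
    |Real.exp (-x) - Real.exp (-y)| ≤ |x - y| := by
  wlog h : x ≤ y generalizing x y
  · rw [abs_sub_comm, abs_sub_comm x]; exact this hy hx (not_le.mp h).le
  have h1 : Real.exp (-y) ≤ Real.exp (-x) := Real.exp_le_exp.mpr (by linarith)
  rw [abs_of_nonneg (by linarith), abs_of_nonpos (by linarith)]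
  have h2 : Real.exp (-y) = Real.exp (-x) * Real.exp (-(y - x)) := by
    rw [← Real.exp_add]; congr 1; ring
  have h3 := Real.add_one_le_exp (-(y - x))
  have h4 : Real.exp (-x) ≤ 1 := Real.exp_le_one_iff.mpr (by linarith)
  rw [h2]
  nlinarith [Real.exp_pos (-x), Real.exp_le_one_iff.mpr (show -(y - x) ≤ 0 by linarith)]

lemma expect_abs_le_sqrt {Ω : Type*} [Fintype Ω] [Nonempty Ω] (f : Ω → ℝ) :
    𝔼 x, |f x| ≤ Real.sqrt (𝔼 x, f x ^ 2) := by
  refine Real.le_sqrt_of_sq_le ?_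
  have h := Finset.expect_mul_sq_le_sq_mul_sq Finset.univ (fun x => |f x|) fun _ => (1 : ℝ)
  simpa using h

lemma norm_expect_le {Ω E : Type*} [Fintype Ω] [NormedAddCommGroup E] [NormedSpace ℝ E]
    [Module ℚ≥0 E] [IsScalarTower ℚ≥0 ℝ E] (f : Ω → E) : ‖𝔼 x, f x‖ ≤ 𝔼 x, ‖f x‖ := by
  have h1 : 𝔼 x, f x = (Fintype.card Ω : ℝ)⁻¹ • ∑ x, f x := by
    rw [Finset.expect]
    have : ((Fintype.card Ω : ℚ≥0)⁻¹ • (1 : ℝ)) = (Fintype.card Ω : ℝ)⁻¹ := by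
      rw [NNRat.smul_def]; simp
    rw [← this, smul_assoc, one_smul]; rfl
  rw [h1, norm_smul, Fintype.expect_eq_sum_div_card, div_eq_inv_mul]
  rw [Real.norm_of_nonneg (by positivity)]
  gcongr
  exact norm_sum_le _ _

/-- A bound for the squared Hilbert-Schmidt norm of a Gram matrix. -/
lemma gram_sq_le {α β : Type*} [Fintype α] [Fintype β] (f : α → β → ℝ) {B P R : ℝ} (hP0 : 0 ≤ P)
    (hB0 : 0 ≤ B)
    (hB : ∀ p x, |f p x| ≤ B) (hP : ∀ x, ∑ p, |f p x| ≤ P) (hR : ∀ p, ∑ x, |f p x| ≤ R) :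
    ∑ x, ∑ x', (∑ p, f p x * f p x') ^ 2 ≤ B * P * (Fintype.card α * R ^ 2) := by
  have h1 : ∀ x x', (∑ p, f p x * f p x') ^ 2 ≤ B * P * ∑ p, |f p x| * |f p x'| := by
    intro x x'
    have a1 : |∑ p, f p x * f p x'| ≤ ∑ p, |f p x| * |f p x'| := by
      refine (Finset.abs_sum_le_sum_abs _ _).trans (le_of_eq ?_)
      simp_rw [abs_mul]
    have a2 : ∑ p, |f p x| * |f p x'| ≤ B * P := by
      calc _ ≤ ∑ p, |f p x| * B := by gcongr with p _; exact hB p x'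
        _ = B * ∑ p, |f p x| := by rw [← Finset.sum_mul, mul_comm]
        _ ≤ _ := by gcongr; exact hP x
    rw [← sq_abs, sq]
    exact mul_le_mul (a1.trans a2) a1 (abs_nonneg _) (mul_nonneg hB0 hP0)
  calc _ ≤ ∑ x, ∑ x', B * P * ∑ p, |f p x| * |f p x'| :=
        Finset.sum_le_sum fun x _ => Finset.sum_le_sum fun x' _ => h1 x x'
    _ = B * P * ∑ p, (∑ x, |f p x|) ^ 2 := by
        simp_rw [← Finset.mul_sum]
        congr 1
        simp_rw [sq, Finset.sum_mul_sum]
        rw [Finset.sum_comm (s := (Finset.univ : Finset α))]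
        refine Finset.sum_congr rfl fun x _ => ?_
        rw [Finset.sum_comm]
    _ ≤ B * P * ∑ _p : α, R ^ 2 := by
        gcongr with p _
        exact hR p
    _ = _ := by simp

end

section

section Chaos
variable {ι : Type*} [Fintype ι]

/-- The coefficients of a trilinear form have all absolute line sums bounded by `κ`. -/
structure LineBound (l : ι → ι → ι → ℝ) (κ : ℝ) : Prop where
  fst : ∀ b c, ∑ a, |l a b c| ≤ κ
  snd : ∀ a c, ∑ b, |l a b c| ≤ κ
  trd : ∀ a b, ∑ c, |l a b c| ≤ κ

lemma LineBound.entry {l : ι → ι → ι → ℝ} {κ : ℝ} (h : LineBound l κ) (a b c : ι) :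
    |l a b c| ≤ κ :=
  (Finset.single_le_sum (f := fun a => |l a b c|) (fun _ _ => abs_nonneg _)
    (Finset.mem_univ a)).trans (h.fst b c)

lemma LineBound.gram_fst {l : ι → ι → ι → ℝ} {κ : ℝ} (h : LineBound l κ) (hκ : 0 ≤ κ) :
    ∑ a, ∑ a', (∑ p : ι × ι, l a p.1 p.2 * l a' p.1 p.2) ^ 2 ≤ (Fintype.card ι : ℝ) ^ 3 * κ ^ 4 := by
  refine (gram_sq_le (fun (p : ι × ι) a => l a p.1 p.2) (B := κ)
    (P := Fintype.card ι * κ) (R := κ) (by positivity) hκ (fun p x => h.entry _ _ _)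
    (fun x => ?_) fun p => h.fst _ _).trans (le_of_eq ?_)
  · rw [Fintype.sum_prod_type]
    exact (Finset.sum_le_sum fun b _ => h.trd x b).trans (by simp)
  · rw [Fintype.card_prod]; push_cast; ring

lemma LineBound.gram_snd {l : ι → ι → ι → ℝ} {κ : ℝ} (h : LineBound l κ) (hκ : 0 ≤ κ) :
    ∑ b, ∑ b', (∑ p : ι × ι, l p.1 b p.2 * l p.1 b' p.2) ^ 2 ≤ (Fintype.card ι : ℝ) ^ 3 * κ ^ 4 := by
  refine (gram_sq_le (fun (p : ι × ι) b => l p.1 b p.2) (B := κ)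
    (P := Fintype.card ι * κ) (R := κ) (by positivity) hκ (fun p x => h.entry _ _ _)
    (fun x => ?_) fun p => h.snd _ _).trans (le_of_eq ?_)
  · rw [Fintype.sum_prod_type]
    exact (Finset.sum_le_sum fun a _ => h.trd a x).trans (by simp)
  · rw [Fintype.card_prod]; push_cast; ring

lemma LineBound.gram_pair {l : ι → ι → ι → ℝ} {κ : ℝ} (h : LineBound l κ) (hκ : 0 ≤ κ) :
    ∑ x : ι × ι, ∑ x' : ι × ι, (∑ c, l x.1 x.2 c * l x'.1 x'.2 c) ^ 2 ≤
      (Fintype.card ι : ℝ) ^ 3 * κ ^ 4 := by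
  refine (gram_sq_le (fun c (x : ι × ι) => l x.1 x.2 c) (B := κ)
    (P := κ) (R := Fintype.card ι * κ) hκ hκ (fun p x => h.entry _ _ _)
    (fun x => h.trd _ _) fun c => ?_).trans (le_of_eq ?_)
  · rw [Fintype.sum_prod_type]
    exact (Finset.sum_le_sum fun a _ => h.snd a c).trans (by simp)
  · ring

/-- The linear form in the first variable. -/
def partialForm (l : ι → ι → ι → ℝ) (x : ι → ZMod 2) (b c : ι) : ℝ := ∑ a, l a b c * sgn (x a)

lemma LineBound.partialForm_le {l : ι → ι → ι → ℝ} {κ : ℝ} (h : LineBound l κ) (x : ι → ZMod 2)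
    (b c : ι) : |partialForm l x b c| ≤ κ := by
  refine (Finset.abs_sum_le_sum_abs _ _).trans (le_trans (le_of_eq ?_) (h.fst b c))
  refine Finset.sum_congr rfl fun a _ => ?_
  rcases sgn_eq (x a) with e | e <;> rw [e] <;> simp

lemma LineBound.partialForm_sq_le {l : ι → ι → ι → ℝ} {κ : ℝ} (h : LineBound l κ)
    (x : ι → ZMod 2) (c : ι) : ∑ b, partialForm l x b c ^ 2 ≤ Fintype.card ι * κ ^ 2 := by
  refine (Finset.sum_le_sum (g := fun _ => κ ^ 2) fun b _ => ?_).trans (by simp)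
  rw [← sq_abs]
  exact pow_le_pow_left₀ (abs_nonneg _) (h.partialForm_le x b c) 2

/-- The linear form in the first two variables. -/
def pairForm (l : ι → ι → ι → ℝ) (x y : ι → ZMod 2) (c : ι) : ℝ :=
  ∑ b, partialForm l x b c * sgn (y b)

lemma trilinear_eq (l : ι → ι → ι → ℝ) (x y z : ι → ZMod 2) :
    ∑ a, ∑ b, ∑ c, l a b c * (sgn (x a) * sgn (y b) * sgn (z c)) =
      ∑ c, pairForm l x y c * sgn (z c) := by
  simp_rw [pairForm, partialForm, Finset.sum_mul]
  rw [Finset.sum_comm]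
  simp_rw [Finset.sum_comm (s := (Finset.univ : Finset ι)) (f := fun a c => l a _ c * _)]
  rw [Finset.sum_comm]
  refine Finset.sum_congr rfl fun c _ => Finset.sum_congr rfl fun b _ =>
    Finset.sum_congr rfl fun a _ => by ring

lemma sum_pairForm_sq (l : ι → ι → ι → ℝ) (x y : ι → ZMod 2) :
    ∑ c, pairForm l x y c ^ 2 =
      ∑ b, ∑ b', (∑ c, partialForm l x b c * partialForm l x b' c) * (sgn (y b) * sgn (y b')) := by
  simp_rw [pairForm, sq, Finset.sum_mul_sum, Finset.sum_mul]
  rw [Finset.sum_comm]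
  refine Finset.sum_congr rfl fun b _ => ?_
  rw [Finset.sum_comm]
  refine Finset.sum_congr rfl fun b' _ => Finset.sum_congr rfl fun c _ => by ring

lemma sum_partialForm_mul (l : ι → ι → ι → ℝ) (x : ι → ZMod 2) (b b' : ι) :
    ∑ c, partialForm l x b c * partialForm l x b' c =
      ∑ a, ∑ a', (∑ c, l a b c * l a' b' c) * (sgn (x a) * sgn (x a')) := by
  simp_rw [partialForm, Finset.sum_mul_sum, Finset.sum_mul]
  rw [Finset.sum_comm]
  refine Finset.sum_congr rfl fun b _ => ?_
  rw [Finset.sum_comm]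
  refine Finset.sum_congr rfl fun b' _ => Finset.sum_congr rfl fun c _ => by ring

variable [DecidableEq ι]

lemma LineBound.expect_pairForm_four_le {l : ι → ι → ι → ℝ} {κ : ℝ} (h : LineBound l κ)
    (x : ι → ZMod 2) :
    𝔼 y : ι → ZMod 2, ∑ c, pairForm l x y c ^ 4 ≤ 3 * (Fintype.card ι : ℝ) ^ 3 * κ ^ 4 := by
  rw [Finset.expect_sum_comm]
  refine (Finset.sum_le_sum (g := fun _ => 3 * ((Fintype.card ι : ℝ) * κ ^ 2) ^ 2)
    fun c _ => ?_).trans (le_of_eq (by simp; ring))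
  refine (expect_linear_pow_four_le fun b => partialForm l x b c).trans ?_
  gcongr
  exact h.partialForm_sq_le x c

lemma LineBound.expect_offdiag_le {l : ι → ι → ι → ℝ} {κ : ℝ} (h : LineBound l κ) (hκ : 0 ≤ κ) :
    𝔼 x : ι → ZMod 2, ∑ b, ∑ b', (∑ c, partialForm l x b c * partialForm l x b' c) ^ 2 ≤
      3 * ((Fintype.card ι : ℝ) ^ 3 * κ ^ 4) := by
  simp_rw [Finset.expect_sum_comm, sum_partialForm_mul]
  calc _ ≤ ∑ b, ∑ b', ((∑ a, ∑ c, l a b c * l a b' c) ^ 2 +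
        2 * ∑ a, ∑ a', (∑ c, l a b c * l a' b' c) ^ 2) :=
        Finset.sum_le_sum fun b _ => Finset.sum_le_sum fun b' _ =>
          quad_sq_le fun a a' => ∑ c, l a b c * l a' b' c
    _ = ∑ b, ∑ b', (∑ p : ι × ι, l p.1 b p.2 * l p.1 b' p.2) ^ 2 +
        2 * ∑ x : ι × ι, ∑ x' : ι × ι, (∑ c, l x.1 x.2 c * l x'.1 x'.2 c) ^ 2 := by
        simp_rw [Fintype.sum_prod_type, Finset.sum_add_distrib, ← Finset.mul_sum]
        congr 2
        rw [Finset.sum_comm (t := (Finset.univ : Finset ι)) (s := (Finset.univ : Finset ι))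
          (f := fun a b => ∑ a', ∑ b', (∑ c, l a b c * l a' b' c) ^ 2)]
        refine Finset.sum_congr rfl fun b _ => ?_
        rw [Finset.sum_comm]
        refine Finset.sum_congr rfl fun a _ => ?_
        rw [Finset.sum_comm]
    _ ≤ _ := by linarith [h.gram_snd hκ, h.gram_pair hκ]

lemma LineBound.expect_diag_le {l : ι → ι → ι → ℝ} {κ : ℝ} (h : LineBound l κ) (hκ : 0 ≤ κ) :
    𝔼 x : ι → ZMod 2, (∑ b, ∑ c, partialForm l x b c * partialForm l x b c -
        ∑ a, ∑ b, ∑ c, l a b c ^ 2) ^ 2 ≤ 2 * ((Fintype.card ι : ℝ) ^ 3 * κ ^ 4) := by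
  have e : ∀ x : ι → ZMod 2, ∑ b, ∑ c, partialForm l x b c * partialForm l x b c =
      ∑ a, ∑ a', (∑ p : ι × ι, l a p.1 p.2 * l a' p.1 p.2) * (sgn (x a) * sgn (x a')) := by
    intro x
    simp_rw [sum_partialForm_mul, Fintype.sum_prod_type, Finset.sum_mul]
    rw [Finset.sum_comm]
    refine Finset.sum_congr rfl fun b _ => ?_
    rw [Finset.sum_comm]
  have e2 : ∑ a, ∑ b, ∑ c, l a b c ^ 2 = ∑ a, ∑ p : ι × ι, l a p.1 p.2 * l a p.1 p.2 := by
    simp_rw [Fintype.sum_prod_type, sq]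
  simp_rw [e, e2]
  exact (quad_var_le _).trans (mul_le_mul_of_nonneg_left (h.gram_fst hκ) (by norm_num))

lemma LineBound.expect_sub_sq_le {l : ι → ι → ι → ℝ} {κ : ℝ} (h : LineBound l κ) (hκ : 0 ≤ κ) :
    𝔼 x : ι → ZMod 2, 𝔼 y : ι → ZMod 2, (∑ c, pairForm l x y c ^ 2 -
        ∑ a, ∑ b, ∑ c, l a b c ^ 2) ^ 2 ≤ 16 * ((Fintype.card ι : ℝ) ^ 3 * κ ^ 4) := by
  have h1 : ∀ x y : ι → ZMod 2, (∑ c, pairForm l x y c ^ 2 - ∑ a, ∑ b, ∑ c, l a b c ^ 2) ^ 2 ≤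
      2 * (∑ c, pairForm l x y c ^ 2 - ∑ b, ∑ c, partialForm l x b c * partialForm l x b c) ^ 2 +
      2 * (∑ b, ∑ c, partialForm l x b c * partialForm l x b c - ∑ a, ∑ b, ∑ c, l a b c ^ 2) ^ 2 := by
    intro x y
    nlinarith [sq_nonneg ((∑ c, pairForm l x y c ^ 2 -
      ∑ b, ∑ c, partialForm l x b c * partialForm l x b c) -
      (∑ b, ∑ c, partialForm l x b c * partialForm l x b c - ∑ a, ∑ b, ∑ c, l a b c ^ 2))]
  have h2 : ∀ x : ι → ZMod 2, 𝔼 y : ι → ZMod 2, (∑ c, pairForm l x y c ^ 2 -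
      ∑ a, ∑ b, ∑ c, l a b c ^ 2) ^ 2 ≤
      2 * (2 * ∑ b, ∑ b', (∑ c, partialForm l x b c * partialForm l x b' c) ^ 2) +
      2 * (∑ b, ∑ c, partialForm l x b c * partialForm l x b c -
        ∑ a, ∑ b, ∑ c, l a b c ^ 2) ^ 2 := by
    intro x
    refine (Finset.expect_le_expect fun y _ => h1 x y).trans ?_
    rw [Finset.expect_add_distrib, ← Finset.mul_expect, Fintype.expect_const]
    gcongr
    simp_rw [sum_pairForm_sq]
    exact quad_var_le _
  refine (Finset.expect_le_expect fun x _ => h2 x).trans ?_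
  simp_rw [Finset.expect_add_distrib, ← Finset.mul_expect]
  linarith [h.expect_offdiag_le hκ, h.expect_diag_le hκ]

lemma expect_expect_abs_le_sqrt {Ω Ω' : Type*} [Fintype Ω] [Nonempty Ω] [Fintype Ω'] [Nonempty Ω']
    (f : Ω → Ω' → ℝ) : 𝔼 x, 𝔼 y, |f x y| ≤ Real.sqrt (𝔼 x, 𝔼 y, f x y ^ 2) := by
  have h := expect_abs_le_sqrt fun p : Ω × Ω' => f p.1 p.2
  have e : ∀ g : Ω → Ω' → ℝ, 𝔼 p : Ω × Ω', g p.1 p.2 = 𝔼 x, 𝔼 y, g x y := fun g => by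
    rw [← Finset.univ_product_univ, Finset.expect_product]
  rwa [e fun x y => |f x y|, e fun x y => f x y ^ 2] at h

/-- A quantitative central limit theorem for random trilinear forms with small line sums, on the
level of characteristic functions. -/
theorem LineBound.norm_charFun_sub_le {l : ι → ι → ι → ℝ} {κ : ℝ} (h : LineBound l κ) (hκ : 0 ≤ κ)
    (θ : ℝ) :
    ‖𝔼 x : ι → ZMod 2, 𝔼 y : ι → ZMod 2, 𝔼 z : ι → ZMod 2, Complex.exp
        (((θ * ∑ a, ∑ b, ∑ c, l a b c * (sgn (x a) * sgn (y b) * sgn (z c)) : ℝ) : ℂ) * Complex.I) -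
      (Real.exp (-(θ ^ 2 / 2 * ∑ a, ∑ b, ∑ c, l a b c ^ 2)) : ℂ)‖ ≤
    6 * θ ^ 4 * ((Fintype.card ι : ℝ) ^ 3 * κ ^ 4) +
      θ ^ 2 / 2 * Real.sqrt (16 * ((Fintype.card ι : ℝ) ^ 3 * κ ^ 4)) := by
  set G := ∑ a, ∑ b, ∑ c, l a b c ^ 2 with hG
  have h1 : ∀ x y : ι → ZMod 2, 𝔼 z : ι → ZMod 2, Complex.exp
      (((θ * ∑ a, ∑ b, ∑ c, l a b c * (sgn (x a) * sgn (y b) * sgn (z c)) : ℝ) : ℂ) * Complex.I) =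
      ((∏ c, Real.cos (θ * pairForm l x y c) : ℝ) : ℂ) := by
    intro x y
    simp_rw [trilinear_eq, Finset.mul_sum, ← mul_assoc]
    rw [expect_exp_linear]
    push_cast; rfl
  have h2 : 𝔼 x : ι → ZMod 2, 𝔼 y : ι → ZMod 2, 𝔼 z : ι → ZMod 2, Complex.exp
        (((θ * ∑ a, ∑ b, ∑ c, l a b c * (sgn (x a) * sgn (y b) * sgn (z c)) : ℝ) : ℂ) * Complex.I) -
      (Real.exp (-(θ ^ 2 / 2 * G)) : ℂ) =
      ((𝔼 x : ι → ZMod 2, 𝔼 y : ι → ZMod 2, (∏ c, Real.cos (θ * pairForm l x y c) -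
        Real.exp (-(θ ^ 2 / 2 * G))) : ℝ) : ℂ) := by
    simp_rw [h1, Finset.expect_sub_distrib, Fintype.expect_const]
    simp only [Complex.ofReal_sub, Complex.ofReal_expect]
  rw [h2, Complex.norm_real, Real.norm_eq_abs]
  have hpt : ∀ x y : ι → ZMod 2, |∏ c, Real.cos (θ * pairForm l x y c) -
      Real.exp (-(θ ^ 2 / 2 * G))| ≤
      2 * θ ^ 4 * ∑ c, pairForm l x y c ^ 4 + θ ^ 2 / 2 * |∑ c, pairForm l x y c ^ 2 - G| := by
    intro x y
    have a1 : Real.exp (-(θ ^ 2 / 2 * ∑ c, pairForm l x y c ^ 2)) =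
        ∏ c, Real.exp (-((θ * pairForm l x y c) ^ 2 / 2)) := by
      rw [← Real.exp_sum]; congr 1
      rw [Finset.sum_neg_distrib, Finset.mul_sum]; congr 1
      exact Finset.sum_congr rfl fun _ _ => by ring
    refine (abs_sub_le _ (Real.exp (-(θ ^ 2 / 2 * ∑ c, pairForm l x y c ^ 2))) _).trans
      (add_le_add ?_ ?_)
    · rw [a1, Finset.mul_sum]
      refine (abs_prod_sub_prod_le _ _ _ (fun _ _ => Real.abs_cos_le_one _) fun _ _ => ?_).trans
        (Finset.sum_le_sum fun c _ => (abs_cos_sub_exp_le _).trans (le_of_eq (by ring)))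
      rw [abs_of_pos (Real.exp_pos _)]
      exact Real.exp_le_one_iff.mpr (by simp; positivity)
    · refine (abs_exp_neg_sub_exp_neg_le ?_ ?_).trans (le_of_eq ?_)
      · positivity
      · positivity
      · rw [← mul_sub, abs_mul, abs_of_nonneg (by positivity)]
  have hnorm : ∀ f : (ι → ZMod 2) → ℝ, |𝔼 x, f x| ≤ 𝔼 x, |f x| := fun f => norm_expect_le f
  calc _ ≤ 𝔼 x : ι → ZMod 2, 𝔼 y : ι → ZMod 2, |∏ c, Real.cos (θ * pairForm l x y c) -
        Real.exp (-(θ ^ 2 / 2 * G))| :=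
        (hnorm _).trans (Finset.expect_le_expect fun x _ => hnorm _)
    _ ≤ 𝔼 x : ι → ZMod 2, 𝔼 y : ι → ZMod 2, (2 * θ ^ 4 * ∑ c, pairForm l x y c ^ 4 +
          θ ^ 2 / 2 * |∑ c, pairForm l x y c ^ 2 - G|) :=
        Finset.expect_le_expect fun x _ => Finset.expect_le_expect fun y _ => hpt x y
    _ = 2 * θ ^ 4 * 𝔼 x : ι → ZMod 2, 𝔼 y : ι → ZMod 2, ∑ c, pairForm l x y c ^ 4 +
          θ ^ 2 / 2 * 𝔼 x : ι → ZMod 2, 𝔼 y : ι → ZMod 2, |∑ c, pairForm l x y c ^ 2 - G| := by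
        simp_rw [Finset.expect_add_distrib, ← Finset.mul_expect]
    _ ≤ 2 * θ ^ 4 * (3 * (Fintype.card ι : ℝ) ^ 3 * κ ^ 4) +
          θ ^ 2 / 2 * Real.sqrt (16 * ((Fintype.card ι : ℝ) ^ 3 * κ ^ 4)) := by
        gcongr
        · exact (Finset.expect_le_expect fun x _ => h.expect_pairForm_four_le x).trans (by simp)
        · exact (expect_expect_abs_le_sqrt _).trans (Real.sqrt_le_sqrt (h.expect_sub_sq_le hκ))
    _ = _ := by ring

end Chaos

end

section

/-- Arrays of `m` binary digits in each of three coordinates. -/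
abbrev Dig (m : ℕ) := Fin 3 → Fin m → ZMod 2

/-- The arrays agree on the first `d i` digits of each coordinate `i`. -/
def Agree {m : ℕ} (d : Fin 3 → ℕ) (x v : Dig m) : Prop :=
  ∀ i (j : Fin m), (j : ℕ) < d i → x i j = v i j

/-- The number of points in the dyadic box prescribed by the first digits of `v`. -/
def cnt {m : ℕ} {N : Type*} [Fintype N] (x : N → Dig m) (d : Fin 3 → ℕ) (v : Dig m) : ℝ :=
  ∑ n, if Agree d (x n) v then 1 else 0

/-- The expected number of points of a net with `2 ^ m` points in a dyadic box. -/
def boxMean (m : ℕ) (d : Fin 3 → ℕ) : ℝ := 2 ^ m * (1 / 2) ^ ∑ i, d i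

/-- The digit arrays of a `(t,m,3)`-net. -/
def DNet {m : ℕ} {N : Type*} [Fintype N] (t : ℕ) (x : N → Dig m) : Prop :=
  Fintype.card N = 2 ^ m ∧ ∀ d : Fin 3 → ℕ, ∑ i, d i + t ≤ m → ∀ v, cnt x d v = boxMean m d

/-- The array with a digit `1` exactly at the positions `A i` (counted from one). -/
def unitArr {m : ℕ} (A : Fin 3 → ℕ) : Dig m := fun i j => if (j : ℕ) + 1 = A i then 1 else 0

/-- The number of points in the box `Π_A` shifted by `z`. -/
def boxCnt {m : ℕ} {N : Type*} [Fintype N] (x : N → Dig m) (A : Fin 3 → ℕ) (z : Dig m) : ℝ :=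
  cnt x A (z + unitArr A)

/-- The local discrepancy of the box `Π_A` shifted by `z`. -/
def lam {m : ℕ} {N : Type*} [Fintype N] (x : N → Dig m) (A : Fin 3 → ℕ) (z : Dig m) : ℝ :=
  boxCnt x A z - boxMean m A

/-- Delete the first `d i` digits. -/
def mask {m : ℕ} (d : Fin 3 → ℕ) (w : Dig m) : Dig m := fun i j => if (j : ℕ) < d i then 0 else w i j

lemma expect_prod_pi {ι V : Type*} [Fintype ι] [DecidableEq ι] [Fintype V] (f : ι → V → ℝ) :
    𝔼 w : ι → V, ∏ i, f i (w i) = ∏ i, 𝔼 v, f i v := by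
  simp_rw [Fintype.expect_eq_sum_div_card, Finset.prod_div_distrib]
  rw [Finset.prod_univ_sum, Fintype.piFinset_univ]
  simp

lemma expect_zmod_two (f : ZMod 2 → ℝ) : 𝔼 u, f u = (f 0 + f 1) / 2 := by
  rw [Fintype.expect_eq_sum_div_card]
  have : ∑ u, f u = f 0 + f 1 := Fin.sum_univ_two f
  rw [this, ZMod.card]; norm_num

lemma expect_indicator_eq (a b : ZMod 2) :
    𝔼 u : ZMod 2, (if a = b + u then (1 : ℝ) else 0) = 1 / 2 := by
  rw [expect_zmod_two]
  rcases zmod_two_cases a with h | h <;> rcases zmod_two_cases b with h' | h' <;> subst h <;>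
    subst h' <;> simp [CharTwo.add_self_eq_zero]

lemma agree_indicator {m : ℕ} (d : Fin 3 → ℕ) (x v : Dig m) :
    (if Agree d x v then (1 : ℝ) else 0) =
      ∏ i, ∏ j : Fin m, if (j : ℕ) < d i then (if x i j = v i j then 1 else 0) else 1 := by
  split_ifs with h
  · refine (Finset.prod_eq_one fun i _ => Finset.prod_eq_one fun j _ => ?_).symm
    split_ifs with h1 h2
    · rfl
    · exact absurd (h i j h1) h2
    · rfl
  · unfold Agree at h
    push Not at h
    obtain ⟨i, j, h1, h2⟩ := h
    refine (Finset.prod_eq_zero (Finset.mem_univ i) (Finset.prod_eq_zero (Finset.mem_univ j) ?_)).symm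
    rw [if_pos h1, if_neg h2]

lemma prod_ite_half (m d d' : ℕ) (h : d' ≤ m) :
    ∏ j : Fin m, (if d ≤ (j : ℕ) ∧ (j : ℕ) < d' then (1 / 2 : ℝ) else 1) = (1 / 2) ^ (d' - d) := by
  rw [Fin.prod_univ_eq_prod_range (fun j => if d ≤ j ∧ j < d' then (1 / 2 : ℝ) else 1),
    Finset.prod_ite, Finset.prod_const_one, mul_one, Finset.prod_const]
  congr 1
  rw [← Nat.card_Ico]
  congr 1
  ext j; simp; omega

lemma expect_agree_mask {m : ℕ} (d d' : Fin 3 → ℕ) (hd' : ∀ i, d' i ≤ m) (x v : Dig m) :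
    𝔼 w : Dig m, (if Agree d' x (v + mask d w) then (1 : ℝ) else 0) =
      (1 / 2) ^ (∑ i, (d' i - d i)) * if Agree (fun i => min (d i) (d' i)) x v then 1 else 0 := by
  simp_rw [agree_indicator]
  have h1 : ∀ i, 𝔼 w : Fin m → ZMod 2, ∏ j : Fin m, (if (j : ℕ) < d' i then
      (if x i j = v i j + (if (j : ℕ) < d i then 0 else w j) then (1 : ℝ) else 0) else 1) =
      ∏ j : Fin m, 𝔼 u, (if (j : ℕ) < d' i then
      (if x i j = v i j + (if (j : ℕ) < d i then 0 else u) then (1 : ℝ) else 0) else 1) :=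
    fun i => expect_prod_pi (fun (j : Fin m) u => if (j : ℕ) < d' i then
      (if x i j = v i j + (if (j : ℕ) < d i then 0 else u) then (1 : ℝ) else 0) else 1)
  have h2 : 𝔼 w : Dig m, ∏ i, ∏ j : Fin m, (if (j : ℕ) < d' i then
      (if x i j = (v + mask d w) i j then (1 : ℝ) else 0) else 1) =
      ∏ i, 𝔼 w : Fin m → ZMod 2, ∏ j : Fin m, (if (j : ℕ) < d' i then
      (if x i j = v i j + (if (j : ℕ) < d i then 0 else w j) then (1 : ℝ) else 0) else 1) :=
    expect_prod_pi (fun i (w : Fin m → ZMod 2) => ∏ j : Fin m, (if (j : ℕ) < d' i then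
      (if x i j = v i j + (if (j : ℕ) < d i then 0 else w j) then (1 : ℝ) else 0) else 1))
  rw [h2, ← Finset.prod_pow_eq_pow_sum, ← Finset.prod_mul_distrib]
  refine Finset.prod_congr rfl fun i _ => ?_
  rw [h1, ← prod_ite_half m (d i) (d' i) (hd' i), ← Finset.prod_mul_distrib]
  refine Finset.prod_congr rfl fun j _ => ?_
  by_cases hj' : (j : ℕ) < d' i
  · by_cases hj : (j : ℕ) < d i
    · simp [hj, hj', not_le.mpr hj]
    · simp only [if_pos hj', if_neg hj, expect_indicator_eq]
      simp [hj, hj', not_lt.mp hj]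
  · simp [hj']

variable {m : ℕ} {N : Type*} [Fintype N] (x : N → Dig m)

lemma expect_cnt_mask (d d' : Fin 3 → ℕ) (hd' : ∀ i, d' i ≤ m) (v : Dig m) :
    𝔼 w : Dig m, cnt x d' (v + mask d w) =
      (1 / 2) ^ (∑ i, (d' i - d i)) * cnt x (fun i => min (d i) (d' i)) v := by
  unfold cnt
  rw [Finset.expect_sum_comm, Finset.mul_sum]
  exact Finset.sum_congr rfl fun n _ => expect_agree_mask d d' hd' _ _

lemma expect_add_left {G : Type*} [Fintype G] [AddGroup G] (f : G → ℝ) (w : G) :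
    𝔼 z, f (z + w) = 𝔼 z, f z :=
  Fintype.expect_equiv (Equiv.addRight w) _ _ fun _ => rfl

lemma cnt_nonneg (d : Fin 3 → ℕ) (v : Dig m) : 0 ≤ cnt x d v :=
  Finset.sum_nonneg fun _ _ => by split_ifs <;> norm_num

lemma cnt_mono {d d' : Fin 3 → ℕ} (h : ∀ i, d i ≤ d' i) (v : Dig m) : cnt x d' v ≤ cnt x d v := by
  refine Finset.sum_le_sum fun n _ => ?_
  split_ifs with h1 h2 h2
  · rfl
  · exact absurd (fun i j hj => h1 i j (hj.trans_le (h i))) h2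
  · norm_num
  · rfl

lemma boxCnt_add_mask (B : Fin 3 → ℕ) (z w : Dig m) : boxCnt x B (z + mask B w) = boxCnt x B z := by
  refine Finset.sum_congr rfl fun n _ => ?_
  congr 1
  refine propext (forall_congr' fun i => forall_congr' fun j => forall_congr' fun hj => ?_)
  simp [mask, hj]

lemma boxMean_nonneg (m : ℕ) (A : Fin 3 → ℕ) : 0 ≤ boxMean m A := by unfold boxMean; positivity

lemma expect_boxCnt (hc : Fintype.card N = 2 ^ m) (A : Fin 3 → ℕ) (hA : ∀ i, A i ≤ m) :
    𝔼 z : Dig m, boxCnt x A z = boxMean m A := by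
  have h := expect_cnt_mask x 0 A hA (unitArr A)
  have e : ∀ w : Dig m, unitArr A + mask 0 w = w + unitArr A := fun w => by
    rw [add_comm]; rfl
  simp_rw [e] at h
  refine h.trans ?_
  simp [cnt, Agree, hc, boxMean, mul_comm]

variable {x} {t : ℕ}

lemma exists_le_sum_eq (A : Fin 3 → ℕ) (k : ℕ) (h : k ≤ ∑ i, A i) :
    ∃ d : Fin 3 → ℕ, (∀ i, d i ≤ A i) ∧ ∑ i, d i = k := by
  rw [Fin.sum_univ_three] at h
  refine ⟨![min (A 0) k, min (A 1) (k - A 0), k - A 0 - A 1], fun i => ?_, ?_⟩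
  · match i with
    | 0 => simp
    | 1 => simp
    | 2 => simp; omega
  · simp [Fin.sum_univ_three]; omega

lemma DNet.lam_eq_zero (hx : DNet t x) {A : Fin 3 → ℕ} (h : ∑ i, A i + t ≤ m) (z : Dig m) :
    lam x A z = 0 := by
  rw [lam, boxCnt, hx.2 A h, sub_self]

lemma DNet.cnt_le (hx : DNet t x) (ht : t ≤ m) {A : Fin 3 → ℕ} (h : m ≤ ∑ i, A i + t) (v : Dig m) :
    cnt x A v ≤ 2 ^ t := by
  obtain ⟨d, hd, hs⟩ := exists_le_sum_eq A (m - t) (by omega)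
  refine (cnt_mono x hd v).trans (le_of_eq ?_)
  rw [hx.2 d (by omega), boxMean, hs]
  have : (2 : ℝ) ^ m = 2 ^ t * 2 ^ (m - t) := by rw [← pow_add]; congr 1; omega
  rw [this, mul_assoc, ← mul_pow]; norm_num

lemma boxMean_le {A : Fin 3 → ℕ} (h : m ≤ ∑ i, A i + t) : boxMean m A ≤ 2 ^ t := by
  unfold boxMean
  calc (2 : ℝ) ^ m * (1 / 2) ^ ∑ i, A i ≤ 2 ^ (∑ i, A i + t) * (1 / 2) ^ ∑ i, A i := by
        gcongr; norm_num
    _ = 2 ^ t := by rw [pow_add, mul_assoc, mul_comm, mul_assoc, ← mul_pow]; norm_num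

lemma DNet.abs_lam_le (hx : DNet t x) (ht : t ≤ m) {A : Fin 3 → ℕ} (h : m ≤ ∑ i, A i + t)
    (z : Dig m) : |lam x A z| ≤ 2 ^ t := by
  have h1 : boxCnt x A z ≤ 2 ^ t := hx.cnt_le ht h _
  have h2 : 0 ≤ boxCnt x A z := cnt_nonneg _ _ _
  have h3 := boxMean_le h
  have h4 := boxMean_nonneg m A
  rw [lam, abs_le]; constructor <;> linarith

lemma DNet.expect_lam (hx : DNet t x) {A : Fin 3 → ℕ} (hA : ∀ i, A i ≤ m) :
    𝔼 z : Dig m, lam x A z = 0 := by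
  simp_rw [lam, Finset.expect_sub_distrib, expect_boxCnt x hx.1 A hA]
  simp

lemma DNet.expect_boxCnt_mul (hx : DNet t x) {A B : Fin 3 → ℕ} (hA : ∀ i, A i ≤ m)
    (hB : ∀ i, B i ≤ m) (h : ∑ i, min (B i) (A i) + t ≤ m) :
    𝔼 z : Dig m, boxCnt x A z * boxCnt x B z = boxMean m A * boxMean m B := by
  have h1 : ∀ w : Dig m, 𝔼 z : Dig m, boxCnt x A z * boxCnt x B z =
      𝔼 z, boxCnt x A (z + mask B w) * boxCnt x B z := fun w => by
    rw [← expect_add_left _ (mask B w)]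
    simp_rw [boxCnt_add_mask]
  have h2 : 𝔼 z : Dig m, boxCnt x A z * boxCnt x B z =
      𝔼 w : Dig m, 𝔼 z, boxCnt x A (z + mask B w) * boxCnt x B z := by
    rw [Finset.expect_congr rfl fun w _ => (h1 w).symm]; simp
  rw [h2, Finset.expect_comm]
  simp_rw [← Finset.expect_mul]
  have h3 : ∀ z : Dig m, 𝔼 w : Dig m, boxCnt x A (z + mask B w) = boxMean m A := fun z => by
    have := expect_cnt_mask x B A hA (z + unitArr A)
    rw [hx.2 _ h, boxMean] at this
    have e : ∀ w : Dig m, boxCnt x A (z + mask B w) = cnt x A (z + unitArr A + mask B w) :=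
      fun w => by rw [boxCnt, add_right_comm]
    simp_rw [e]
    rw [this, boxMean, mul_left_comm, ← pow_add, ← Finset.sum_add_distrib]
    congr 3
    ext i
    omega
  simp_rw [h3]
  rw [← Finset.mul_expect, expect_boxCnt x hx.1 B hB]

lemma DNet.expect_lam_mul (hx : DNet t x) {A B : Fin 3 → ℕ} (hA : ∀ i, A i ≤ m)
    (hB : ∀ i, B i ≤ m) (h : ∑ i, min (B i) (A i) + t ≤ m) :
    𝔼 z : Dig m, lam x A z * lam x B z = 0 := by
  have e : ∀ z : Dig m, lam x A z * lam x B z = boxCnt x A z * boxCnt x B z -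
      boxMean m B * boxCnt x A z - boxMean m A * boxCnt x B z + boxMean m A * boxMean m B := by
    intro z; unfold lam; ring
  simp_rw [e, Finset.expect_add_distrib, Finset.expect_sub_distrib, ← Finset.mul_expect]
  rw [hx.expect_boxCnt_mul hA hB h, expect_boxCnt x hx.1 A hA, expect_boxCnt x hx.1 B hB]
  simp; ring

lemma DNet.expect_lam_sq_le (hx : DNet t x) (ht : t ≤ m) {A : Fin 3 → ℕ} (hA : ∀ i, A i ≤ m)
    (h : m ≤ ∑ i, A i + t) : 𝔼 z : Dig m, lam x A z ^ 2 ≤ 2 ^ t * boxMean m A := by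
  have e : ∀ z : Dig m, lam x A z ^ 2 ≤ 2 ^ t * boxCnt x A z -
      2 * boxMean m A * boxCnt x A z + boxMean m A ^ 2 := by
    intro z
    have h1 : boxCnt x A z ≤ 2 ^ t := hx.cnt_le ht h _
    have h2 : 0 ≤ boxCnt x A z := cnt_nonneg _ _ _
    unfold lam
    nlinarith
  refine (Finset.expect_le_expect fun z _ => e z).trans ?_
  simp_rw [Finset.expect_add_distrib, Finset.expect_sub_distrib, ← Finset.mul_expect]
  rw [expect_boxCnt x hx.1 A hA]
  simp; nlinarith [boxMean_nonneg m A]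

end

section

lemma Agree.symm {m : ℕ} {d : Fin 3 → ℕ} {x v : Dig m} (h : Agree d x v) : Agree d v x :=
  fun i j hj => (h i j hj).symm

lemma Agree.trans {m : ℕ} {d : Fin 3 → ℕ} {x v w : Dig m} (h : Agree d x v) (h' : Agree d v w) :
    Agree d x w := fun i j hj => (h i j hj).trans (h' i j hj)

section
variable {m : ℕ} {N : Type*} [Fintype N]

/-- The number of points whose digits differ from the digits of the comparison array. -/
def defect (x g : N → Dig m) (A : Fin 3 → ℕ) : ℝ := ∑ n, if Agree A (x n) (g n) then 0 else 1

variable {x g : N → Dig m} {t : ℕ}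

lemma cnt_congr {A : Fin 3 → ℕ} {v w : Dig m} (h : Agree A v w) : cnt x A v = cnt x A w := by
  refine Finset.sum_congr rfl fun n _ => ?_
  congr 1
  exact propext ⟨fun h' => h'.trans h, fun h' => h'.trans h.symm⟩

lemma class_sum_le (hx : DNet t x) (ht : t ≤ m) {A : Fin 3 → ℕ} (h : m ≤ ∑ i, A i + t) {κ : ℝ}
    (hκ : ∀ n, cnt g A (g n) = κ) :
    ∑ n, |cnt x A (x n) - min κ (2 ^ t)| ≤ 3 * 2 ^ t * defect x g A := by
  have hle : ∀ v, cnt x A v ≤ 2 ^ t := fun v => hx.cnt_le ht h v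
  have h0 : ∀ v, 0 ≤ cnt x A v := fun v => cnt_nonneg _ _ _
  have hg0 : ∀ v, 0 ≤ cnt g A v := fun v => cnt_nonneg _ _ _
  set c : N → ℝ := fun n => if Agree A (x n) (g n) then 0 else 1 with hc
  have hc0 : ∀ n, 0 ≤ c n := fun n => by simp only [hc]; split_ifs <;> norm_num
  have hc1 : ∀ n, 0 ≤ 1 - c n := fun n => by simp only [hc]; split_ifs <;> norm_num
  have key : ∀ n, |cnt x A (x n) - min κ (2 ^ t)| ≤ 2 ^ t * c n +
      ∑ n', (1 - c n) * c n' * (if Agree A (x n') (x n) then 1 else 0) +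
      ∑ n', (1 - c n) * c n' * (if Agree A (g n') (g n) then 1 else 0) := by
    intro n
    have hk := hκ n
    have hk0 := hg0 (g n)
    by_cases hn : Agree A (x n) (g n)
    · have hcn : c n = 0 := if_pos hn
      simp only [hcn, sub_zero, one_mul, mul_zero, zero_add]
      set r := ∑ n', c n' * (if Agree A (x n') (x n) then (1 : ℝ) else 0) with hr
      set f := ∑ n', c n' * (if Agree A (g n') (g n) then (1 : ℝ) else 0) with hf
      have hr0 : 0 ≤ r := Finset.sum_nonneg fun n' _ =>
        mul_nonneg (hc0 n') (by split_ifs <;> norm_num)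
      have hf0 : 0 ≤ f := Finset.sum_nonneg fun n' _ =>
        mul_nonneg (hc0 n') (by split_ifs <;> norm_num)
      have e : cnt x A (x n) - r = κ - f := by
        rw [← hk, cnt, cnt, hr, hf, ← Finset.sum_sub_distrib, ← Finset.sum_sub_distrib]
        refine Finset.sum_congr rfl fun n' _ => ?_
        by_cases hn' : Agree A (x n') (g n')
        · have hcn' : c n' = 0 := if_pos hn'
          have : Agree A (x n') (x n) ↔ Agree A (g n') (g n) :=
            ⟨fun h => hn'.symm.trans (h.trans hn), fun h => hn'.trans (h.trans hn.symm)⟩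
          simp [hcn', this]
        · have hcn' : c n' = 1 := if_neg hn'
          simp [hcn']
      have := hle (x n)
      rcases le_total κ (2 ^ t) with hh | hh
      · rw [min_eq_left hh, abs_le]; constructor <;> linarith
      · rw [min_eq_right hh, abs_le]; constructor <;> linarith
    · have hcn : c n = 1 := if_neg hn
      simp only [hcn, sub_self, zero_mul, Finset.sum_const_zero, add_zero, mul_one]
      have h1 := hle (x n)
      have h2 := h0 (x n)
      have h3 : 0 ≤ min κ (2 ^ t) := le_min (by linarith) (by positivity)
      have h4 : min κ ((2 : ℝ) ^ t) ≤ 2 ^ t := min_le_right _ _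
      rw [abs_le]; constructor <;> linarith
  have hR : ∑ n, ∑ n', (1 - c n) * c n' * (if Agree A (x n') (x n) then (1 : ℝ) else 0) ≤
      2 ^ t * ∑ n, c n := by
    rw [Finset.sum_comm, Finset.mul_sum]
    refine Finset.sum_le_sum fun n' _ => ?_
    calc _ ≤ ∑ n, c n' * (if Agree A (x n) (x n') then (1 : ℝ) else 0) := by
          refine Finset.sum_le_sum fun n _ => ?_
          by_cases hh : Agree A (x n) (x n')
          · rw [if_pos hh, if_pos hh.symm]
            nlinarith [hc0 n, hc0 n', mul_nonneg (hc0 n) (hc0 n')]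
          · rw [if_neg hh, if_neg fun h => hh h.symm]; simp
      _ = c n' * cnt x A (x n') := by rw [← Finset.mul_sum]; rfl
      _ ≤ 2 ^ t * c n' := by rw [mul_comm]; exact mul_le_mul_of_nonneg_right (hle _) (hc0 _)
  have hF : ∑ n, ∑ n', (1 - c n) * c n' * (if Agree A (g n') (g n) then (1 : ℝ) else 0) ≤
      2 ^ t * ∑ n, c n := by
    rw [Finset.sum_comm, Finset.mul_sum]
    refine Finset.sum_le_sum fun n' _ => ?_
    by_cases hex : ∃ n0, Agree A (x n0) (g n0) ∧ Agree A (g n') (g n0)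
    · obtain ⟨n0, h1, h2⟩ := hex
      calc _ ≤ ∑ n, c n' * (if Agree A (x n) (x n0) then (1 : ℝ) else 0) := by
            refine Finset.sum_le_sum fun n _ => ?_
            by_cases hn : Agree A (x n) (g n)
            · have hcn : c n = 0 := if_pos hn
              rw [hcn, sub_zero, one_mul]
              by_cases hh : Agree A (g n') (g n)
              · rw [if_pos hh, if_pos (hn.trans (hh.symm.trans (h2.trans h1.symm)))]
              · rw [if_neg hh, mul_zero]
                exact mul_nonneg (hc0 _) (by split_ifs <;> norm_num)
            · have hcn : c n = 1 := if_neg hn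
              rw [hcn, sub_self, zero_mul, zero_mul]
              exact mul_nonneg (hc0 _) (by split_ifs <;> norm_num)
        _ = c n' * cnt x A (x n0) := by rw [← Finset.mul_sum]; rfl
        _ ≤ 2 ^ t * c n' := by rw [mul_comm]; exact mul_le_mul_of_nonneg_right (hle _) (hc0 _)
    · rw [Finset.sum_eq_zero]
      · have := hc0 n'; positivity
      · intro n _
        by_cases hn : Agree A (x n) (g n)
        · rw [if_neg fun h => hex ⟨n, hn, h⟩, mul_zero]
        · have hcn : c n = 1 := if_neg hn
          rw [hcn, sub_self, zero_mul, zero_mul]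
  refine (Finset.sum_le_sum fun n _ => key n).trans ?_
  rw [Finset.sum_add_distrib, Finset.sum_add_distrib, ← Finset.mul_sum]
  have : defect x g A = ∑ n, c n := rfl
  rw [this]
  linarith

lemma boxCnt_sq (A : Fin 3 → ℕ) (z : Dig m) : boxCnt x A z ^ 2 =
    ∑ n, (if Agree A (x n) (z + unitArr A) then 1 else 0) * cnt x A (x n) := by
  rw [sq]
  nth_rw 1 [boxCnt]
  rw [cnt, Finset.sum_mul]
  refine Finset.sum_congr rfl fun n _ => ?_
  by_cases h : Agree A (x n) (z + unitArr A)
  · rw [if_pos h, one_mul, one_mul, boxCnt, cnt_congr h]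
  · rw [if_neg h, zero_mul, zero_mul]

lemma expect_agree {A : Fin 3 → ℕ} (hA : ∀ i, A i ≤ m) (v u : Dig m) :
    𝔼 z : Dig m, (if Agree A v (z + u) then (1 : ℝ) else 0) = (1 / 2) ^ ∑ i, A i := by
  have h := expect_agree_mask 0 A hA v u
  have e : ∀ w : Dig m, u + mask 0 w = w + u := fun w => by
    rw [add_comm]; rfl
  simp_rw [e] at h
  refine h.trans ?_
  simp [Agree]

lemma expect_boxCnt_sq_sub_le (hx : DNet t x) (ht : t ≤ m) {A : Fin 3 → ℕ} (hA : ∀ i, A i ≤ m)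
    (h : m ≤ ∑ i, A i + t) {κ : ℝ} (hκ : ∀ n, cnt g A (g n) = κ) :
    𝔼 z : Dig m, |boxCnt x A z ^ 2 - min κ (2 ^ t) * boxCnt x A z| ≤
      (1 / 2) ^ (∑ i, A i) * (3 * 2 ^ t * defect x g A) := by
  have e : ∀ z : Dig m, |boxCnt x A z ^ 2 - min κ (2 ^ t) * boxCnt x A z| ≤
      ∑ n, |cnt x A (x n) - min κ (2 ^ t)| * (if Agree A (x n) (z + unitArr A) then 1 else 0) := by
    intro z
    rw [boxCnt_sq, boxCnt, cnt, Finset.mul_sum, ← Finset.sum_sub_distrib]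
    refine (Finset.abs_sum_le_sum_abs _ _).trans (Finset.sum_le_sum fun n _ => ?_)
    split_ifs <;> simp [cnt]
  refine (Finset.expect_le_expect fun z _ => e z).trans ?_
  simp_rw [Finset.expect_sum_comm, ← Finset.mul_expect, expect_agree hA]
  rw [← Finset.sum_mul, mul_comm]
  exact mul_le_mul_of_nonneg_left (class_sum_le hx ht h hκ) (by positivity)

end

/-- The dominant indices of the expansion of the discrepancy. -/
def mainIdx (m t W : ℕ) : Finset (Fin 3 → ℕ) :=
  (Fintype.piFinset fun _ => Finset.Icc 1 m).filter fun A => m < ∑ i, A i + t ∧ ∑ i, A i < m + W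

lemma mem_mainIdx {m t W : ℕ} {A : Fin 3 → ℕ} : A ∈ mainIdx m t W ↔
    (∀ i, 1 ≤ A i ∧ A i ≤ m) ∧ m < ∑ i, A i + t ∧ ∑ i, A i < m + W := by
  simp [mainIdx, Fintype.mem_piFinset]

lemma card_mainIdx_le (m t W : ℕ) : (mainIdx m t W).card ≤ m ^ 2 * (W + t) := by
  have h : (mainIdx m t W).card ≤
      (Finset.Icc 1 m ×ˢ Finset.Icc 1 m ×ˢ Finset.range (W + t)).card := by
    refine Finset.card_le_card_of_injOn (fun A => (A 0, A 1, ∑ i, A i + t - m)) ?_ ?_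
    · intro A hA
      have hA := mem_mainIdx.mp (Finset.mem_coe.mp hA)
      simp only [Finset.coe_product, Set.mem_prod, Finset.coe_Icc, Set.mem_Icc, Finset.coe_range,
        Set.mem_Iio]
      exact ⟨hA.1 0, hA.1 1, by omega⟩
    · intro A hA B hB hAB
      have hA := mem_mainIdx.mp (Finset.mem_coe.mp hA)
      have hB := mem_mainIdx.mp (Finset.mem_coe.mp hB)
      simp only [Fin.sum_univ_three, Prod.mk.injEq] at hA hB hAB
      ext i
      match i with
      | 0 => omega
      | 1 => omega
      | 2 => omega
  refine h.trans (le_of_eq ?_)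
  simp [Finset.card_product]; ring

lemma card_close_le {m t W : ℕ} {A : Fin 3 → ℕ} (hA : A ∈ mainIdx m t W) :
    ((mainIdx m t W).filter fun B => m < ∑ i, min (B i) (A i) + t).card ≤ (2 * (W + t)) ^ 3 := by
  have hA := mem_mainIdx.mp hA
  calc _ ≤ (Fintype.piFinset fun i => Finset.Ico (A i - (W + t)) (A i + (W + t))).card := by
        refine Finset.card_le_card fun B hB => ?_
        obtain ⟨hB, h⟩ := Finset.mem_filter.mp hB
        have hB := mem_mainIdx.mp hB
        rw [Fintype.mem_piFinset]
        simp only [Fin.sum_univ_three, Finset.mem_Ico] at *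
        intro i
        match i with
        | 0 => constructor <;> omega
        | 1 => constructor <;> omega
        | 2 => constructor <;> omega
    _ = ∏ i, ((A i + (W + t)) - (A i - (W + t))) := by simp
    _ ≤ ∏ _i : Fin 3, 2 * (W + t) := Finset.prod_le_prod' fun i _ => by omega
    _ = _ := by simp

lemma sum_geom_half_le (m : ℕ) : ∑ a ∈ Finset.Icc 1 m, (1 / 2 : ℝ) ^ a ≤ 1 := by
  have : ∑ a ∈ Finset.Icc 1 m, (1 / 2 : ℝ) ^ a = 1 - (1 / 2) ^ m := by
    induction m with
    | zero => simp
    | succ k ih => rw [Finset.sum_Icc_succ_top (by omega), ih]; ring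
  rw [this]; linarith [pow_pos (show (0 : ℝ) < 1 / 2 by norm_num) m]

lemma sum_weight_le (m t W : ℕ) (k : Fin 3) :
    ∑ A ∈ mainIdx m t W, (1 / 2 : ℝ) ^ (∑ i, A i) * 2 ^ A k ≤ m := by
  calc _ ≤ ∑ A ∈ Fintype.piFinset fun _ : Fin 3 => Finset.Icc 1 m,
        (1 / 2 : ℝ) ^ (∑ i, A i) * 2 ^ A k :=
        Finset.sum_le_sum_of_subset_of_nonneg (Finset.filter_subset _ _) fun _ _ _ => by positivity
    _ = ∑ A ∈ Fintype.piFinset fun _ : Fin 3 => Finset.Icc 1 m,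
        ∏ i, (fun i a => (1 / 2 : ℝ) ^ a * if i = k then 2 ^ a else 1) i (A i) := by
        refine Finset.sum_congr rfl fun A _ => ?_
        rw [← Finset.prod_pow_eq_pow_sum, Finset.prod_mul_distrib]
        simp
    _ = ∏ i : Fin 3, ∑ a ∈ Finset.Icc 1 m, (1 / 2 : ℝ) ^ a * if i = k then 2 ^ a else 1 := by
        rw [Finset.prod_univ_sum]
    _ ≤ ∏ i : Fin 3, if i = k then (m : ℝ) else 1 := by
        refine Finset.prod_le_prod (fun i _ => Finset.sum_nonneg fun a _ => by
          split_ifs <;> positivity) fun i _ => ?_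
        split_ifs
        · refine le_of_eq ?_
          rw [Finset.sum_congr rfl (g := fun _ => (1 : ℝ))]
          · simp
          · intro a _; rw [← mul_pow]; norm_num
        · simpa using sum_geom_half_le m
    _ = m := by simp

/-- The conditional variance of the main part of the discrepancy, up to a factor. -/
def gramSum {m : ℕ} {N : Type*} [Fintype N] (x : N → Dig m) (t W : ℕ) (z : Dig m) : ℝ :=
  ∑ A ∈ mainIdx m t W, lam x A z ^ 2

/-- The digit arrays `x` of a net are close to the digit arrays `g` of a digital net. -/
structure NearDigital {m : ℕ} {N : Type*} [Fintype N] (t : ℕ) (x g : N → Dig m) : Prop where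
  net : DNet t x
  le : t ≤ m
  cls : ∀ A, ∃ κ : ℝ, ∀ n, cnt g A (g n) = κ
  defect_le : ∀ A, defect x g A ≤ 2 ^ t * (2 ^ A 1 + 2 ^ A 2)

variable {m : ℕ} {N : Type*} [Fintype N] {x g : N → Dig m} {t : ℕ}

lemma DNet.expect_linear_sq_le (hx : DNet t x) (ht : t ≤ m) (W : ℕ) (c : (Fin 3 → ℕ) → ℝ)
    (hc : ∀ A, m ≤ ∑ i, A i + t → |c A| ≤ 2 * 2 ^ t) :
    𝔼 z : Dig m, (∑ A ∈ mainIdx m t W, c A * lam x A z) ^ 2 ≤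
      32 * 2 ^ (4 * t) * (m : ℝ) ^ 2 * ((W + t : ℕ) : ℝ) ^ 4 := by
  have e : 𝔼 z : Dig m, (∑ A ∈ mainIdx m t W, c A * lam x A z) ^ 2 =
      ∑ A ∈ mainIdx m t W, ∑ B ∈ mainIdx m t W, c A * c B * 𝔼 z : Dig m, lam x A z * lam x B z := by
    simp_rw [Finset.mul_expect, ← Finset.expect_sum_comm]
    refine Finset.expect_congr rfl fun z _ => ?_
    rw [sq, Finset.sum_mul_sum]
    exact Finset.sum_congr rfl fun A _ => Finset.sum_congr rfl fun B _ => by ring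
  rw [e]
  have hpt : ∀ A ∈ mainIdx m t W, ∀ B ∈ mainIdx m t W,
      c A * c B * 𝔼 z : Dig m, lam x A z * lam x B z ≤
      if m < ∑ i, min (B i) (A i) + t then 4 * 2 ^ (4 * t) else 0 := by
    intro A hA B hB
    have hA := mem_mainIdx.mp hA
    have hB := mem_mainIdx.mp hB
    split_ifs with h
    · refine (le_abs_self _).trans ?_
      rw [abs_mul, abs_mul]
      have h1 : |𝔼 z : Dig m, lam x A z * lam x B z| ≤ 2 ^ t * 2 ^ t := by
        refine (norm_expect_le (fun z : Dig m => lam x A z * lam x B z)).trans ?_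
        refine (Finset.expect_le_expect (g := fun _ => (2 : ℝ) ^ t * 2 ^ t) fun z _ => ?_).trans
          (by simp)
        rw [Real.norm_eq_abs, abs_mul]
        exact mul_le_mul (hx.abs_lam_le ht (by omega) z) (hx.abs_lam_le ht (by omega) z)
          (abs_nonneg _) (by positivity)
      calc _ ≤ (2 * 2 ^ t) * (2 * 2 ^ t) * ((2 : ℝ) ^ t * 2 ^ t) := by
            gcongr
            · exact hc A (by omega)
            · exact hc B (by omega)
        _ = _ := by rw [pow_mul']; ring
    · rw [hx.expect_lam_mul (fun i => (hA.1 i).2) (fun i => (hB.1 i).2) (not_lt.mp h), mul_zero]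
  calc _ ≤ ∑ A ∈ mainIdx m t W, ∑ B ∈ mainIdx m t W,
        (if m < ∑ i, min (B i) (A i) + t then (4 * 2 ^ (4 * t) : ℝ) else 0) :=
        Finset.sum_le_sum fun A hA => Finset.sum_le_sum fun B hB => hpt A hA B hB
    _ ≤ ∑ A ∈ mainIdx m t W, ((2 * (W + t) : ℕ) : ℝ) ^ 3 * (4 * 2 ^ (4 * t)) := by
        refine Finset.sum_le_sum fun A hA => ?_
        rw [← Finset.sum_filter, Finset.sum_const, nsmul_eq_mul]
        gcongr
        exact_mod_cast card_close_le hA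
    _ ≤ ((m ^ 2 * (W + t) : ℕ) : ℝ) * (((2 * (W + t) : ℕ) : ℝ) ^ 3 * (4 * 2 ^ (4 * t))) := by
        rw [Finset.sum_const, nsmul_eq_mul]
        gcongr
        exact card_mainIdx_le m t W
    _ = _ := by push_cast; ring

/-- The conditional variance concentrates around its mean. -/
lemma NearDigital.expect_gramSum_sub_le (hx : NearDigital t x g) (W : ℕ) :
    𝔼 z : Dig m, |gramSum x t W z - 𝔼 z' : Dig m, gramSum x t W z'| ≤
      Real.sqrt (32 * 2 ^ (4 * t) * (m : ℝ) ^ 2 * ((W + t : ℕ) : ℝ) ^ 4) + 12 * 2 ^ (2 * t) * m := by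
  choose κ hκ using hx.cls
  set k : (Fin 3 → ℕ) → ℝ := fun A => min (κ A) (2 ^ t) with hk
  set c : (Fin 3 → ℕ) → ℝ := fun A => k A - 2 * boxMean m A with hc
  set b : ℝ := ∑ A ∈ mainIdx m t W, (c A * boxMean m A + boxMean m A ^ 2) with hb
  set L : Dig m → ℝ := fun z => ∑ A ∈ mainIdx m t W, c A * lam x A z with hL
  set R : Dig m → ℝ := fun z => ∑ A ∈ mainIdx m t W, (boxCnt x A z ^ 2 - k A * boxCnt x A z) with hR
  have hdec : ∀ z, gramSum x t W z = L z + b + R z := by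
    intro z
    rw [gramSum, hL, hb, hR]
    simp only
    rw [← Finset.sum_add_distrib, ← Finset.sum_add_distrib]
    refine Finset.sum_congr rfl fun A _ => ?_
    simp only [hc, lam]; ring
  have hL0 : 𝔼 z, L z = 0 := by
    rw [hL, Finset.expect_sum_comm]
    refine Finset.sum_eq_zero fun A hA => ?_
    rw [← Finset.mul_expect, hx.net.expect_lam fun i => ((mem_mainIdx.mp hA).1 i).2, mul_zero]
  have hRle : 𝔼 z, |R z| ≤ 6 * 2 ^ (2 * t) * m := by
    calc 𝔼 z, |R z| ≤ 𝔼 z : Dig m, ∑ A ∈ mainIdx m t W, |boxCnt x A z ^ 2 - k A * boxCnt x A z| :=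
          Finset.expect_le_expect fun z _ => Finset.abs_sum_le_sum_abs _ _
      _ = ∑ A ∈ mainIdx m t W, 𝔼 z : Dig m, |boxCnt x A z ^ 2 - k A * boxCnt x A z| :=
          Finset.expect_sum_comm _ _ _
      _ ≤ ∑ A ∈ mainIdx m t W, 3 * 2 ^ (2 * t) * ((1 / 2) ^ (∑ i, A i) * 2 ^ A 1 +
            (1 / 2) ^ (∑ i, A i) * 2 ^ A 2) := by
          refine Finset.sum_le_sum fun A hA => ?_
          have hA := mem_mainIdx.mp hA
          refine (expect_boxCnt_sq_sub_le hx.net hx.le (fun i => (hA.1 i).2) (by omega)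
            (hκ A)).trans ?_
          calc _ ≤ (1 / 2 : ℝ) ^ (∑ i, A i) * (3 * 2 ^ t * (2 ^ t * (2 ^ A 1 + 2 ^ A 2))) := by
                gcongr; exact hx.defect_le A
            _ = _ := by rw [two_mul t, pow_add]; ring
      _ ≤ 3 * 2 ^ (2 * t) * (m + m) := by
          rw [← Finset.mul_sum, Finset.sum_add_distrib]
          gcongr
          · exact sum_weight_le m t W 1
          · exact sum_weight_le m t W 2
      _ = _ := by ring
  have hck : ∀ A, m ≤ ∑ i, A i + t → |c A| ≤ 2 * 2 ^ t := by
    intro A hA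
    have h1 := boxMean_le hA
    have h2 := boxMean_nonneg m A
    have hne : Nonempty N := Fintype.card_pos_iff.mp (by rw [hx.net.1]; positivity)
    have h3 : 0 ≤ κ A := by rw [← hκ A hne.some]; exact cnt_nonneg _ _ _
    have h4 : 0 ≤ k A := le_min h3 (by positivity)
    have h5 : k A ≤ 2 ^ t := min_le_right _ _
    simp only [hc]
    rw [abs_le]; constructor <;> linarith
  have hLle : 𝔼 z, |L z| ≤
      Real.sqrt (32 * 2 ^ (4 * t) * (m : ℝ) ^ 2 * ((W + t : ℕ) : ℝ) ^ 4) :=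
    (expect_abs_le_sqrt _).trans (Real.sqrt_le_sqrt (hx.net.expect_linear_sq_le hx.le W c hck))
  have hmean : 𝔼 z, gramSum x t W z = b + 𝔼 z, R z := by
    simp_rw [hdec, Finset.expect_add_distrib, hL0]; simp
  have hER : |𝔼 z, R z| ≤ 𝔼 z, |R z| := norm_expect_le R
  calc _ ≤ 𝔼 z : Dig m, (|L z| + |R z| + |𝔼 z, R z|) := by
        refine Finset.expect_le_expect fun z _ => ?_
        rw [hmean, hdec]
        have : L z + b + R z - (b + 𝔼 z, R z) = L z + R z - 𝔼 z, R z := by ring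
        rw [this]
        exact (abs_sub _ _).trans (add_le_add (abs_add_le _ _) le_rfl)
    _ = 𝔼 z, |L z| + 𝔼 z, |R z| + |𝔼 z, R z| := by
        simp_rw [Finset.expect_add_distrib]; simp
    _ ≤ _ := by linarith

/-- The mean conditional variance is at least of the order `m ^ 2`. -/
lemma le_expect_gramSum (x : N → Dig m) (t : ℕ) {W : ℕ} (hW : 2 ≤ W) :
    ((m / 2 : ℕ) : ℝ) ^ 2 / 4 ≤ 𝔼 z : Dig m, gramSum x t W z := by
  have hinj : ((Finset.Icc 1 (m / 2)) ×ˢ (Finset.Icc 1 (m / 2))).card ≤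
      ((mainIdx m t W).filter fun A => ∑ i, A i = m + 1).card := by
    refine Finset.card_le_card_of_injOn (fun p => ![p.1, p.2, m + 1 - p.1 - p.2]) ?_ ?_
    · intro p hp
      simp only [Finset.coe_product, Set.mem_prod, Finset.coe_Icc, Set.mem_Icc] at hp
      simp only [Finset.mem_coe, Finset.mem_filter, mem_mainIdx, Fin.sum_univ_three, Fin.forall_fin_succ]
      simp
      omega
    · intro p _ p' _ h
      have h0 := congrFun h 0
      have h1 := congrFun h 1
      simp at h0 h1
      exact Prod.ext h0 h1
  have hz : ∀ z : Dig m, ((m / 2 : ℕ) : ℝ) ^ 2 / 4 ≤ gramSum x t W z := by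
    intro z
    calc ((m / 2 : ℕ) : ℝ) ^ 2 / 4 ≤
          ∑ A ∈ (mainIdx m t W).filter (fun A => ∑ i, A i = m + 1), (1 / 4 : ℝ) := by
          rw [Finset.sum_const, nsmul_eq_mul]
          have : ((m / 2 : ℕ) : ℝ) ^ 2 ≤
              (((mainIdx m t W).filter fun A => ∑ i, A i = m + 1).card : ℝ) := by
            rw [Finset.card_product] at hinj
            simp at hinj
            rw [sq]
            exact_mod_cast hinj
          linarith
      _ ≤ ∑ A ∈ (mainIdx m t W).filter (fun A => ∑ i, A i = m + 1), lam x A z ^ 2 := by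
          refine Finset.sum_le_sum fun A hA => ?_
          have hs := (Finset.mem_filter.mp hA).2
          have hp : boxMean m A = 1 / 2 := by
            rw [boxMean, hs, pow_succ, ← mul_assoc, ← mul_pow]; norm_num
          have hN : ∃ k : ℕ, boxCnt x A z = k := ⟨_, by rw [boxCnt, cnt, Finset.sum_boole]⟩
          obtain ⟨k, hk⟩ := hN
          rw [lam, hk, hp]
          rcases Nat.eq_zero_or_pos k with h | h
          · subst h; norm_num
          · have : (1 : ℝ) ≤ k := by exact_mod_cast h
            nlinarith
      _ ≤ _ := Finset.sum_le_sum_of_subset_of_nonneg (Finset.filter_subset _ _)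
          fun _ _ _ => sq_nonneg _
  calc _ = 𝔼 _z : Dig m, ((m / 2 : ℕ) : ℝ) ^ 2 / 4 := by simp
    _ ≤ _ := Finset.expect_le_expect fun z _ => hz z

end

section

/-- The Rademacher function of index `a` (constant for `a = 0`) of a digit vector. -/
def rad {m : ℕ} (a : ℕ) (v : Fin m → ZMod 2) : ℝ :=
  if h : 1 ≤ a ∧ a ≤ m then sgn (v ⟨a - 1, by omega⟩) else 1

lemma rad_mul_self {m : ℕ} (a : ℕ) (v : Fin m → ZMod 2) : rad a v * rad a v = 1 := by
  unfold rad; split_ifs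
  · exact sgn_mul_self _
  · norm_num

lemma expect_rad_eq_zero {m : ℕ} {a b : ℕ} (ha : 1 ≤ a) (ham : a ≤ m) (hab : a ≠ b) :
    𝔼 v : Fin m → ZMod 2, rad a v * rad b v = 0 := by
  refine expect_eq_zero_of_flip (⟨a - 1, by omega⟩ : Fin m) _ fun v => ?_
  have h1 : rad a (v + unitDigit (⟨a - 1, by omega⟩ : Fin m)) = - rad a v := by
    simp only [rad, dif_pos (⟨ha, ham⟩ : 1 ≤ a ∧ a ≤ m)]
    exact sgn_flip_self _ _
  have h2 : rad b (v + unitDigit (⟨a - 1, by omega⟩ : Fin m)) = rad b v := by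
    unfold rad
    split_ifs with h
    · exact sgn_flip_of_ne (by rw [Ne, Fin.mk.injEq]; omega) _
    · rfl
  rw [h1, h2]; ring

lemma expect_rad_mul_rad {m : ℕ} {a b : ℕ} (ha : a ≤ m) (hb : b ≤ m) :
    𝔼 v : Fin m → ZMod 2, rad a v * rad b v = if a = b then 1 else 0 := by
  split_ifs with h
  · subst h; simp_rw [rad_mul_self]; simp
  · rcases Nat.eq_zero_or_pos a with h0 | h0
    · simp_rw [mul_comm (rad a _)]
      exact expect_rad_eq_zero (by omega) hb (Ne.symm h)
    · exact expect_rad_eq_zero h0 ha h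

/-- The Rademacher function of a multi-index. -/
def radV {m : ℕ} (A : Fin 3 → ℕ) (y : Dig m) : ℝ := ∏ i, rad (A i) (y i)

lemma expect_radV_mul_radV {m : ℕ} {A B : Fin 3 → ℕ} (hA : ∀ i, A i ≤ m) (hB : ∀ i, B i ≤ m) :
    𝔼 y : Dig m, radV A y * radV B y = if A = B then 1 else 0 := by
  simp_rw [radV, ← Finset.prod_mul_distrib]
  refine (expect_prod_pi fun i (v : Fin m → ZMod 2) => rad (A i) v * rad (B i) v).trans ?_
  simp_rw [fun i => expect_rad_mul_rad (hA i) (hB i)]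
  split_ifs with h
  · subst h; simp
  · obtain ⟨i, hi⟩ := Function.ne_iff.mp h
    exact Finset.prod_eq_zero (Finset.mem_univ i) (if_neg hi)

/-- The sign `(-1) ^ κ(A)`. -/
def sgnIdx (A : Fin 3 → ℕ) : ℝ := ∏ i, if A i = 0 then 1 else -1

lemma sgnIdx_sq (A : Fin 3 → ℕ) : sgnIdx A ^ 2 = 1 := by
  rw [sgnIdx, ← Finset.prod_pow]
  exact Finset.prod_eq_one fun i _ => by split_ifs <;> norm_num

/-- All indices of the expansion of the truncated discrepancy. -/
def allIdx (m : ℕ) : Finset (Fin 3 → ℕ) := Fintype.piFinset fun _ => Finset.range (m + 1)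

lemma mem_allIdx {m : ℕ} {A : Fin 3 → ℕ} : A ∈ allIdx m ↔ ∀ i, A i ≤ m := by
  simp [allIdx, Fintype.mem_piFinset]

/-- A partial sum of the Rademacher expansion of the truncated discrepancy. -/
def partDisc {m : ℕ} {N : Type*} [Fintype N] (x : N → Dig m) (S : Finset (Fin 3 → ℕ))
    (y z : Dig m) : ℝ := 1 / 8 * ∑ A ∈ S, sgnIdx A * radV A y * lam x A z

variable {m : ℕ} {N : Type*} [Fintype N] {x g : N → Dig m} {t W : ℕ}

lemma expect_partDisc_sq (x : N → Dig m) {S : Finset (Fin 3 → ℕ)} (hS : S ⊆ allIdx m) :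
    𝔼 z : Dig m, 𝔼 y : Dig m, partDisc x S y z ^ 2 = 1 / 64 * ∑ A ∈ S, 𝔼 z : Dig m, lam x A z ^ 2 := by
  have e : ∀ z : Dig m, 𝔼 y : Dig m, partDisc x S y z ^ 2 = 1 / 64 * ∑ A ∈ S, lam x A z ^ 2 := by
    intro z
    have e1 : ∀ y : Dig m, partDisc x S y z ^ 2 = 1 / 64 * ∑ A ∈ S, ∑ B ∈ S,
        sgnIdx A * lam x A z * (sgnIdx B * lam x B z) * (radV A y * radV B y) := by
      intro y
      rw [partDisc, mul_pow, sq (∑ A ∈ S, _), Finset.sum_mul_sum]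
      congr 1
      · norm_num
      · exact Finset.sum_congr rfl fun A _ => Finset.sum_congr rfl fun B _ => by ring
    simp_rw [e1, ← Finset.mul_expect, Finset.expect_sum_comm, ← Finset.mul_expect]
    congr 1
    refine Finset.sum_congr rfl fun A hA => ?_
    rw [Finset.sum_eq_single_of_mem A hA]
    · rw [expect_radV_mul_radV (mem_allIdx.mp (hS hA)) (mem_allIdx.mp (hS hA)), if_pos rfl]
      linear_combination lam x A z ^ 2 * sgnIdx_sq A
    · intro B hB hne
      rw [expect_radV_mul_radV (mem_allIdx.mp (hS hA)) (mem_allIdx.mp (hS hB)),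
        if_neg (Ne.symm hne), mul_zero]
  simp_rw [e, ← Finset.mul_expect, Finset.expect_sum_comm]

lemma mainIdx_subset : mainIdx m t W ⊆ allIdx m := fun _ hA =>
  mem_allIdx.mpr fun i => ((mem_mainIdx.mp hA).1 i).2

lemma card_face_le (i : Fin 3) : ((allIdx m).filter fun A =>
    A i = 0 ∧ m < ∑ i, A i + t ∧ ∑ i, A i < m + W).card ≤ (m + 1) * (W + t) := by
  have h : ((allIdx m).filter fun A =>
      A i = 0 ∧ m < ∑ i, A i + t ∧ ∑ i, A i < m + W).card ≤
      (Finset.range (m + 1) ×ˢ Finset.range (W + t)).card := by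
    refine Finset.card_le_card_of_injOn (fun A => (A (i + 1), ∑ i, A i + t - m)) ?_ ?_
    · intro A hA
      obtain ⟨h1, h2⟩ := Finset.mem_filter.mp (Finset.mem_coe.mp hA)
      simp only [Finset.coe_product, Set.mem_prod, Finset.coe_range, Set.mem_Iio]
      exact ⟨Nat.lt_succ_of_le (mem_allIdx.mp h1 _), by omega⟩
    · intro A hA B hB hAB
      obtain ⟨-, hA⟩ := Finset.mem_filter.mp (Finset.mem_coe.mp hA)
      obtain ⟨-, hB⟩ := Finset.mem_filter.mp (Finset.mem_coe.mp hB)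
      simp only [Fin.sum_univ_three, Prod.mk.injEq] at hA hB hAB
      match i with
      | 0 =>
        simp only [zero_add] at hAB
        ext j
        match j with
        | 0 => omega
        | 1 => omega
        | 2 => omega
      | 1 =>
        have e : (1 + 1 : Fin 3) = 2 := rfl
        rw [e] at hAB
        ext j
        match j with
        | 0 => omega
        | 1 => omega
        | 2 => omega
      | 2 =>
        have e : (2 + 1 : Fin 3) = 0 := rfl
        rw [e] at hAB
        ext j
        match j with
        | 0 => omega
        | 1 => omega
        | 2 => omega
  exact h.trans (le_of_eq (by simp))

/-- The indices outside the dominant range contribute little. -/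
lemma DNet.sum_rest_le (hx : DNet t x) (ht : t ≤ m) (hW : (m + 1) ^ 3 ≤ 2 ^ W) :
    ∑ A ∈ allIdx m \ mainIdx m t W, 𝔼 z : Dig m, lam x A z ^ 2 ≤
      2 ^ t + 3 * ((m + 1 : ℕ) : ℝ) * ((W + t : ℕ) : ℝ) * 2 ^ (2 * t) := by
  have hpt : ∀ A ∈ allIdx m \ mainIdx m t W, 𝔼 z : Dig m, lam x A z ^ 2 ≤ 2 ^ t * (1 / 2) ^ W +
      ∑ i, if A i = 0 ∧ m < ∑ i, A i + t ∧ ∑ i, A i < m + W then (2 : ℝ) ^ (2 * t) else 0 := by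
    intro A hA
    obtain ⟨hA, hA'⟩ := Finset.mem_sdiff.mp hA
    have hA := mem_allIdx.mp hA
    have hnn : 0 ≤ ∑ i, if A i = 0 ∧ m < ∑ i, A i + t ∧ ∑ i, A i < m + W then (2 : ℝ) ^ (2 * t)
        else 0 := Finset.sum_nonneg fun _ _ => by split_ifs <;> positivity
    have hw0 : (0 : ℝ) ≤ 2 ^ t * (1 / 2) ^ W := by positivity
    rcases le_or_gt (∑ i, A i + t) m with h1 | h1
    · simp_rw [hx.lam_eq_zero h1]
      simp only [ne_eq, OfNat.ofNat_ne_zero, not_false_eq_true, zero_pow, Finset.expect_const_zero]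
      linarith
    · have hsq := hx.expect_lam_sq_le ht hA h1.le
      rcases le_or_gt (m + W) (∑ i, A i) with h2 | h2
      · have : boxMean m A ≤ (1 / 2) ^ W := by
          unfold boxMean
          calc (2 : ℝ) ^ m * (1 / 2) ^ ∑ i, A i ≤ 2 ^ m * (1 / 2) ^ (m + W) := by
                gcongr ?_ * ?_
                exact pow_le_pow_of_le_one (by norm_num) (by norm_num) h2
            _ = (1 / 2) ^ W := by rw [pow_add, ← mul_assoc, ← mul_pow]; norm_num
        have := mul_le_mul_of_nonneg_left this (show (0 : ℝ) ≤ 2 ^ t by positivity)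
        linarith
      · have hex : ∃ i, A i = 0 := by
          by_contra hne
          push Not at hne
          exact hA' (mem_mainIdx.mpr ⟨fun i => ⟨Nat.one_le_iff_ne_zero.mpr (hne i), hA i⟩, h1, h2⟩)
        obtain ⟨i, hi⟩ := hex
        have h3 : (2 : ℝ) ^ (2 * t) ≤ ∑ i, if A i = 0 ∧ m < ∑ i, A i + t ∧ ∑ i, A i < m + W then
            (2 : ℝ) ^ (2 * t) else 0 := by
          refine le_trans (le_of_eq ?_) (Finset.single_le_sum (f := fun i =>
            if A i = 0 ∧ m < ∑ i, A i + t ∧ ∑ i, A i < m + W then (2 : ℝ) ^ (2 * t) else 0)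
            (fun _ _ => by split_ifs <;> positivity) (Finset.mem_univ i))
          exact (if_pos ⟨hi, h1, h2⟩).symm
        have h4 : (2 : ℝ) ^ t * boxMean m A ≤ 2 ^ (2 * t) := by
          rw [two_mul, pow_add]; gcongr; exact boxMean_le h1.le
        linarith
  refine (Finset.sum_le_sum hpt).trans ?_
  rw [Finset.sum_add_distrib]
  refine add_le_add ?_ ?_
  · rw [Finset.sum_const, nsmul_eq_mul]
    have h1 : (((allIdx m \ mainIdx m t W).card : ℕ) : ℝ) ≤ 2 ^ W := by
      have : (allIdx m \ mainIdx m t W).card ≤ (m + 1) ^ 3 :=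
        (Finset.card_le_card Finset.sdiff_subset).trans (le_of_eq (by simp [allIdx]))
      exact_mod_cast this.trans hW
    calc _ ≤ (2 : ℝ) ^ W * (2 ^ t * (1 / 2) ^ W) := by gcongr
      _ = 2 ^ t := by rw [mul_left_comm, ← mul_pow]; norm_num
  · calc _ ≤ ∑ A ∈ allIdx m, ∑ i, (if A i = 0 ∧ m < ∑ i, A i + t ∧ ∑ i, A i < m + W then
          (2 : ℝ) ^ (2 * t) else 0) :=
          Finset.sum_le_sum_of_subset_of_nonneg Finset.sdiff_subset fun _ _ _ =>
            Finset.sum_nonneg fun _ _ => by split_ifs <;> positivity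
      _ = ∑ i : Fin 3, ∑ A ∈ allIdx m, (if A i = 0 ∧ m < ∑ i, A i + t ∧ ∑ i, A i < m + W then
          (2 : ℝ) ^ (2 * t) else 0) := Finset.sum_comm
      _ ≤ ∑ _i : Fin 3, (((m + 1) * (W + t) : ℕ) : ℝ) * 2 ^ (2 * t) := by
          refine Finset.sum_le_sum fun i _ => ?_
          rw [← Finset.sum_filter, Finset.sum_const, nsmul_eq_mul]
          gcongr
          exact card_face_le i
      _ = _ := by simp; ring

/-- A sum over the dominant indices as an iterated sum. -/
lemma sum_mainIdx (F : (Fin 3 → ℕ) → ℝ) : ∑ A ∈ mainIdx m t W, F A =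
    ∑ a : Fin m, ∑ b : Fin m, ∑ c : Fin m,
      if ![(a : ℕ) + 1, (b : ℕ) + 1, (c : ℕ) + 1] ∈ mainIdx m t W then
        F ![(a : ℕ) + 1, (b : ℕ) + 1, (c : ℕ) + 1] else 0 := by
  have : ∀ f : Fin m → Fin m → Fin m → ℝ, ∑ a, ∑ b, ∑ c, f a b c =
      ∑ p : Fin m × Fin m × Fin m, f p.1 p.2.1 p.2.2 := fun f => by
    simp_rw [Fintype.sum_prod_type]
  rw [this, ← Finset.sum_filter]
  refine (Finset.sum_bij (fun p _ => ![(p.1 : ℕ) + 1, (p.2.1 : ℕ) + 1, (p.2.2 : ℕ) + 1])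
    ?_ ?_ ?_ ?_).symm
  · intro p hp; exact (Finset.mem_filter.mp hp).2
  · intro p _ p' _ h
    have h0 := congrFun h 0
    have h1 := congrFun h 1
    have h2 := congrFun h 2
    simp at h0 h1 h2
    exact Prod.ext (Fin.ext h0) (Prod.ext (Fin.ext h1) (Fin.ext h2))
  · intro A hA
    have h := (mem_mainIdx.mp hA).1
    have e : ![(A 0 - 1) + 1, (A 1 - 1) + 1, (A 2 - 1) + 1] = A := by
      ext i
      match i with
      | 0 => have := h 0; simp; omega
      | 1 => have := h 1; simp; omega
      | 2 => have := h 2; simp; omega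
    refine ⟨(⟨A 0 - 1, by have := h 0; omega⟩, ⟨A 1 - 1, by have := h 1; omega⟩,
      ⟨A 2 - 1, by have := h 2; omega⟩), ?_, e⟩
    refine Finset.mem_filter.mpr ⟨Finset.mem_univ _, ?_⟩
    simpa only [e] using hA
  · intro p _; rfl

/-- The coefficients of the dominant trilinear form. -/
def mainCoef (x : N → Dig m) (t W : ℕ) (z : Dig m) (a b c : Fin m) : ℝ :=
  if ![(a : ℕ) + 1, (b : ℕ) + 1, (c : ℕ) + 1] ∈ mainIdx m t W then
    lam x ![(a : ℕ) + 1, (b : ℕ) + 1, (c : ℕ) + 1] z else 0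

lemma sum_window_le {f : Fin m → ℝ} {p : Fin m → Prop} [DecidablePred p] {B : ℝ} (hB : 0 ≤ B) (s : ℕ)
    (hp : ∀ a, p a → m < (a : ℕ) + s + t ∧ (a : ℕ) + s < m + W)
    (hf : ∀ a, p a → |f a| ≤ B) :
    ∑ a, |if p a then f a else 0| ≤ ((W + t : ℕ) : ℝ) * B := by
  calc _ ≤ ∑ a, (if p a then B else 0) := by
        refine Finset.sum_le_sum fun a _ => ?_
        split_ifs with h
        · exact hf a h
        · simp
    _ = ((Finset.univ.filter p).card : ℝ) * B := by
        rw [← Finset.sum_filter, Finset.sum_const, nsmul_eq_mul]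
    _ ≤ _ := by
        gcongr
        have : (Finset.univ.filter p).card ≤ (Finset.range (W + t)).card := by
          refine Finset.card_le_card_of_injOn (fun a => (a : ℕ) + s + t - m) ?_ ?_
          · intro a ha
            have := hp a (by simpa using ha)
            simp only [Finset.coe_range, Set.mem_Iio]; omega
          · intro a ha b hb hab
            have := hp a (by simpa using ha)
            have := hp b (by simpa using hb)
            simp only at hab
            exact Fin.ext (by omega)
        simpa using this

lemma DNet.lineBound (hx : DNet t x) (ht : t ≤ m) (W : ℕ) (z : Dig m) :
    LineBound (mainCoef x t W z) (((W + t : ℕ) : ℝ) * 2 ^ t) := by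
  have hl : ∀ a b c : Fin m, ![(a : ℕ) + 1, (b : ℕ) + 1, (c : ℕ) + 1] ∈ mainIdx m t W →
      |lam x ![(a : ℕ) + 1, (b : ℕ) + 1, (c : ℕ) + 1] z| ≤ 2 ^ t := fun a b c h =>
    hx.abs_lam_le ht (mem_mainIdx.mp h).2.1.le z
  have hw : ∀ a b c : Fin m, ![(a : ℕ) + 1, (b : ℕ) + 1, (c : ℕ) + 1] ∈ mainIdx m t W →
      m < a + b + c + 3 + t ∧ (a + b + c + 3 : ℕ) < m + W := by
    intro a b c h
    have := (mem_mainIdx.mp h).2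
    simp [Fin.sum_univ_three] at this
    omega
  have hK : (0 : ℝ) ≤ 2 ^ t := by positivity
  refine ⟨fun b c => ?_, fun a c => ?_, fun a b => ?_⟩
  · exact sum_window_le (p := fun a : Fin m => ![(a : ℕ) + 1, (b : ℕ) + 1, (c : ℕ) + 1] ∈ mainIdx m t W)
      (f := fun a : Fin m => lam x ![(a : ℕ) + 1, (b : ℕ) + 1, (c : ℕ) + 1] z) hK ((b : ℕ) + c + 3)
      (fun a h => by have := hw a b c h; omega) fun a h => hl a b c h
  · exact sum_window_le (p := fun b : Fin m => ![(a : ℕ) + 1, (b : ℕ) + 1, (c : ℕ) + 1] ∈ mainIdx m t W)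
      (f := fun b : Fin m => lam x ![(a : ℕ) + 1, (b : ℕ) + 1, (c : ℕ) + 1] z) hK ((a : ℕ) + c + 3)
      (fun b h => by have := hw a b c h; omega) fun b h => hl a b c h
  · exact sum_window_le (p := fun c : Fin m => ![(a : ℕ) + 1, (b : ℕ) + 1, (c : ℕ) + 1] ∈ mainIdx m t W)
      (f := fun c : Fin m => lam x ![(a : ℕ) + 1, (b : ℕ) + 1, (c : ℕ) + 1] z) hK ((a : ℕ) + b + 3)
      (fun c h => by have := hw a b c h; omega) fun c h => hl a b c h

lemma sum_mainCoef_sq (x : N → Dig m) (t W : ℕ) (z : Dig m) :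
    ∑ a, ∑ b, ∑ c, mainCoef x t W z a b c ^ 2 = gramSum x t W z := by
  rw [gramSum, sum_mainIdx]
  refine Finset.sum_congr rfl fun a _ => Finset.sum_congr rfl fun b _ =>
    Finset.sum_congr rfl fun c _ => ?_
  unfold mainCoef
  split_ifs <;> simp

lemma partDisc_mainIdx (x : N → Dig m) (t W : ℕ) (y z : Dig m) :
    partDisc x (mainIdx m t W) y z = -(1 / 8) * ∑ a, ∑ b, ∑ c, mainCoef x t W z a b c *
      (sgn (y 0 a) * sgn (y 1 b) * sgn (y 2 c)) := by
  rw [partDisc, sum_mainIdx, neg_mul, ← mul_neg, ← Finset.sum_neg_distrib]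
  congr 1
  refine Finset.sum_congr rfl fun a _ => ?_
  rw [← Finset.sum_neg_distrib]
  refine Finset.sum_congr rfl fun b _ => ?_
  rw [← Finset.sum_neg_distrib]
  refine Finset.sum_congr rfl fun c _ => ?_
  unfold mainCoef
  have hr : ∀ (a : Fin m) (v : Fin m → ZMod 2), rad ((a : ℕ) + 1) v = sgn (v a) := by
    intro a v
    rw [rad, dif_pos ⟨by omega, a.2⟩]
    congr 1
  split_ifs
  · simp [sgnIdx, radV, Fin.prod_univ_three, hr]; ring
  · simp

lemma expect_fin_three {V M : Type*} [Fintype V] [AddCommMonoid M] [Module ℚ≥0 M]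
    (f : (Fin 3 → V) → M) : 𝔼 y, f y = 𝔼 a, 𝔼 b, 𝔼 c, f ![a, b, c] := by
  have e : ∀ h : V → V → V → M, 𝔼 a, 𝔼 b, 𝔼 c, h a b c =
      𝔼 p : V × V × V, h p.1 p.2.1 p.2.2 := fun h => by
    rw [← Finset.univ_product_univ, Finset.expect_product]
    refine Finset.expect_congr rfl fun a _ => ?_
    rw [← Finset.univ_product_univ, Finset.expect_product]
  rw [e fun a b c => f ![a, b, c]]
  refine (Fintype.expect_equiv
    { toFun := fun p => ![p.1, p.2.1, p.2.2]
      invFun := fun y => (y 0, y 1, y 2)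
      left_inv := fun p => rfl
      right_inv := fun y => by
        ext i
        match i with
        | 0 => rfl
        | 1 => rfl
        | 2 => rfl } _ _ fun p => rfl).symm

lemma norm_exp_mul_I_sub_le (a b : ℝ) :
    ‖Complex.exp ((a : ℂ) * Complex.I) - Complex.exp ((b : ℂ) * Complex.I)‖ ≤ |a - b| := by
  have e : Complex.exp ((a : ℂ) * Complex.I) - Complex.exp ((b : ℂ) * Complex.I) =
      Complex.exp ((b : ℂ) * Complex.I) * (Complex.exp (Complex.I * ((a - b : ℝ) : ℂ)) - 1) := by
    rw [mul_sub, ← Complex.exp_add, mul_one]; congr 2; push_cast; ring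
  rw [e, norm_mul, Complex.norm_exp_ofReal_mul_I, one_mul]
  exact (Real.norm_exp_I_mul_ofReal_sub_one_le).trans (le_of_eq (Real.norm_eq_abs _))

/-- The characteristic function of the full expansion is close to a Gaussian one. -/
theorem NearDigital.norm_charFun_sub_le (hx : NearDigital t x g) (W : ℕ) (τ : ℝ) :
    ‖𝔼 z : Dig m, 𝔼 y : Dig m, Complex.exp (((τ * partDisc x (allIdx m) y z : ℝ) : ℂ) * Complex.I) -
      (Real.exp (-(τ ^ 2 / 2 * (1 / 64 * 𝔼 z : Dig m, gramSum x t W z))) : ℂ)‖ ≤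
    |τ| * Real.sqrt (1 / 64 * ∑ A ∈ allIdx m \ mainIdx m t W, 𝔼 z : Dig m, lam x A z ^ 2) +
    (6 * (τ / 8) ^ 4 * ((m : ℝ) ^ 3 * (((W + t : ℕ) : ℝ) * 2 ^ t) ^ 4) +
      (τ / 8) ^ 2 / 2 * Real.sqrt (16 * ((m : ℝ) ^ 3 * (((W + t : ℕ) : ℝ) * 2 ^ t) ^ 4))) +
    (τ / 8) ^ 2 / 2 * 𝔼 z : Dig m, |gramSum x t W z - 𝔼 z' : Dig m, gramSum x t W z'| := by
  set S := mainIdx m t W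
  set G := gramSum x t W
  set Γ := 𝔼 z : Dig m, G z
  set e := fun r : ℝ => Complex.exp ((r : ℂ) * Complex.I) with he
  have h1 : ‖𝔼 z : Dig m, 𝔼 y : Dig m, e (τ * partDisc x (allIdx m) y z) -
      𝔼 z : Dig m, 𝔼 y : Dig m, e (τ * partDisc x S y z)‖ ≤
      |τ| * Real.sqrt (1 / 64 * ∑ A ∈ allIdx m \ S, 𝔼 z : Dig m, lam x A z ^ 2) := by
    simp_rw [← Finset.expect_sub_distrib]
    rw [← expect_partDisc_sq x Finset.sdiff_subset]
    refine le_trans ?_ (mul_le_mul_of_nonneg_left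
      (expect_expect_abs_le_sqrt fun z y => partDisc x (allIdx m \ S) y z) (abs_nonneg τ))
    simp_rw [Finset.mul_expect]
    refine (norm_expect_le _).trans (Finset.expect_le_expect fun z _ =>
      (norm_expect_le _).trans (Finset.expect_le_expect fun y _ => ?_))
    refine (norm_exp_mul_I_sub_le _ _).trans (le_of_eq ?_)
    rw [← mul_sub, abs_mul]
    congr 2
    rw [partDisc, partDisc, partDisc, ← mul_sub, ← Finset.sum_sdiff (mainIdx_subset (m := m) (t := t) (W := W))]
    ring
  have h2 : ∀ z : Dig m, ‖𝔼 y : Dig m, e (τ * partDisc x S y z) -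
      (Real.exp (-((τ / 8) ^ 2 / 2 * G z)) : ℂ)‖ ≤
      6 * (τ / 8) ^ 4 * ((m : ℝ) ^ 3 * (((W + t : ℕ) : ℝ) * 2 ^ t) ^ 4) +
      (τ / 8) ^ 2 / 2 * Real.sqrt (16 * ((m : ℝ) ^ 3 * (((W + t : ℕ) : ℝ) * 2 ^ t) ^ 4)) := by
    intro z
    have := (hx.net.lineBound hx.le W z).norm_charFun_sub_le (by positivity) (-(τ / 8))
    rw [Fintype.card_fin, sum_mainCoef_sq] at this
    rw [expect_fin_three]
    have ee : ∀ a b c : Fin m → ZMod 2, τ * partDisc x S ![a, b, c] z = -(τ / 8) *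
        ∑ i, ∑ j, ∑ k, mainCoef x t W z i j k * (sgn (a i) * sgn (b j) * sgn (c k)) := by
      intro a b c
      rw [partDisc_mainIdx, ← mul_assoc]
      congr 1
      ring
    simp_rw [ee]
    simpa only [Even.neg_pow (show Even 4 from ⟨2, rfl⟩), neg_sq] using this
  have h3 : ‖(𝔼 z : Dig m, (Real.exp (-((τ / 8) ^ 2 / 2 * G z)) : ℂ)) -
      (Real.exp (-((τ / 8) ^ 2 / 2 * Γ)) : ℂ)‖ ≤ (τ / 8) ^ 2 / 2 * 𝔼 z : Dig m, |G z - Γ| := by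
    have : (𝔼 z : Dig m, (Real.exp (-((τ / 8) ^ 2 / 2 * G z)) : ℂ)) -
      (Real.exp (-((τ / 8) ^ 2 / 2 * Γ)) : ℂ) = 𝔼 z : Dig m, ((Real.exp (-((τ / 8) ^ 2 / 2 * G z)) -
      Real.exp (-((τ / 8) ^ 2 / 2 * Γ)) : ℝ) : ℂ) := by
      simp_rw [Complex.ofReal_sub, Finset.expect_sub_distrib, Fintype.expect_const]
    have hm : (τ / 8) ^ 2 / 2 * 𝔼 z : Dig m, |G z - Γ| =
        𝔼 z : Dig m, (τ / 8) ^ 2 / 2 * |G z - Γ| := Finset.mul_expect _ _ _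
    rw [this, hm]
    have hG0 : ∀ z, 0 ≤ G z := fun z => Finset.sum_nonneg fun _ _ => sq_nonneg _
    have hΓ0 : 0 ≤ Γ := Finset.expect_nonneg fun z _ => hG0 z
    refine (norm_expect_le _).trans (Finset.expect_le_expect fun z _ => ?_)
    rw [Complex.norm_real, Real.norm_eq_abs]
    refine (abs_exp_neg_sub_exp_neg_le ?_ ?_).trans (le_of_eq ?_)
    · have := hG0 z; positivity
    · positivity
    · rw [← mul_sub, abs_mul, abs_of_nonneg (by positivity)]
  have h2' : ‖𝔼 z : Dig m, 𝔼 y : Dig m, e (τ * partDisc x S y z) -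
      𝔼 z : Dig m, (Real.exp (-((τ / 8) ^ 2 / 2 * G z)) : ℂ)‖ ≤
      6 * (τ / 8) ^ 4 * ((m : ℝ) ^ 3 * (((W + t : ℕ) : ℝ) * 2 ^ t) ^ 4) +
      (τ / 8) ^ 2 / 2 * Real.sqrt (16 * ((m : ℝ) ^ 3 * (((W + t : ℕ) : ℝ) * 2 ^ t) ^ 4)) := by
    rw [← Finset.expect_sub_distrib]
    exact (norm_expect_le _).trans ((Finset.expect_le_expect fun z _ => h2 z).trans (by simp))
  have h4 : τ ^ 2 / 2 * (1 / 64 * Γ) = (τ / 8) ^ 2 / 2 * Γ := by ring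
  rw [h4]
  refine (norm_sub_le_norm_sub_add_norm_sub _
    (𝔼 z : Dig m, (Real.exp (-((τ / 8) ^ 2 / 2 * G z)) : ℂ)) _).trans (add_le_add ?_ h3)
  exact (norm_sub_le_norm_sub_add_norm_sub _
    (𝔼 z : Dig m, 𝔼 y : Dig m, e (τ * partDisc x S y z)) _).trans (add_le_add h1 h2')

end

section

/-- The index of the dyadic interval of order `d` containing `x`. -/
def fl (d : ℕ) (x : ℝ) : ℕ := ⌊x * 2 ^ d⌋₊

lemma bdigit_eq (a : ℕ) (x : ℝ) : bdigit a x = fl a x % 2 := by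
  rw [bdigit, fl, Int.floor_toNat]

lemma fl_succ_div (d : ℕ) (x : ℝ) : fl (d + 1) x / 2 = fl d x := by
  rw [fl, fl, ← Nat.floor_div_natCast]
  congr 1; push_cast; ring

lemma fl_succ (d : ℕ) (x : ℝ) : fl (d + 1) x = 2 * fl d x + bdigit (d + 1) x := by
  have := fl_succ_div d x
  rw [bdigit_eq]; omega

lemma fl_eq_iff {d a : ℕ} {x : ℝ} (hx : 0 ≤ x) :
    fl d x = a ↔ (a : ℝ) / 2 ^ d ≤ x ∧ x < ((a : ℝ) + 1) / 2 ^ d := by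
  rw [fl, Nat.floor_eq_iff (by positivity), div_le_iff₀ (by positivity), lt_div_iff₀ (by positivity)]

lemma fl_zero {x : ℝ} (hx1 : x < 1) : fl 0 x = 0 := by
  rw [fl, Nat.floor_eq_zero]; simpa using hx1

lemma fl_lt {x : ℝ} (hx1 : x < 1) (d : ℕ) : fl d x < 2 ^ d := by
  induction d with
  | zero => simp [fl_zero hx1]
  | succ d ih => rw [fl_succ, pow_succ, bdigit_eq]; omega

/-- The integer with binary digits `v 0, …, v (d - 1)`. -/
def pre (v : ℕ → ℕ) : ℕ → ℕ
  | 0 => 0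
  | d + 1 => 2 * pre v d + v d

lemma pre_lt {v : ℕ → ℕ} (hv : ∀ j, v j < 2) (d : ℕ) : pre v d < 2 ^ d := by
  induction d with
  | zero => simp [pre]
  | succ d ih => rw [pre, pow_succ]; have := hv d; omega

lemma fl_eq_pre_iff {v : ℕ → ℕ} (hv : ∀ j, v j < 2) {x : ℝ} (hx1 : x < 1) (d : ℕ) :
    fl d x = pre v d ↔ ∀ j < d, bdigit (j + 1) x = v j := by
  induction d with
  | zero => simp [fl_zero hx1, pre]
  | succ d ih =>
    have h : bdigit (d + 1) x < 2 := by rw [bdigit_eq]; omega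
    have := hv d
    rw [fl_succ, pre, Nat.forall_lt_succ_right, ← ih]
    omega

variable {s m t : ℕ}

lemma card_box_of_isNet {t M : ℕ} {P : Fin (2 ^ M) → Fin 2 → ℝ} (hP : IsNet t M 2 P)
    (h0 : ∀ n i, 0 ≤ P n i) (d a : Fin 2 → ℕ) (ha : ∀ i, a i < 2 ^ d i) (hd : ∑ i, d i + t ≤ M) :
    (Finset.univ.filter fun n => ∀ i, fl (d i) (P n i) = a i).card = 2 ^ (M - ∑ i, d i) := by
  obtain ⟨k, hk⟩ : ∃ k, ∑ i, d i + t + k = M := ⟨_, Nat.add_sub_cancel' hd⟩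
  induction k generalizing d a with
  | zero =>
    have := hP d a ha (by omega)
    simp_rw [← fl_eq_iff (h0 _ _)] at this
    rw [this]
    congr 1; omega
  | succ k ih =>
    simp only [Fin.sum_univ_two, Fin.forall_fin_two] at *
    have e : ∀ c, c < 2 → (Finset.univ.filter fun n => fl (d 0 + 1) (P n 0) = 2 * a 0 + c ∧
        fl (d 1) (P n 1) = a 1).card = 2 ^ (M - (d 0 + 1 + d 1)) := by
      intro c hc
      have := ih ![d 0 + 1, d 1] ![2 * a 0 + c, a 1] (by simp [pow_succ]; omega)
        (by simp; omega) (by simp; omega)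
      simpa using this
    have hs : (Finset.univ.filter fun n => fl (d 0) (P n 0) = a 0 ∧ fl (d 1) (P n 1) = a 1) =
        (Finset.univ.filter fun n => fl (d 0 + 1) (P n 0) = 2 * a 0 + 0 ∧ fl (d 1) (P n 1) = a 1) ∪
        (Finset.univ.filter fun n => fl (d 0 + 1) (P n 0) = 2 * a 0 + 1 ∧ fl (d 1) (P n 1) = a 1) := by
      ext n
      simp only [Finset.mem_union, Finset.mem_filter, Finset.mem_univ, true_and]
      have := fl_succ_div (d 0) (P n 0)
      omega
    rw [hs, Finset.card_union_of_disjoint, e 0 (by omega), e 1 (by omega), ← two_mul, ← pow_succ']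
    · congr 1; omega
    · rw [Finset.disjoint_filter]
      intro n _ h h'
      omega

lemma seqPoint_nonneg (C : Fin s → ℕ → ℕ → ZMod 2) (n : ℕ) (i : Fin s) : 0 ≤ seqPoint s C n i :=
  tsum_nonneg fun _ => by positivity

/-- Every block of length at most `2 ^ m` of the planar sequence is a net of quality `t`. -/
def NetUpTo (t m : ℕ) (C : Fin 2 → ℕ → ℕ → ZMod 2) : Prop :=
  ∀ M, 1 ≤ M → M ≤ m → ∀ k : ℕ, ∃ t' ≤ t, t' ≤ M ∧
    IsNet t' M 2 fun n : Fin (2 ^ M) => seqPoint 2 C (k * 2 ^ M + (n : ℕ))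

variable {C : Fin 2 → ℕ → ℕ → ZMod 2}

lemma NetUpTo.card_box (h : NetUpTo t m C) {M : ℕ} (hM : M ≤ m) (k : ℕ) (d a : Fin 2 → ℕ)
    (ha : ∀ i, a i < 2 ^ d i) (hd : ∑ i, d i + t ≤ M) (h1 : 1 ≤ M):
    (Finset.univ.filter fun n : Fin (2 ^ M) =>
      ∀ i, fl (d i) (seqPoint 2 C (k * 2 ^ M + (n : ℕ)) i) = a i).card = 2 ^ (M - ∑ i, d i) := by
  obtain ⟨t', ht', -, hn⟩ := h M h1 hM k
  exact card_box_of_isNet hn (fun n i => seqPoint_nonneg C _ i) d a ha (by omega)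

lemma NetUpTo.lt_one (h : NetUpTo t m C) (hm : 1 ≤ m) {n : ℕ} (hn : n < 2 ^ m) (i : Fin 2) :
    seqPoint 2 C n i < 1 := by
  obtain ⟨t', -, ht', hn'⟩ := h m hm le_rfl 0
  have := card_box_of_isNet hn' (fun n i => seqPoint_nonneg C _ i) 0 0 (by simp) (by simpa using ht')
  simp only [Pi.zero_apply, Finset.sum_const_zero, Nat.sub_zero] at this
  have h2 : ∀ n : Fin (2 ^ m), ∀ i, fl 0 (seqPoint 2 C (0 * 2 ^ m + (n : ℕ)) i) = 0 := fun n =>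
    Finset.card_filter_eq_iff.mp (this.trans (by simp)) n (Finset.mem_univ _)
  simpa [fl] using h2 ⟨n, hn⟩ i

/-- The points `(n / 2 ^ m, X_n)`. -/
def pt (m : ℕ) (C : Fin 2 → ℕ → ℕ → ZMod 2) (n : ℕ) : Fin 3 → ℝ :=
  Fin.cons ((n : ℝ) / 2 ^ m) (seqPoint 2 C n)

/-- The first `m` dyadic digits of the coordinates of `X`. -/
def realDig (m : ℕ) (X : Fin 3 → ℝ) : Dig m := fun i j => (bdigit ((j : ℕ) + 1) (X i) : ZMod 2)

lemma pt_nonneg (m : ℕ) (C : Fin 2 → ℕ → ℕ → ZMod 2) (n : ℕ) (i : Fin 3) : 0 ≤ pt m C n i := by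
  refine Fin.cases ?_ (fun i => ?_) i
  · simp only [pt, Fin.cons_zero]; positivity
  · exact seqPoint_nonneg C n i

lemma NetUpTo.pt_lt_one (h : NetUpTo t m C) (hm : 1 ≤ m) {n : ℕ} (hn : n < 2 ^ m) (i : Fin 3) :
    pt m C n i < 1 := by
  refine Fin.cases ?_ (fun i => ?_) i
  · simp only [pt, Fin.cons_zero]
    rw [div_lt_one (by positivity)]
    exact_mod_cast hn
  · exact h.lt_one hm hn i

lemma zmod_two_natCast_eq {a b : ℕ} (ha : a < 2) (hb : b < 2) : (a : ZMod 2) = b ↔ a = b := by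
  rw [ZMod.natCast_eq_natCast_iff', Nat.mod_eq_of_lt ha, Nat.mod_eq_of_lt hb]

/-- The digits of `v` as natural numbers, extended by zero. -/
def natDig {m : ℕ} (v : Fin m → ZMod 2) (j : ℕ) : ℕ := if h : j < m then (v ⟨j, h⟩).val else 0

lemma natDig_lt {m : ℕ} (v : Fin m → ZMod 2) (j : ℕ) : natDig v j < 2 := by
  unfold natDig; split_ifs
  · exact ZMod.val_lt _
  · norm_num

lemma natDig_cast {m : ℕ} (v : Fin m → ZMod 2) (j : Fin m) : (natDig v j : ZMod 2) = v j := by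
  simp [natDig]

lemma fl_eq_pre_natDig_iff {x : ℝ} (hx1 : x < 1) {d : ℕ} (hd : d ≤ m) (v : Fin m → ZMod 2) :
    fl d x = pre (natDig v) d ↔ ∀ j : Fin m, (j : ℕ) < d → (bdigit ((j : ℕ) + 1) x : ZMod 2) = v j := by
  rw [fl_eq_pre_iff (natDig_lt v) hx1]
  have hb : ∀ j, bdigit (j + 1) x < 2 := fun j => by rw [bdigit_eq]; omega
  constructor
  · intro h j hj
    rw [h j hj, natDig_cast]
  · intro h j hj
    have := h ⟨j, by omega⟩ hj
    rw [← natDig_cast v ⟨j, by omega⟩] at this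
    exact (zmod_two_natCast_eq (hb j) (natDig_lt v j)).mp this

lemma agree_realDig_iff {X : Fin 3 → ℝ} (hX : ∀ i, X i < 1) {d : Fin 3 → ℕ} (hd : ∀ i, d i ≤ m)
    (v : Dig m) : Agree d (realDig m X) v ↔ ∀ i, fl (d i) (X i) = pre (natDig (v i)) (d i) := by
  simp_rw [fun i => fl_eq_pre_natDig_iff (hX i) (hd i) (v i)]
  rfl

lemma fl_natCast_div {d : ℕ} (hd : d ≤ m) (n : ℕ) : fl d ((n : ℝ) / 2 ^ m) = n / 2 ^ (m - d) := by
  obtain ⟨k, rfl⟩ := Nat.exists_eq_add_of_le hd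
  rw [fl, Nat.add_sub_cancel_left, ← Nat.floor_div_eq_div (K := ℝ), pow_add]
  congr 1
  push_cast
  field_simp

lemma NetUpTo.dnet (h : NetUpTo t m C) (hm : 1 ≤ m) :
    DNet t fun n : Fin (2 ^ m) => realDig m (pt m C n) := by
  refine ⟨by simp, fun d hd v => ?_⟩
  have hdm : ∀ i, d i ≤ m := fun i =>
    (Finset.single_le_sum (fun _ _ => Nat.zero_le _) (Finset.mem_univ i)).trans (by omega)
  simp only [cnt, agree_realDig_iff (h.pt_lt_one hm (Fin.is_lt _)) hdm]
  rw [Finset.sum_boole]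
  set a : Fin 3 → ℕ := fun i => pre (natDig (v i)) (d i)
  have ha : ∀ i, a i < 2 ^ d i := fun i => pre_lt (natDig_lt _) _
  rw [Fin.sum_univ_succ] at hd
  set M := m - d 0
  have hMm : M + d 0 = m := by have := hdm 0; omega
  have hcard : (Finset.univ.filter fun n : Fin (2 ^ m) => ∀ i, fl (d i) (pt m C n i) = a i).card =
      (Finset.univ.filter fun r : Fin (2 ^ M) =>
        ∀ i : Fin 2, fl (d i.succ) (seqPoint 2 C (a 0 * 2 ^ M + (r : ℕ)) i) = a i.succ).card := by
    have hlt : ∀ r : Fin (2 ^ M), a 0 * 2 ^ M + (r : ℕ) < 2 ^ m := by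
      intro r
      calc a 0 * 2 ^ M + (r : ℕ) < (a 0 + 1) * 2 ^ M := by rw [add_mul]; have := r.2; omega
        _ ≤ 2 ^ d 0 * 2 ^ M := Nat.mul_le_mul_right _ (ha 0)
        _ = 2 ^ m := by rw [← pow_add, add_comm, hMm]
    have h0 : ∀ n : ℕ, fl (d 0) (pt m C n 0) = n / 2 ^ M := fun n => fl_natCast_div (hdm 0) n
    symm
    refine Finset.card_bij (fun r _ => ⟨a 0 * 2 ^ M + (r : ℕ), hlt r⟩) ?_ ?_ ?_
    · intro r hr
      simp only [Finset.mem_filter, Finset.mem_univ, true_and] at hr ⊢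
      refine Fin.cases ?_ hr
      rw [h0, mul_comm, Nat.mul_add_div (by positivity), Nat.div_eq_of_lt r.2, add_zero]
    · intro r _ r' _ he
      have := congrArg Fin.val he
      simp only at this
      exact Fin.ext (by omega)
    · intro n hn
      simp only [Finset.mem_filter, Finset.mem_univ, true_and] at hn
      have hn0 := hn 0
      rw [h0] at hn0
      have hmod : a 0 * 2 ^ M + (n : ℕ) % 2 ^ M = n := by
        rw [← hn0, mul_comm]; exact Nat.div_add_mod _ _
      refine ⟨⟨(n : ℕ) % 2 ^ M, Nat.mod_lt _ (by positivity)⟩, ?_, Fin.ext hmod⟩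
      simp only [Finset.mem_filter, Finset.mem_univ, true_and, hmod]
      exact fun i => hn i.succ
  rw [hcard]
  have key : (Finset.univ.filter fun r : Fin (2 ^ M) =>
      ∀ i : Fin 2, fl (d i.succ) (seqPoint 2 C (a 0 * 2 ^ M + (r : ℕ)) i) = a i.succ).card =
      2 ^ (M - ∑ i : Fin 2, d i.succ) := by
    rcases Nat.eq_zero_or_pos M with hM | hM
    · have hd1 : ∀ i : Fin 2, d i.succ = 0 := fun i => by
        have := Finset.single_le_sum (f := fun i : Fin 2 => d i.succ) (fun _ _ => Nat.zero_le _)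
          (Finset.mem_univ i)
        omega
      have ha1 : ∀ i : Fin 2, a i.succ = 0 := fun i => by
        have := ha i.succ
        rw [hd1] at this
        omega
      rw [Finset.filter_true_of_mem, Finset.card_univ, Fintype.card_fin, hM]
      · simp
      · intro r _ i
        rw [hd1, ha1, fl_zero]
        refine h.lt_one hm ?_ i
        have h2 : 2 ^ M = 1 := by rw [hM, pow_zero]
        have h3 := ha 0
        rw [show d 0 = m by omega] at h3
        have hr := r.2.trans_eq h2
        have h4 : a 0 * 2 ^ M = a 0 := by rw [h2, mul_one]
        omega
    · exact h.card_box (by omega) (a 0) (fun i => d i.succ) (fun i => a i.succ)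
        (fun i => ha i.succ) (by omega) hM
  rw [key, boxMean]
  have e : m = (M - ∑ i : Fin 2, d i.succ) + ∑ i, d i := by rw [Fin.sum_univ_succ d]; omega
  have e2 : (2 : ℝ) ^ m = 2 ^ (M - ∑ i : Fin 2, d i.succ) * 2 ^ ∑ i, d i := by
    rw [← pow_add, ← e]
  rw [e2, mul_assoc, ← mul_pow]
  norm_num

end

section

variable {m t : ℕ} {C : Fin 2 → ℕ → ℕ → ZMod 2}

/-- The digits of `(n / 2 ^ m, X_n)` prescribed by the generating matrices. -/
def formDig (m : ℕ) (C : Fin 2 → ℕ → ℕ → ZMod 2) (n : ℕ) : Dig m :=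
  Fin.cons (α := fun _ => Fin m → ZMod 2) (fun j => if n.testBit (m - 1 - j) then 1 else 0)
    fun i j => seqDig 2 C n i j

lemma seqDig_eq {s : ℕ} (C : Fin s → ℕ → ℕ → ZMod 2) {n K : ℕ} (hn : n < 2 ^ K) (i : Fin s) (j : ℕ) :
    seqDig s C n i j = ∑ r ∈ Finset.range K, C i j r * (if n.testBit r then 1 else 0) := by
  have h : ∀ K, n < 2 ^ K → ∑ r ∈ Finset.range K, C i j r * (if n.testBit r then 1 else 0) =
      ∑ r ∈ Finset.range (K + (n + 1)), C i j r * (if n.testBit r then 1 else 0) := by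
    intro K hK
    refine Finset.sum_subset (Finset.range_mono (by omega)) fun r _ hr => ?_
    rw [Nat.testBit_lt_two_pow (hK.trans_le (Nat.pow_le_pow_right (by norm_num) (by simpa using hr)))]
    simp
  have h' : ∀ K, ∑ r ∈ Finset.range (n + 1), C i j r * (if n.testBit r then 1 else 0) =
      ∑ r ∈ Finset.range (K + (n + 1)), C i j r * (if n.testBit r then 1 else 0) := by
    intro K
    refine Finset.sum_subset (Finset.range_mono (by omega)) fun r _ hr => ?_
    rw [Nat.testBit_lt_two_pow (Nat.lt_two_pow_self.trans_le
      (Nat.pow_le_pow_right (by norm_num) (by simp at hr; omega)))]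
    simp
  rw [seqDig, h K hn, h' K]

lemma bit_xor (a b r : ℕ) : (if (a ^^^ b).testBit r then (1 : ZMod 2) else 0) =
    (if a.testBit r then 1 else 0) + if b.testBit r then 1 else 0 := by
  have : (1 : ZMod 2) + 1 = 0 := rfl
  rw [Nat.testBit_xor]
  cases a.testBit r <;> cases b.testBit r <;> simp [this]

lemma formDig_xor {a b : ℕ} (ha : a < 2 ^ m) (hb : b < 2 ^ m) :
    formDig m C (a ^^^ b) = formDig m C a + formDig m C b := by
  ext i j
  refine Fin.cases ?_ (fun i => ?_) i
  · simp only [formDig, Pi.add_apply, Fin.cons_zero]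
    exact bit_xor _ _ _
  · simp only [formDig, Pi.add_apply, Fin.cons_succ]
    rw [seqDig_eq C ha, seqDig_eq C hb, seqDig_eq C (Nat.xor_lt_two_pow ha hb),
      ← Finset.sum_add_distrib]
    exact Finset.sum_congr rfl fun r _ => by rw [bit_xor, mul_add]

/-- The number of points in the box of a given point does not depend on the point. -/
lemma cnt_formDig (A : Fin 3 → ℕ) (n : Fin (2 ^ m)) :
    cnt (fun n : Fin (2 ^ m) => formDig m C n) A (formDig m C n) =
      cnt (fun n : Fin (2 ^ m) => formDig m C n) A 0 := by
  unfold cnt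
  let e : Fin (2 ^ m) ≃ Fin (2 ^ m) :=
    { toFun := fun k => ⟨(k : ℕ) ^^^ n, Nat.xor_lt_two_pow k.2 n.2⟩
      invFun := fun k => ⟨(k : ℕ) ^^^ n, Nat.xor_lt_two_pow k.2 n.2⟩
      left_inv := fun k => by simp
      right_inv := fun k => by simp }
  rw [← e.sum_comp]
  refine Finset.sum_congr rfl fun k _ => ?_
  have h : Agree A (formDig m C (e k : ℕ)) (formDig m C n) ↔ Agree A (formDig m C k) 0 := by
    have : formDig m C (e k : ℕ) = formDig m C k + formDig m C n := formDig_xor k.2 n.2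
    simp only [this, Agree, Pi.add_apply, Pi.zero_apply, add_eq_right]
  simp only [h]

lemma summable_digits {y : ℕ → ZMod 2} : Summable fun j : ℕ => ((y j).val : ℝ) / 2 ^ (j + 1) := by
  refine Summable.of_nonneg_of_le (fun j => by positivity) (fun j => ?_)
    (summable_geometric_two' 1)
  have : ((y j).val : ℝ) ≤ 1 := by
    have := ZMod.val_lt (y j)
    exact_mod_cast Nat.lt_succ_iff.mp this
  rw [pow_succ, mul_comm ((2 : ℝ) ^ j) 2, ← div_div]
  gcongr

lemma tsum_digits_le_one (y : ℕ → ZMod 2) : ∑' j : ℕ, ((y j).val : ℝ) / 2 ^ (j + 1) ≤ 1 := by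
  have h := summable_geometric_two' 1
  rw [← tsum_geometric_two' 1]
  refine summable_digits.tsum_le_tsum (fun j => ?_) h
  have : ((y j).val : ℝ) ≤ 1 := by
    have := ZMod.val_lt (y j)
    exact_mod_cast Nat.lt_succ_iff.mp this
  rw [pow_succ, mul_comm ((2 : ℝ) ^ j) 2, ← div_div]
  gcongr

lemma tsum_digits_mul_two_pow (y : ℕ → ZMod 2) (A : ℕ) :
    (∑' j : ℕ, ((y j).val : ℝ) / 2 ^ (j + 1)) * 2 ^ A =
      (pre (fun j => (y j).val) A : ℝ) + ∑' j : ℕ, ((y (A + j)).val : ℝ) / 2 ^ (j + 1) := by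
  induction A with
  | zero => simp [pre]
  | succ A ih =>
    rw [pow_succ, ← mul_assoc, ih, pre, summable_digits.tsum_eq_zero_add, add_mul, add_mul,
      ← tsum_mul_right]
    have : ∀ j : ℕ, ((y (A + (j + 1))).val : ℝ) / 2 ^ (j + 1 + 1) * 2 =
        ((y (A + 1 + j)).val : ℝ) / 2 ^ (j + 1) := fun j => by
      rw [pow_succ _ (j + 1), show A + (j + 1) = A + 1 + j by ring]; field_simp
    simp_rw [this]
    push_cast
    simp only [add_zero, pow_one]
    ring

/-- Real digits differ from the prescribed ones only at dyadic rationals. -/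
lemma bdigit_tsum_digits {y : ℕ → ZMod 2} {x : ℝ} (hx : x = ∑' j : ℕ, ((y j).val : ℝ) / 2 ^ (j + 1))
    (hx1 : x < 1) {A : ℕ} (h : (fl A x : ℝ) ≠ x * 2 ^ A) {j : ℕ} (hj : j < A) :
    (bdigit (j + 1) x : ZMod 2) = y j := by
  have hA := tsum_digits_mul_two_pow y A
  rw [← hx] at hA
  have h1 := tsum_digits_le_one fun j => y (A + j)
  have h0 : 0 ≤ ∑' j : ℕ, ((y (A + j)).val : ℝ) / 2 ^ (j + 1) := tsum_nonneg fun _ => by positivity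
  rcases h1.lt_or_eq with h1 | h1
  · have hfl : fl A x = pre (fun j => (y j).val) A := by
      rw [fl, hA, Nat.floor_eq_iff (by positivity)]
      constructor <;> linarith
    have := (fl_eq_pre_iff (fun j => ZMod.val_lt (y j)) hx1 A).mp hfl j hj
    rw [this, ZMod.natCast_zmod_val]
  · refine absurd ?_ h
    rw [h1] at hA
    rw [fl, hA, ← Nat.cast_succ, Nat.floor_natCast]

lemma fl_add_of_dyadic {A k : ℕ} {x : ℝ} (h : (fl A x : ℝ) = x * 2 ^ A) :
    fl (A + k) x = fl A x * 2 ^ k := by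
  rw [fl, pow_add, ← mul_assoc, ← h]
  exact_mod_cast Nat.floor_natCast (R := ℝ) _

lemma NetUpTo.card_dyadic_le (h : NetUpTo t m C) (hm : 1 ≤ m) (i : Fin 2) (A : ℕ) :
    (Finset.univ.filter fun n : Fin (2 ^ m) =>
      (fl A (seqPoint 2 C n i) : ℝ) = seqPoint 2 C n i * 2 ^ A).card ≤ 2 ^ (A + t) := by
  rcases le_or_gt m (A + t) with hA | hA
  · calc _ ≤ (Finset.univ : Finset (Fin (2 ^ m))).card := Finset.card_filter_le _ _
      _ ≤ 2 ^ (A + t) := by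
        rw [Finset.card_univ, Fintype.card_fin]
        exact Nat.pow_le_pow_right (by norm_num) hA
  · obtain ⟨k, hk⟩ := Nat.exists_eq_add_of_le hA.le
    rw [pow_add, mul_comm, ← Finset.card_range (2 ^ A)]
    refine Finset.card_le_mul_card_image_of_maps_to (f := fun n : Fin (2 ^ m) =>
      fl A (seqPoint 2 C n i)) ?_ _ ?_
    · intro n _
      exact Finset.mem_range.mpr (fl_lt (h.lt_one hm n.2 i) _)
    · intro b hb
      set d : Fin 2 → ℕ := fun i' => if i' = i then A + k else 0
      set a : Fin 2 → ℕ := fun i' => if i' = i then b * 2 ^ k else 0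
      have hd : ∑ i', d i' = A + k := by simp [d]
      have := h.card_box le_rfl 0 d a (fun i' => by
        simp only [d, a]
        split_ifs
        · rw [pow_add]; exact Nat.mul_lt_mul_of_pos_right (Finset.mem_range.mp hb) (by positivity)
        · simp) (by omega) hm
      rw [hd, show m - (A + k) = t by omega] at this
      rw [← this]
      refine Finset.card_le_card fun n hn => ?_
      simp only [Finset.mem_filter, Finset.mem_univ, true_and] at hn ⊢
      intro i'
      simp only [d, a, zero_mul, zero_add]
      split_ifs with hi
      · rw [hi, fl_add_of_dyadic hn.1, hn.2]
      · exact fl_zero (h.lt_one hm n.2 _)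

lemma bdigit_natCast_div {j : ℕ} (hj : j < m) (n : ℕ) :
    (bdigit (j + 1) ((n : ℝ) / 2 ^ m) : ZMod 2) = if n.testBit (m - 1 - j) then 1 else 0 := by
  rw [bdigit_eq, fl_natCast_div (by omega), Nat.testBit_eq_decide_div_mod_eq,
    show m - (j + 1) = m - 1 - j by omega]
  rcases Nat.mod_two_eq_zero_or_one (n / 2 ^ (m - 1 - j)) with h | h <;> simp [h]

lemma NetUpTo.defect_le (h : NetUpTo t m C) (hm : 1 ≤ m) (A : Fin 3 → ℕ) :
    defect (fun n : Fin (2 ^ m) => realDig m (pt m C n)) (fun n : Fin (2 ^ m) => formDig m C n) A ≤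
      2 ^ t * (2 ^ A 1 + 2 ^ A 2) := by
  have hpt : ∀ n : Fin (2 ^ m),
      (if Agree A (realDig m (pt m C n)) (formDig m C n) then (0 : ℝ) else 1) ≤
      ∑ i : Fin 2, if (fl (A i.succ) (seqPoint 2 C n i) : ℝ) = seqPoint 2 C n i * 2 ^ A i.succ
        then 1 else 0 := by
    intro n
    have hnn : ∀ i : Fin 2, (0 : ℝ) ≤ if (fl (A i.succ) (seqPoint 2 C n i) : ℝ) =
        seqPoint 2 C n i * 2 ^ A i.succ then 1 else 0 := fun i => by split_ifs <;> norm_num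
    split_ifs with hag
    · exact Finset.sum_nonneg fun i _ => hnn i
    · by_cases hex : ∃ i : Fin 2, (fl (A i.succ) (seqPoint 2 C n i) : ℝ) =
        seqPoint 2 C n i * 2 ^ A i.succ
      · obtain ⟨i, hi⟩ := hex
        refine le_trans (le_of_eq ?_) (Finset.single_le_sum (fun i _ => hnn i) (Finset.mem_univ i))
        exact (if_pos hi).symm
      · push Not at hex
        refine absurd ?_ hag
        intro i j hj
        revert hj
        refine Fin.cases (fun hj => ?_) (fun i hj => ?_) i
        · simp only [realDig, pt, formDig, Fin.cons_zero]
          exact bdigit_natCast_div j.2 n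
        · simp only [realDig, pt, formDig, Fin.cons_succ]
          exact bdigit_tsum_digits (y := fun j => seqDig 2 C n i j) rfl (h.lt_one hm n.2 i)
            (hex i) hj
  refine (Finset.sum_le_sum fun n _ => hpt n).trans ?_
  rw [Finset.sum_comm, Fin.sum_univ_two, Finset.sum_boole, Finset.sum_boole, mul_add, ← pow_add,
    ← pow_add, add_comm t, add_comm t]
  exact add_le_add (by exact_mod_cast h.card_dyadic_le hm 0 (A 1))
    (by exact_mod_cast h.card_dyadic_le hm 1 (A 2))

lemma NetUpTo.nearDigital (h : NetUpTo t m C) (hm : 1 ≤ m) (ht : t ≤ m) :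
    NearDigital t (fun n : Fin (2 ^ m) => realDig m (pt m C n))
      (fun n : Fin (2 ^ m) => formDig m C n) where
  net := h.dnet hm
  le := ht
  cls := fun A => ⟨_, cnt_formDig A⟩
  defect_le := h.defect_le hm

end

section

variable {m t : ℕ}

lemma bdigit_lt (j : ℕ) (x : ℝ) : bdigit j x < 2 := by rw [bdigit_eq]; omega

lemma val_natCast_bdigit (j : ℕ) (x : ℝ) : ((bdigit j x : ℕ) : ZMod 2).val = bdigit j x := by
  rw [ZMod.val_natCast, Nat.mod_eq_of_lt (bdigit_lt j x)]

lemma tsum_bdigit_aux {x : ℝ} (hx1 : x < 1) (A : ℕ) :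
    fl A x = pre (fun j => ((bdigit (j + 1) x : ℕ) : ZMod 2).val) A :=
  (fl_eq_pre_iff (fun _ => ZMod.val_lt _) hx1 A).mpr fun _ _ => (val_natCast_bdigit _ _).symm

lemma fl_le {x : ℝ} (hx : 0 ≤ x) (A : ℕ) : (fl A x : ℝ) ≤ x * 2 ^ A := Nat.floor_le (by positivity)

lemma lt_fl_add_one (x : ℝ) (A : ℕ) : x * 2 ^ A < fl A x + 1 := Nat.lt_floor_add_one _

/-- The dyadic expansion of a number in the unit interval. -/
lemma eq_tsum_bdigit {x : ℝ} (hx : 0 ≤ x) (hx1 : x < 1) :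
    ∑' j : ℕ, (((bdigit (j + 1) x : ℕ) : ZMod 2).val : ℝ) / 2 ^ (j + 1) = x := by
  set X := ∑' j : ℕ, (((bdigit (j + 1) x : ℕ) : ZMod 2).val : ℝ) / 2 ^ (j + 1) with hX
  have key : ∀ A : ℕ, |X - x| * 2 ^ A ≤ 1 := by
    intro A
    have h1 := tsum_digits_mul_two_pow (fun j => ((bdigit (j + 1) x : ℕ) : ZMod 2)) A
    rw [← hX, ← tsum_bdigit_aux hx1 A] at h1
    have h2 := tsum_digits_le_one fun j => ((bdigit (A + j + 1) x : ℕ) : ZMod 2)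
    have h3 : 0 ≤ ∑' j : ℕ, (((bdigit (A + j + 1) x : ℕ) : ZMod 2).val : ℝ) / 2 ^ (j + 1) :=
      tsum_nonneg fun _ => by positivity
    have h4 := fl_le hx A
    have h5 := lt_fl_add_one x A
    rw [← abs_of_pos (show (0 : ℝ) < 2 ^ A by positivity), ← abs_mul, abs_le]
    constructor <;> linarith
  by_contra hne
  have hpos : 0 < |X - x| := abs_pos.mpr (sub_ne_zero.mpr hne)
  obtain ⟨A, hA⟩ := pow_unbounded_of_one_lt (|X - x|⁻¹) (show (1 : ℝ) < 2 by norm_num)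
  have := mul_lt_mul_of_pos_left hA hpos
  rw [mul_inv_cancel₀ hpos.ne'] at this
  linarith [key A]

lemma fl_natCast_div_add (k n : ℕ) : fl (m + k) ((n : ℝ) / 2 ^ m) = n * 2 ^ k := by
  rw [fl, pow_add, ← mul_assoc, div_mul_cancel₀ _ (by positivity)]
  exact_mod_cast Nat.floor_natCast (R := ℝ) _

lemma xorReal_spec {x : ℝ} (hx : 0 ≤ x) (hx1 : x < 1) (n : ℕ) :
    0 ≤ xorReal x ((n : ℝ) / 2 ^ m) ∧ xorReal x ((n : ℝ) / 2 ^ m) < 1 ∧ ∀ j < m,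
      (bdigit (j + 1) (xorReal x ((n : ℝ) / 2 ^ m)) : ZMod 2) =
        bdigit (j + 1) x + bdigit (j + 1) ((n : ℝ) / 2 ^ m) := by
  set y : ℕ → ZMod 2 := fun j => ((bdigit (j + 1) x : ℕ) : ZMod 2) +
    ((bdigit (j + 1) ((n : ℝ) / 2 ^ m) : ℕ) : ZMod 2) with hy
  set q := xorReal x ((n : ℝ) / 2 ^ m) with hq
  have hqy : q = ∑' j : ℕ, ((y j).val : ℝ) / 2 ^ (j + 1) := by
    rw [hq, xorReal]
    refine tsum_congr fun j => ?_
    rw [hy]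
    simp only
    rw [← Nat.cast_add, ZMod.val_natCast]
  have htail : ∀ j, y (m + j) = ((bdigit (m + j + 1) x : ℕ) : ZMod 2) := by
    intro j
    have : bdigit (m + j + 1) ((n : ℝ) / 2 ^ m) = 0 := by
      rw [bdigit_eq, add_assoc, fl_natCast_div_add, pow_succ, ← mul_assoc]
      omega
    rw [hy]
    simp [this]
  have h0 : 0 ≤ q := by rw [hqy]; exact tsum_nonneg fun _ => by positivity
  have hxm := tsum_digits_mul_two_pow (fun j => ((bdigit (j + 1) x : ℕ) : ZMod 2)) m
  rw [eq_tsum_bdigit hx hx1, ← tsum_bdigit_aux hx1 m] at hxm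
  have hqm := tsum_digits_mul_two_pow y m
  simp_rw [htail] at hqm
  rw [← hqy] at hqm
  have hlt := lt_fl_add_one x m
  have h3 : 0 ≤ ∑' j : ℕ, (((bdigit (m + j + 1) x : ℕ) : ZMod 2).val : ℝ) / 2 ^ (j + 1) :=
    tsum_nonneg fun _ => by positivity
  have hv : ∀ j, (y j).val < 2 := fun j => ZMod.val_lt _
  have hfl : fl m q = pre (fun j => (y j).val) m := by
    rw [fl, Nat.floor_eq_iff (by positivity)]
    constructor <;> linarith
  have h1 : q < 1 := by
    have hp : (pre (fun j => (y j).val) m : ℝ) + 1 ≤ 2 ^ m := by exact_mod_cast pre_lt hv m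
    have := lt_fl_add_one q m
    rw [hfl] at this
    have h2 : q * 2 ^ m < 1 * 2 ^ m := by linarith
    exact lt_of_mul_lt_mul_right h2 (by positivity)
  refine ⟨h0, h1, fun j hj => ?_⟩
  rw [(fl_eq_pre_iff hv h1 m).mp hfl j hj, ZMod.natCast_zmod_val]

lemma realDig_xorVec {X : Fin 3 → ℝ} (h0 : ∀ i, 0 ≤ X i) (h1 : ∀ i, X i < 1)
    (T : Fin 3 → Fin (2 ^ m)) :
    realDig m (xorVec X (Qpt m T)) = realDig m X + realDig m (Qpt m T) := by
  ext i j
  exact (xorReal_spec (h0 i) (h1 i) (T i)).2.2 j j.2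

/-- The indicator of the dyadic interval on which the first digit different from that of `v` has
index `a` (of the whole interval for `a = 0`). -/
def firstDiff (a : ℕ) (u v : Fin m → ZMod 2) : ℝ :=
  if ∀ j : Fin m, (j : ℕ) < a → u j = v j + (if (j : ℕ) + 1 = a then 1 else 0) then 1 else 0

/-- The one-dimensional sign. -/
def sgnOne (a : ℕ) : ℝ := if a = 0 then 1 else -1

lemma lt_of_fl_lt {d : ℕ} {x y : ℝ} (h : fl d x < fl d y) : x < y := by
  by_contra hxy
  push Not at hxy
  exact absurd (Nat.floor_le_floor (mul_le_mul_of_nonneg_right hxy (by positivity))) (not_le.mpr h)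

lemma firstDiff_zero (u v : Fin m → ZMod 2) : firstDiff 0 u v = 1 := if_pos fun j hj => by omega

lemma firstDiff_of_first {u v : Fin m → ZMod 2} {j₀ : Fin m} (hne : u j₀ ≠ v j₀)
    (hlt : ∀ j < j₀, u j = v j) (a : ℕ) (ha : a < m) :
    firstDiff (a + 1) u v = if a = j₀ then 1 else 0 := by
  unfold firstDiff
  congr 1
  rw [eq_iff_iff]
  constructor
  · intro h
    by_contra hne'
    rcases lt_or_gt_of_ne hne' with hl | hl
    · have h1 := h ⟨a, ha⟩ (Nat.lt_succ_self a)
      rw [hlt ⟨a, ha⟩ hl] at h1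
      simp at h1
    · have h1 := h j₀ (by omega)
      rw [if_neg (by omega), add_zero] at h1
      exact hne h1
  · rintro rfl j hj
    rcases (Nat.lt_succ_iff.mp hj).lt_or_eq with hl | hl
    · rw [hlt j hl, if_neg (by omega), add_zero]
    · obtain rfl : j = j₀ := Fin.ext hl
      rw [if_pos rfl]
      rcases zmod_two_cases (u j) with h1 | h1 <;> rcases zmod_two_cases (v j) with h2 | h2 <;>
        rw [h1, h2] at hne ⊢ <;> first | rfl | exact absurd rfl hne

lemma sum_firstDiff (u v : Fin m → ZMod 2) (r : ℕ → ℝ) {j₀ : Fin m} (hne : u j₀ ≠ v j₀)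
    (hlt : ∀ j < j₀, u j = v j) (hr : r 0 = 1) :
    ∑ a ∈ Finset.range (m + 1), sgnOne a * r a * firstDiff a u v = 1 - r ((j₀ : ℕ) + 1) := by
  rw [Finset.sum_range_succ', firstDiff_zero, hr]
  have : ∀ a ∈ Finset.range m, sgnOne (a + 1) * r (a + 1) * firstDiff (a + 1) u v =
      if a = j₀ then -r ((j₀ : ℕ) + 1) else 0 := by
    intro a ha
    rw [firstDiff_of_first hne hlt a (Finset.mem_range.mp ha), sgnOne, if_neg (by omega)]
    split_ifs with h
    · rw [h]; ring
    · ring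
  rw [Finset.sum_congr rfl this, Finset.sum_ite_eq', if_pos (Finset.mem_range.mpr j₀.2), sgnOne]
  simp
  ring

lemma sum_firstDiff_of_eq (u : Fin m → ZMod 2) (r : ℕ → ℝ) (hr : r 0 = 1) :
    ∑ a ∈ Finset.range (m + 1), sgnOne a * r a * firstDiff a u u = 1 := by
  rw [Finset.sum_range_succ', firstDiff_zero, hr]
  have : ∀ a ∈ Finset.range m, sgnOne (a + 1) * r (a + 1) * firstDiff (a + 1) u u = 0 := by
    intro a ha
    rw [firstDiff, if_neg, mul_zero]
    intro h
    have := h ⟨a, Finset.mem_range.mp ha⟩ (Nat.lt_succ_self a)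
    simp at this
  rw [Finset.sum_eq_zero this]
  simp [sgnOne]

/-- The truncated Rademacher expansion of the indicator of `[0, y)`. -/
lemma abs_indicator_sub_le {q y : ℝ} (hq1 : q < 1) (hy1 : y < 1) {u v : Fin m → ZMod 2}
    (hu : ∀ j : Fin m, (bdigit ((j : ℕ) + 1) q : ZMod 2) = u j)
    (hv : ∀ j : Fin m, (bdigit ((j : ℕ) + 1) y : ZMod 2) = v j) :
    |(if q < y then (1 : ℝ) else 0) -
      1 / 2 * ∑ a ∈ Finset.range (m + 1), sgnOne a * rad a v * firstDiff a u v| ≤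
      1 / 2 * (if u = v then 1 else 0) ∧
    |1 / 2 * ∑ a ∈ Finset.range (m + 1), sgnOne a * rad a v * firstDiff a u v| ≤ 1 := by
  have hr0 : rad 0 v = 1 := dif_neg (by omega)
  by_cases huv : u = v
  · subst huv
    rw [sum_firstDiff_of_eq u (fun a => rad a u) hr0, if_pos rfl]
    constructor
    · split_ifs <;> norm_num [abs_of_pos, abs_of_neg]
    · norm_num [abs_of_pos]
  · have hex : ∃ j, u j ≠ v j := Function.ne_iff.mp huv
    obtain ⟨j₀, hj₀, hmin⟩ := WellFounded.has_min (wellFounded_lt (α := Fin m)) {j | u j ≠ v j} hex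
    have hlt : ∀ j < j₀, u j = v j := fun j hj => by
      by_contra h
      exact hmin j h hj
    rw [sum_firstDiff u v (fun a => rad a v) hj₀ hlt hr0, if_neg huv]
    have hrj : rad ((j₀ : ℕ) + 1) v = sgn (v j₀) := by
      rw [rad, dif_pos ⟨by omega, j₀.2⟩]
      congr 1
    have hfl : fl j₀ q = fl j₀ y := by
      rw [(fl_eq_pre_natDig_iff hq1 j₀.2.le v).mpr fun j hj => (hu j).trans (hlt j hj),
        (fl_eq_pre_natDig_iff hy1 j₀.2.le v).mpr fun j _ => hv j]
    have hq := fl_succ j₀ q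
    have hy := fl_succ j₀ y
    have hbu := hu j₀
    have hbv := hv j₀
    have hbq := bdigit_lt ((j₀ : ℕ) + 1) q
    have hby := bdigit_lt ((j₀ : ℕ) + 1) y
    have h01 : ((0 : ℕ) : ZMod 2) = 0 := Nat.cast_zero
    have h11 : ((1 : ℕ) : ZMod 2) = 1 := Nat.cast_one
    rw [hrj]
    rcases zmod_two_cases (v j₀) with h2 | h2
    · have h1 : u j₀ = 1 := (zmod_two_cases _).resolve_left fun h => hj₀ (h.trans h2.symm)
      rw [h1, ← h11, zmod_two_natCast_eq hbq (by norm_num)] at hbu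
      rw [h2, ← h01, zmod_two_natCast_eq hby (by norm_num)] at hbv
      have : y < q := lt_of_fl_lt (d := j₀ + 1) (by omega)
      rw [h2, sgn_zero, if_neg this.le.not_gt]
      norm_num
    · have h1 : u j₀ = 0 := (zmod_two_cases _).resolve_right fun h => hj₀ (h.trans h2.symm)
      rw [h1, ← h01, zmod_two_natCast_eq hbq (by norm_num)] at hbu
      rw [h2, ← h11, zmod_two_natCast_eq hby (by norm_num)] at hbv
      have : q < y := lt_of_fl_lt (d := j₀ + 1) (by omega)
      rw [h2, sgn_one, if_pos this]
      norm_num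

/-- The truncated Rademacher expansion of the identity. -/
lemma abs_sub_sum_rad_le {y : ℝ} (hy0 : 0 ≤ y) (hy1 : y < 1) {v : Fin m → ZMod 2}
    (hv : ∀ j : Fin m, (bdigit ((j : ℕ) + 1) y : ZMod 2) = v j) :
    |y - 1 / 2 * ∑ a ∈ Finset.range (m + 1), sgnOne a * rad a v * (1 / 2) ^ a| ≤
      1 / 2 * (1 / 2) ^ m ∧
    |1 / 2 * ∑ a ∈ Finset.range (m + 1), sgnOne a * rad a v * (1 / 2) ^ a| ≤ 1 := by
  have key : ∀ d ≤ m, ∑ a ∈ Finset.range (d + 1), sgnOne a * rad a v * (1 / 2) ^ a =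
      (2 * fl d y + 1) * (1 / 2) ^ d := by
    intro d
    induction d with
    | zero => intro _; simp [sgnOne, rad, fl_zero hy1]
    | succ d ih =>
      intro hd
      have hb : rad (d + 1) v = 1 - 2 * bdigit (d + 1) y := by
        rw [rad, dif_pos ⟨by omega, hd⟩]
        have h := hv ⟨d, hd⟩
        simp only at h
        rw [show (⟨d + 1 - 1, by omega⟩ : Fin m) = ⟨d, hd⟩ from rfl, ← h]
        have hlt := bdigit_lt (d + 1) y
        generalize bdigit (d + 1) y = b at hlt
        interval_cases b
        · simp [sgn_zero]
        · simp [sgn_one]; norm_num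
      rw [Finset.sum_range_succ, ih (by omega), hb, fl_succ, sgnOne, if_neg (by omega)]
      push_cast
      rw [pow_succ]
      ring
  rw [key m le_rfl]
  have h1 := fl_le hy0 m
  have h2 := lt_fl_add_one y m
  have h3 : (fl m y : ℝ) + 1 ≤ 2 ^ m := by exact_mod_cast fl_lt hy1 m
  have hp : (0 : ℝ) < (1 / 2) ^ m := by positivity
  have h22 : (2 : ℝ) ^ m * (1 / 2) ^ m = 1 := by rw [← mul_pow]; norm_num
  have h1' := mul_le_mul_of_nonneg_right h1 hp.le
  have h2' := mul_le_mul_of_nonneg_right h2.le hp.le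
  have h3' := mul_le_mul_of_nonneg_right h3 hp.le
  have h0' : 0 ≤ (fl m y : ℝ) * (1 / 2) ^ m := by positivity
  rw [mul_assoc, h22, mul_one] at h1' h2'
  constructor <;> rw [abs_le] <;> constructor <;> nlinarith

end

section

variable {m t : ℕ}

lemma prod_half_sum (F : Fin 3 → ℕ → ℝ) :
    ∏ i, (1 / 2 * ∑ a ∈ Finset.range (m + 1), F i a) = 1 / 8 * ∑ A ∈ allIdx m, ∏ i, F i (A i) := by
  rw [Finset.prod_mul_distrib, Finset.prod_univ_sum]
  congr 1
  norm_num

lemma prod_ite_forall {ι : Type*} [Fintype ι] (p : ι → Prop) [∀ i, Decidable (p i)]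
    [Decidable (∀ i, p i)] : ∏ i, (if p i then (1 : ℝ) else 0) = if ∀ i, p i then 1 else 0 := by
  split_ifs with h
  · exact Finset.prod_eq_one fun i _ => if_pos (h i)
  · obtain ⟨i, hi⟩ := not_forall.mp h
    exact Finset.prod_eq_zero (Finset.mem_univ i) (if_neg hi)

lemma prod_firstDiff (A : Fin 3 → ℕ) (x τ v : Dig m) :
    ∏ i, firstDiff (A i) ((x + τ) i) (v i) = if Agree A x (τ + v + unitArr A) then 1 else 0 := by
  unfold firstDiff
  rw [prod_ite_forall fun i => ∀ j : Fin m, (j : ℕ) < A i →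
    (x + τ) i j = v i j + if (j : ℕ) + 1 = A i then 1 else 0]
  congr 1
  rw [eq_iff_iff]
  refine forall_congr' fun i => forall_congr' fun j => imp_congr_right fun _ => ?_
  simp only [Pi.add_apply, unitArr]
  rw [add_assoc, ← eq_sub_iff_add_eq, CharTwo.sub_eq_add, add_comm _ (τ i j)]

lemma partDisc_allIdx {N : Type*} [Fintype N] (x : N → Dig m)
    (τ v : Dig m) : partDisc x (allIdx m) v (τ + v) =
    ∑ n, ∏ i, (1 / 2 * ∑ a ∈ Finset.range (m + 1),
      sgnOne a * rad a (v i) * firstDiff a ((x n + τ) i) (v i)) -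
    2 ^ m * ∏ i, (1 / 2 * ∑ a ∈ Finset.range (m + 1), sgnOne a * rad a (v i) * (1 / 2) ^ a) := by
  simp_rw [prod_half_sum]
  rw [← Finset.mul_sum, Finset.sum_comm, mul_left_comm, ← mul_sub, partDisc, Finset.mul_sum _ _ (2 ^ m),
    ← Finset.sum_sub_distrib]
  congr 1
  refine Finset.sum_congr rfl fun A _ => ?_
  simp_rw [Finset.prod_mul_distrib, prod_firstDiff]
  rw [← Finset.mul_sum, Finset.prod_pow_eq_pow_sum, lam, boxCnt, boxMean, cnt, sgnIdx, radV]
  simp only [sgnOne]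
  ring

lemma realDig_apply (X : Fin 3 → ℝ) (i : Fin 3) (j : Fin m) :
    (bdigit ((j : ℕ) + 1) (X i) : ZMod 2) = realDig m X i j := rfl

/-- The local discrepancy is uniformly close to its truncated expansion. -/
theorem abs_Dloc_sub_le {P : Fin (2 ^ m) → Fin 3 → ℝ} (h0 : ∀ n i, 0 ≤ P n i)
    (h1 : ∀ n i, P n i < 1) (hx : DNet t fun n => realDig m (P n)) (ht : t ≤ m)
    (T : Fin 3 → Fin (2 ^ m)) {Y : Fin 3 → ℝ} (hY : ∀ i, Y i ∈ Set.Ico (0 : ℝ) 1) :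
    |Dloc (fun n => xorVec (P n) (Qpt m T)) Y -
      partDisc (fun n => realDig m (P n)) (allIdx m) (realDig m Y)
        (realDig m (Qpt m T) + realDig m Y)| ≤ 3 * 2 ^ t := by
  set τ := realDig m (Qpt m T)
  set v := realDig m Y
  set q := fun n => xorVec (P n) (Qpt m T)
  have hq0 : ∀ n i, 0 ≤ q n i := fun n i => (xorReal_spec (m := m) (h0 n i) (h1 n i) (T i)).1
  have hq1 : ∀ n i, q n i < 1 := fun n i => (xorReal_spec (m := m) (h0 n i) (h1 n i) (T i)).2.1
  have hqd : ∀ n, realDig m (q n) = realDig m (P n) + τ := fun n => realDig_xorVec (h0 n) (h1 n) T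
  rw [partDisc_allIdx]
  set f : Fin (2 ^ m) → Fin 3 → ℝ := fun n i => 1 / 2 * ∑ a ∈ Finset.range (m + 1),
    sgnOne a * rad a (v i) * firstDiff a ((realDig m (P n) + τ) i) (v i)
  set h : Fin 3 → ℝ := fun i => 1 / 2 * ∑ a ∈ Finset.range (m + 1),
    sgnOne a * rad a (v i) * (1 / 2) ^ a
  have hf : ∀ n i, |(if q n i < Y i then (1 : ℝ) else 0) - f n i| ≤
      1 / 2 * (if (realDig m (P n) + τ) i = v i then 1 else 0) ∧ |f n i| ≤ 1 := fun n i =>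
    abs_indicator_sub_le (hq1 n i) (hY i).2 (fun j => by rw [realDig_apply, hqd])
      fun j => realDig_apply Y i j
  have hh : ∀ i, |Y i - h i| ≤ 1 / 2 * (1 / 2) ^ m ∧ |h i| ≤ 1 := fun i =>
    abs_sub_sum_rad_le (hY i).1 (hY i).2 fun j => realDig_apply Y i j
  have e1 : ∀ n, (if ∀ i, 0 ≤ q n i ∧ q n i < Y i then (1 : ℝ) else 0) =
      ∏ i, if q n i < Y i then (1 : ℝ) else 0 := by
    intro n
    rw [prod_ite_forall fun i => q n i < Y i]
    congr 1
    simp only [hq0, true_and]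
  have hA : |∑ n, ((∏ i, if q n i < Y i then (1 : ℝ) else 0) - ∏ i, f n i)| ≤ 3 / 2 * 2 ^ t := by
    calc _ ≤ ∑ n, ∑ i, 1 / 2 * (if (realDig m (P n) + τ) i = v i then (1 : ℝ) else 0) := by
          refine (Finset.abs_sum_le_sum_abs _ _).trans (Finset.sum_le_sum fun n _ => ?_)
          refine (abs_prod_sub_prod_le Finset.univ _ _ (fun i _ => ?_) fun i _ => (hf n i).2).trans
            (Finset.sum_le_sum fun i _ => (hf n i).1)
          split_ifs <;> norm_num
      _ = ∑ i, 1 / 2 * ∑ n, (if (realDig m (P n) + τ) i = v i then (1 : ℝ) else 0) := by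
          rw [Finset.sum_comm]; simp_rw [Finset.mul_sum]
      _ ≤ ∑ _i : Fin 3, 1 / 2 * 2 ^ t := by
          refine Finset.sum_le_sum fun i _ => mul_le_mul_of_nonneg_left ?_ (by norm_num)
          refine le_trans (le_of_eq ?_) (hx.cnt_le ht (A := fun i' => if i' = i then m else 0)
            (by simp) (v + τ))
          refine Finset.sum_congr rfl fun n _ => ?_
          congr 1
          rw [eq_iff_iff]
          constructor
          · intro he i' j hj
            simp only at hj
            split_ifs at hj with hi
            · rw [hi]
              have := congrFun he j
              simp only [Pi.add_apply] at this ⊢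
              rw [← this, add_assoc, CharTwo.add_self_eq_zero, add_zero]
            · omega
          · intro hag
            ext j
            have := hag i j (by simp)
            simp only [Pi.add_apply] at this ⊢
            rw [this, add_assoc, CharTwo.add_self_eq_zero, add_zero]
      _ = 3 / 2 * 2 ^ t := by simp; ring
  have hB : |∏ i, Y i - ∏ i, h i| ≤ 3 * (1 / 2 * (1 / 2) ^ m) := by
    refine (abs_prod_sub_prod_le Finset.univ _ _ (fun i _ => ?_) fun i _ => (hh i).2).trans
      ((Finset.sum_le_sum fun i _ => (hh i).1).trans (le_of_eq (by simp)))
    rw [abs_of_nonneg (hY i).1]; exact (hY i).2.le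
  have e2 : Dloc q Y - (∑ n, ∏ i, f n i - 2 ^ m * ∏ i, h i) =
      ∑ n, ((∏ i, if q n i < Y i then (1 : ℝ) else 0) - ∏ i, f n i) -
        2 ^ m * (∏ i, Y i - ∏ i, h i) := by
    rw [Dloc, Finset.sum_congr rfl fun n _ => e1 n, Finset.sum_sub_distrib]
    push_cast
    ring
  rw [e2]
  have h22 : (2 : ℝ) ^ m * (1 / 2) ^ m = 1 := by rw [← mul_pow]; norm_num
  have h1t : (1 : ℝ) ≤ 2 ^ t := one_le_pow₀ (by norm_num)
  have hC : |(2 : ℝ) ^ m * (∏ i, Y i - ∏ i, h i)| ≤ 2 ^ m * (3 * (1 / 2 * (1 / 2) ^ m)) := by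
    rw [abs_mul, abs_of_pos (by positivity)]
    gcongr
  have h3 : (2 : ℝ) ^ m * (3 * (1 / 2 * (1 / 2) ^ m)) = 3 / 2 := by
    linear_combination 3 / 2 * h22
  rw [abs_le] at hA hC ⊢
  constructor <;> linarith [hA.1, hA.2, hC.1, hC.2]

end

section

variable {m t : ℕ}

/-- The half-open unit cube. -/
def unitCube : Set (Fin 3 → ℝ) := {Y | ∀ i, Y i ∈ Set.Ico (0 : ℝ) 1}

lemma unitCube_eq : unitCube = Set.univ.pi fun _ => Set.Ico (0 : ℝ) 1 := by
  ext Y; simp [unitCube]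

lemma measurableSet_unitCube : MeasurableSet unitCube := by
  rw [unitCube_eq]
  exact MeasurableSet.univ_pi fun _ => measurableSet_Ico

lemma volume_unitCube : volume unitCube = 1 := by
  rw [unitCube_eq, Real.volume_pi_Ico]
  simp

/-- The dyadic cell with digit array `v`. -/
def cell (v : Dig m) : Set (Fin 3 → ℝ) := {Y | Y ∈ unitCube ∧ realDig m Y = v}

lemma cell_eq (v : Dig m) : cell v = Set.univ.pi fun i =>
    Set.Ico ((pre (natDig (v i)) m : ℝ) / 2 ^ m) ((pre (natDig (v i)) m + 1) / 2 ^ m) := by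
  ext Y
  simp only [cell, Set.mem_ofPred_eq, Set.mem_pi, Set.mem_univ, true_implies, unitCube]
  have key : ∀ hY : ∀ i, Y i ∈ Set.Ico (0 : ℝ) 1, realDig m Y = v ↔
      ∀ i, fl m (Y i) = pre (natDig (v i)) m := by
    intro hY
    simp_rw [fun i => fl_eq_pre_natDig_iff (hY i).2 le_rfl (v i)]
    constructor
    · rintro rfl i j _
      rfl
    · intro h
      ext i j
      exact h i j j.2
  constructor
  · rintro ⟨hY, hv⟩ i
    exact (fl_eq_iff (hY i).1).mp ((key hY).mp hv i)
  · intro h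
    have hY : ∀ i, Y i ∈ Set.Ico (0 : ℝ) 1 := by
      refine fun i => ⟨le_trans (by positivity) (h i).1, (h i).2.trans_le ?_⟩
      rw [div_le_one (by positivity)]
      exact_mod_cast pre_lt (natDig_lt (v i)) m
    exact ⟨hY, (key hY).mpr fun i => (fl_eq_iff (hY i).1).mpr (h i)⟩

lemma measurableSet_cell (v : Dig m) : MeasurableSet (cell v) := by
  rw [cell_eq]
  exact MeasurableSet.univ_pi fun _ => measurableSet_Ico

lemma volume_real_cell (v : Dig m) : volume.real (cell v) = ((2 : ℝ) ^ (3 * m))⁻¹ := by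
  rw [cell_eq, Measure.real, Real.volume_pi_Ico_toReal]
  · rw [Finset.prod_congr rfl fun i _ => show ((pre (natDig (v i)) m + 1) / 2 ^ m : ℝ) -
      (pre (natDig (v i)) m : ℝ) / 2 ^ m = ((2 : ℝ) ^ m)⁻¹ by ring]
    simp [mul_comm 3 m, pow_mul]
  · intro i
    simp only
    gcongr
    linarith

lemma volume_cell_ne_top (v : Dig m) : volume (cell v) ≠ ⊤ := by
  rw [cell_eq, Real.volume_pi_Ico]
  exact ENNReal.prod_ne_top fun _ _ => ENNReal.ofReal_ne_top

lemma iUnion_cell : ⋃ v : Dig m, cell v = unitCube := by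
  ext Y
  simp [cell]

lemma pairwise_disjoint_cell : Pairwise (Function.onFun Disjoint (cell (m := m))) := fun _ _ hvw =>
  Set.disjoint_left.mpr fun _ hv hw => hvw (hv.2.symm.trans hw.2)

section Average

lemma integrableOn_comp_realDig {E : Type*} [NormedAddCommGroup E] (F : Dig m → E) :
    IntegrableOn (fun Y => F (realDig m Y)) unitCube := by
  rw [← iUnion_cell (m := m), integrableOn_finite_iUnion]
  intro v
  refine (integrableOn_congr_fun (g := fun _ => F v) (fun Y hY => ?_) (measurableSet_cell v)).mpr
    (integrableOn_const (volume_cell_ne_top v))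
  simp only [hY.2]

variable {E : Type*} [NormedAddCommGroup E] [NormedSpace ℝ E] [Module ℚ≥0 E] [IsScalarTower ℚ≥0 ℝ E]

lemma expect_eq_inv_card_smul {Ω : Type*} [Fintype Ω] (f : Ω → E) :
    𝔼 x, f x = (Fintype.card Ω : ℝ)⁻¹ • ∑ x, f x := by
  rw [Finset.expect]
  have : ((Fintype.card Ω : ℚ≥0)⁻¹ • (1 : ℝ)) = (Fintype.card Ω : ℝ)⁻¹ := by
    rw [NNRat.smul_def]; simp
  rw [← this, smul_assoc, one_smul]; rfl

variable [CompleteSpace E]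

lemma card_dig : (Fintype.card (Dig m) : ℝ) = 2 ^ (3 * m) := by
  have : Fintype.card (Dig m) = 2 ^ (3 * m) := by
    refine (Fintype.card_fun (α := Fin 3) (β := Fin m → ZMod 2)).trans ?_
    simp [ZMod.card, mul_comm 3 m, pow_mul]
  rw [this]; norm_num

lemma integral_comp_realDig (F : Dig m → E) :
    ∫ Y in unitCube, F (realDig m Y) = 𝔼 v, F v := by
  rw [expect_eq_inv_card_smul, card_dig, ← iUnion_cell (m := m),
    integral_iUnion_fintype measurableSet_cell pairwise_disjoint_cell, Finset.smul_sum]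
  · refine Finset.sum_congr rfl fun v _ => ?_
    rw [setIntegral_congr_fun (measurableSet_cell v) (g := fun _ => F v) fun Y hY => by
      simp only [hY.2], setIntegral_const, volume_real_cell]
  · intro v
    exact (integrableOn_comp_realDig F).mono_set (iUnion_cell (m := m) ▸ Set.subset_iUnion _ v)

lemma realDig_Qpt_bijective : Function.Bijective fun T : Fin 3 → Fin (2 ^ m) => realDig m (Qpt m T) := by
  rw [Fintype.bijective_iff_injective_and_card]
  constructor
  · intro T T' h
    ext i
    have hfl : ∀ T : Fin 3 → Fin (2 ^ m),
        pre (natDig (realDig m (Qpt m T) i)) m = T i := by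
      intro T
      have h1 : Qpt m T i < 1 := by
        rw [Qpt, div_lt_one (by positivity)]
        exact_mod_cast (T i).2
      rw [← (fl_eq_pre_natDig_iff h1 le_rfl (realDig m (Qpt m T) i)).mpr fun j _ => rfl, Qpt,
        fl_natCast_div le_rfl]
      simp
    have h' : realDig m (Qpt m T) = realDig m (Qpt m T') := h
    rw [← hfl T, ← hfl T', h']
  · have : (Fintype.card (Dig m) : ℝ) = Fintype.card (Fin 3 → Fin (2 ^ m)) := by
      rw [card_dig]
      simp [mul_comm 3 m, pow_mul]
    exact_mod_cast this.symm

/-- The average over all digital shifts and all boxes. -/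
def avg (m : ℕ) (f : (Fin 3 → Fin (2 ^ m)) → (Fin 3 → ℝ) → E) : E :=
  ((2 : ℝ) ^ (3 * m))⁻¹ • ∑ T, ∫ Y in unitCube, f T Y

lemma avg_comp_realDig (G : Dig m → Dig m → E) :
    avg m (fun T Y => G (realDig m (Qpt m T) + realDig m Y) (realDig m Y)) =
      𝔼 z, 𝔼 y, G z y := by
  rw [avg, Finset.sum_congr rfl fun T _ =>
    integral_comp_realDig fun v => G (realDig m (Qpt m T) + v) v]
  rw [realDig_Qpt_bijective.sum_comp fun z => 𝔼 v, G (z + v) v, ← card_dig,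
    ← expect_eq_inv_card_smul, Finset.expect_comm, Finset.expect_comm (f := G)]
  refine Finset.expect_congr rfl fun y _ => ?_
  simp_rw [add_comm _ y]
  exact Fintype.expect_equiv (Equiv.addRight y) _ _ fun _ => by simp [add_comm y]

theorem norm_avg_sub_le {f : (Fin 3 → Fin (2 ^ m)) → (Fin 3 → ℝ) → E} {G : Dig m → Dig m → E}
    {H : Dig m → Dig m → ℝ} (hf : ∀ T, IntegrableOn (f T) unitCube)
    (h : ∀ T, ∀ Y ∈ unitCube, ‖f T Y - G (realDig m (Qpt m T) + realDig m Y) (realDig m Y)‖ ≤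
      H (realDig m (Qpt m T) + realDig m Y) (realDig m Y)) :
    ‖avg m f - 𝔼 z, 𝔼 y, G z y‖ ≤ 𝔼 z, 𝔼 y, H z y := by
  rw [← avg_comp_realDig G, ← avg_comp_realDig H, avg, avg, avg, ← smul_sub,
    ← Finset.sum_sub_distrib, norm_smul, smul_eq_mul, Real.norm_of_nonneg (by positivity)]
  refine mul_le_mul_of_nonneg_left ((norm_sum_le _ _).trans (Finset.sum_le_sum fun T _ => ?_))
    (by positivity)
  rw [← integral_sub (hf T)
    (integrableOn_comp_realDig fun v => G (realDig m (Qpt m T) + v) v)]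
  refine norm_integral_le_of_norm_le
    (integrableOn_comp_realDig fun v => H (realDig m (Qpt m T) + v) v) ?_
  filter_upwards [ae_restrict_mem measurableSet_unitCube] with Y hY using h T Y hY

end Average

end

section

variable {m t W : ℕ} {C : Fin 2 → ℕ → ℕ → ZMod 2}

lemma measurable_Dloc {N s : ℕ} (P : Fin N → Fin s → ℝ) : Measurable (Dloc P) := by
  unfold Dloc
  refine Measurable.sub (Finset.measurable_fun_sum _ fun n _ => ?_) (by fun_prop)
  refine Measurable.ite ?_ measurable_const measurable_const
  rw [show {Y : Fin s → ℝ | ∀ i, 0 ≤ P n i ∧ P n i < Y i} =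
    ⋂ i, {Y : Fin s → ℝ | 0 ≤ P n i ∧ P n i < Y i} by ext; simp]
  refine MeasurableSet.iInter fun i => ?_
  by_cases h : 0 ≤ P n i
  · simp only [h, true_and]
    exact measurableSet_lt measurable_const (measurable_pi_apply i)
  · simp [h]

lemma abs_Dloc_le {N : ℕ} (P : Fin N → Fin 3 → ℝ) {Y : Fin 3 → ℝ} (hY : Y ∈ unitCube) :
    |Dloc P Y| ≤ N := by
  have h1 : 0 ≤ ∏ i, Y i := Finset.prod_nonneg fun i _ => (hY i).1
  have h2 : ∏ i, Y i ≤ 1 := Finset.prod_le_one (fun i _ => (hY i).1) fun i _ => (hY i).2.le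
  have h3 : 0 ≤ ∑ n : Fin N, if ∀ i, 0 ≤ P n i ∧ P n i < Y i then (1 : ℝ) else 0 :=
    Finset.sum_nonneg fun n _ => by split_ifs <;> norm_num
  have h4 : (∑ n : Fin N, if ∀ i, 0 ≤ P n i ∧ P n i < Y i then (1 : ℝ) else 0) ≤ N := by
    refine (Finset.sum_le_sum (g := fun _ => (1 : ℝ)) fun n _ => ?_).trans (by simp)
    split_ifs <;> norm_num
  have h5 := mul_le_mul_of_nonneg_left h2 (Nat.cast_nonneg (α := ℝ) N)
  have h6 := mul_nonneg (Nat.cast_nonneg (α := ℝ) N) h1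
  rw [Dloc, abs_le]
  constructor <;> linarith

/-- The local discrepancy of the shifted extended point set. -/
def shiftDisc (m : ℕ) (C : Fin 2 → ℕ → ℕ → ZMod 2) (T : Fin 3 → Fin (2 ^ m)) : (Fin 3 → ℝ) → ℝ :=
  Dloc fun n : Fin (2 ^ m) => xorVec (pt m C n) (Qpt m T)

lemma integrableOn_comp_shiftDisc {E : Type*} [NormedAddCommGroup E] [MeasurableSpace E]
    [BorelSpace E] [SecondCountableTopology E] {F : ℝ → E} (hF : Continuous F)
    (T : Fin 3 → Fin (2 ^ m)) : IntegrableOn (fun Y => F (shiftDisc m C T Y)) unitCube := by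
  obtain ⟨B, hB⟩ := (isCompact_Icc (a := -(((2 : ℕ) ^ m : ℕ) : ℝ))
    (b := ((2 : ℕ) ^ m : ℕ))).exists_bound_of_continuousOn hF.continuousOn
  refine Measure.integrableOn_of_bounded (M := B) (by rw [volume_unitCube]; simp)
    (hF.measurable.comp (measurable_Dloc _)).aestronglyMeasurable ?_
  filter_upwards [ae_restrict_mem measurableSet_unitCube] with Y hY
  exact hB _ (abs_le.mp (abs_Dloc_le _ hY))

/-- The digits of the extended point set. -/
def ptDig (m : ℕ) (C : Fin 2 → ℕ → ℕ → ZMod 2) (n : Fin (2 ^ m)) : Dig m := realDig m (pt m C n)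

lemma NetUpTo.abs_shiftDisc_sub_le (h : NetUpTo t m C) (hm : 1 ≤ m) (ht : t ≤ m)
    (T : Fin 3 → Fin (2 ^ m)) {Y : Fin 3 → ℝ} (hY : Y ∈ unitCube) :
    |shiftDisc m C T Y - partDisc (ptDig m C) (allIdx m) (realDig m Y)
      (realDig m (Qpt m T) + realDig m Y)| ≤ 3 * 2 ^ t :=
  abs_Dloc_sub_le (fun n i => pt_nonneg m C n i) (fun n i => h.pt_lt_one hm n.2 i) (h.dnet hm) ht T hY

/-- The variance of the main part. -/
def mainVar (t W m : ℕ) (C : Fin 2 → ℕ → ℕ → ZMod 2) : ℝ :=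
  1 / 64 * 𝔼 z : Dig m, gramSum (ptDig m C) t W z

/-- The variance of the remainder. -/
def restVar (t W m : ℕ) (C : Fin 2 → ℕ → ℕ → ZMod 2) : ℝ :=
  1 / 64 * ∑ A ∈ allIdx m \ mainIdx m t W, 𝔼 z : Dig m, lam (ptDig m C) A z ^ 2

lemma expect_partDisc_allIdx_sq (t W m : ℕ) (C : Fin 2 → ℕ → ℕ → ZMod 2) :
    𝔼 z : Dig m, 𝔼 y : Dig m, partDisc (ptDig m C) (allIdx m) y z ^ 2 =
      mainVar t W m C + restVar t W m C := by
  rw [expect_partDisc_sq _ le_rfl, ← Finset.sum_sdiff (mainIdx_subset (t := t) (W := W)), mainVar,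
    restVar]
  simp_rw [gramSum]
  rw [Finset.expect_sum_comm]
  ring

/-- The second moment of the discrepancy. -/
def secondMoment (m : ℕ) (C : Fin 2 → ℕ → ℕ → ZMod 2) : ℝ :=
  avg m fun T Y => shiftDisc m C T Y ^ 2

lemma NetUpTo.abs_secondMoment_sub_le (h : NetUpTo t m C) (hm : 1 ≤ m) (ht : t ≤ m) (W : ℕ) :
    |secondMoment m C - (mainVar t W m C + restVar t W m C)| ≤
      6 * 2 ^ t * Real.sqrt (mainVar t W m C + restVar t W m C) + 9 * (2 ^ t) ^ 2 := by
  have key := norm_avg_sub_le (m := m) (f := fun T Y => shiftDisc m C T Y ^ 2)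
    (G := fun z y => partDisc (ptDig m C) (allIdx m) y z ^ 2)
    (H := fun z y => 6 * 2 ^ t * |partDisc (ptDig m C) (allIdx m) y z| + 9 * (2 ^ t) ^ 2)
    (fun T => integrableOn_comp_shiftDisc (continuous_pow 2) T) (fun T Y hY => by
      have h1 := h.abs_shiftDisc_sub_le hm ht T hY
      set a := shiftDisc m C T Y
      set b := partDisc (ptDig m C) (allIdx m) (realDig m Y) (realDig m (Qpt m T) + realDig m Y)
      rw [Real.norm_eq_abs, show a ^ 2 - b ^ 2 = (a - b) * (2 * b + (a - b)) by ring, abs_mul]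
      have h2 : |2 * b + (a - b)| ≤ 2 * |b| + 3 * 2 ^ t := by
        refine (abs_add_le _ _).trans ?_
        rw [abs_mul, abs_two]
        linarith
      calc _ ≤ 3 * 2 ^ t * (2 * |b| + 3 * 2 ^ t) := mul_le_mul h1 h2 (abs_nonneg _) (by positivity)
        _ = _ := by ring)
  rw [expect_partDisc_allIdx_sq t W, Real.norm_eq_abs] at key
  refine key.trans ?_
  simp_rw [Finset.expect_add_distrib, ← Finset.mul_expect]
  have h3 := expect_expect_abs_le_sqrt fun (z y : Dig m) => partDisc (ptDig m C) (allIdx m) y z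
  rw [expect_partDisc_allIdx_sq t W] at h3
  have h4 : 𝔼 _z : Dig m, 𝔼 _y : Dig m, ((2 : ℝ) ^ t) ^ 2 = (2 ^ t) ^ 2 := by simp
  rw [h4]
  gcongr

lemma msp_eq_sqrt (m : ℕ) (C : Fin 2 → ℕ → ℕ → ZMod 2) :
    Msp 3 m 2 (fun n : Fin (2 ^ m) => pt m C n) = Real.sqrt (secondMoment m C) := by
  have e : ∀ T : Fin 3 → Fin (2 ^ m), ∫ Y in cube 3,
      |Dloc (fun n : Fin (2 ^ m) => xorVec (pt m C n) (Qpt m T)) Y| ^ (2 : ℝ) =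
      ∫ Y in unitCube, shiftDisc m C T Y ^ 2 := by
    intro T
    have hae : cube 3 =ᵐ[volume] unitCube := by
      rw [cube, unitCube_eq]
      have := (Measure.univ_pi_Ico_ae_eq_Icc (μ := fun _ : Fin 3 => (volume : Measure ℝ))
        (f := 0) (g := 1)).symm
      rwa [← Set.pi_univ_Icc] at this
    rw [setIntegral_congr_set hae]
    simp only [Real.rpow_two, sq_abs]
    rfl
  rw [Msp, Real.sqrt_eq_rpow, secondMoment, avg, Finset.sum_congr rfl fun T _ => e T, smul_eq_mul]
  congr 2
  rw [zpow_neg]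
  norm_cast

lemma NetUpTo.norm_avg_exp_sub_le (h : NetUpTo t m C) (hm : 1 ≤ m) (ht : t ≤ m) (W : ℕ) (τ : ℝ) :
    ‖avg m (fun T Y => Complex.exp (((τ * shiftDisc m C T Y : ℝ) : ℂ) * Complex.I)) -
      (Real.exp (-(τ ^ 2 / 2 * mainVar t W m C)) : ℂ)‖ ≤
    |τ| * (3 * 2 ^ t) + (|τ| * Real.sqrt (restVar t W m C) +
    (6 * (τ / 8) ^ 4 * ((m : ℝ) ^ 3 * (((W + t : ℕ) : ℝ) * 2 ^ t) ^ 4) +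
      (τ / 8) ^ 2 / 2 * Real.sqrt (16 * ((m : ℝ) ^ 3 * (((W + t : ℕ) : ℝ) * 2 ^ t) ^ 4))) +
    (τ / 8) ^ 2 / 2 * 𝔼 z : Dig m, |gramSum (ptDig m C) t W z -
      𝔼 z' : Dig m, gramSum (ptDig m C) t W z'|) := by
  refine (norm_sub_le_norm_sub_add_norm_sub _ (𝔼 z : Dig m, 𝔼 y : Dig m,
    Complex.exp (((τ * partDisc (ptDig m C) (allIdx m) y z : ℝ) : ℂ) * Complex.I)) _).trans
    (add_le_add ?_ ((h.nearDigital hm ht).norm_charFun_sub_le W τ))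
  refine (norm_avg_sub_le (H := fun _ _ => |τ| * (3 * 2 ^ t)) (fun T => ?_) fun T Y hY => ?_).trans
    (le_of_eq (by simp))
  · exact integrableOn_comp_shiftDisc
      (F := fun x => Complex.exp (((τ * x : ℝ) : ℂ) * Complex.I)) (by fun_prop) T
  · refine (norm_exp_mul_I_sub_le _ _).trans ?_
    rw [← mul_sub, abs_mul]
    exact mul_le_mul_of_nonneg_left (h.abs_shiftDisc_sub_le hm ht T hY) (abs_nonneg _)

end

section

lemma tendsto_ratio_of_bounds {S R q V : ℕ → ℝ} (hS : ∀ᶠ m in atTop, 0 < S m)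
    (hq : ∀ m, 0 ≤ q m)
    (hRS : Tendsto (fun m => R m / S m) atTop (𝓝 0))
    (hqS : Tendsto (fun m => q m ^ 2 / S m) atTop (𝓝 0))
    (hV : ∀ᶠ m in atTop, |V m - (S m + R m)| ≤ 6 * q m * Real.sqrt (S m + R m) + 9 * q m ^ 2) :
    Tendsto (fun m => V m / S m) atTop (𝓝 1) := by
  have h1 : Tendsto (fun m => 6 * Real.sqrt (q m ^ 2 / S m * (1 + R m / S m)) +
      9 * (q m ^ 2 / S m)) atTop (𝓝 0) := by
    have := (((hqS.mul (hRS.const_add 1)).sqrt).const_mul 6).add (hqS.const_mul 9)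
    simpa using this
  have h2 : Tendsto (fun m => V m / S m - (1 + R m / S m)) atTop (𝓝 0) := by
    refine squeeze_zero_norm' ?_ h1
    filter_upwards [hS, hV] with m hS hV
    have e : V m / S m - (1 + R m / S m) = (V m - (S m + R m)) / S m := by field_simp
    have e2 : q m ^ 2 / S m * (1 + R m / S m) = (q m) ^ 2 * (S m + R m) / S m ^ 2 := by
      field_simp
    rw [Real.norm_eq_abs, e, e2, abs_div, abs_of_pos hS, Real.sqrt_div' _ (by positivity),
      Real.sqrt_sq hS.le, Real.sqrt_mul (by positivity), Real.sqrt_sq (hq m), div_le_iff₀ hS]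
    refine hV.trans (le_of_eq ?_)
    field_simp
  simpa using h2.add (hRS.const_add 1)

theorem tendsto_charFun_of_bounds {S R q Q G V : ℕ → ℝ} {F : ℕ → ℝ → ℂ}
    (hS : ∀ᶠ m in atTop, 0 < S m) (hq : ∀ m, 0 ≤ q m)
    (hRS : Tendsto (fun m => R m / S m) atTop (𝓝 0))
    (hqS : Tendsto (fun m => q m ^ 2 / S m) atTop (𝓝 0))
    (hQS : Tendsto (fun m => Q m / S m ^ 2) atTop (𝓝 0))
    (hGS : Tendsto (fun m => G m / S m) atTop (𝓝 0))
    (hV : ∀ᶠ m in atTop, |V m - (S m + R m)| ≤ 6 * q m * Real.sqrt (S m + R m) + 9 * q m ^ 2)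
    (hF : ∀ᶠ m in atTop, ∀ τ : ℝ, ‖F m τ - (Real.exp (-(τ ^ 2 / 2 * S m)) : ℂ)‖ ≤
      |τ| * (3 * q m) + (|τ| * Real.sqrt (R m) +
        (6 * (τ / 8) ^ 4 * Q m + (τ / 8) ^ 2 / 2 * Real.sqrt (16 * Q m)) +
        (τ / 8) ^ 2 / 2 * G m)) (τ : ℝ) :
    Tendsto (fun m => F m (τ / Real.sqrt (V m))) atTop (𝓝 (Real.exp (-(τ ^ 2 / 2)) : ℂ)) := by
  have hVS := tendsto_ratio_of_bounds hS hq hRS hqS hV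
  have hVpos : ∀ᶠ m in atTop, 0 < V m := by
    filter_upwards [hS, hVS.eventually (lt_mem_nhds one_pos)] with m h1 h2
    exact (div_pos_iff_of_pos_right h1).mp h2
  have hu : Tendsto (fun m => (τ / Real.sqrt (V m)) ^ 2 * S m) atTop (𝓝 (τ ^ 2)) := by
    have h1 : Tendsto (fun m => τ ^ 2 / (V m / S m)) atTop (𝓝 (τ ^ 2 / 1)) :=
      tendsto_const_nhds.div hVS one_ne_zero
    rw [div_one] at h1
    refine h1.congr' ?_
    filter_upwards [hS, hVpos] with m h1 h2
    rw [div_pow, Real.sq_sqrt h2.le]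
    field_simp
  set u := fun m => (τ / Real.sqrt (V m)) ^ 2 * S m with hudef
  have herr : Tendsto (fun m => 3 * Real.sqrt (u m * (q m ^ 2 / S m)) +
      (Real.sqrt (u m * (R m / S m)) + (6 / 8 ^ 4 * (u m ^ 2 * (Q m / S m ^ 2)) +
        1 / 128 * Real.sqrt (16 * (u m ^ 2 * (Q m / S m ^ 2)))) +
        1 / 128 * (u m * (G m / S m)))) atTop (𝓝 0) := by
    have hQ := (hu.pow 2).mul hQS
    have := ((hu.mul hqS).sqrt.const_mul 3).add (((hu.mul hRS).sqrt.add
      ((hQ.const_mul (6 / 8 ^ 4)).add ((hQ.const_mul 16).sqrt.const_mul (1 / 128)))).add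
      ((hu.mul hGS).const_mul (1 / 128)))
    simpa using this
  have hdiff : Tendsto (fun m => F m (τ / Real.sqrt (V m)) - (Real.exp (-(u m / 2)) : ℂ)) atTop
      (𝓝 0) := by
    refine squeeze_zero_norm' ?_ herr
    filter_upwards [hS, hF] with m hS hF
    set τ' := τ / Real.sqrt (V m)
    have eu : u m = τ' ^ 2 * S m := rfl
    have e1 : u m * (q m ^ 2 / S m) = (τ' * q m) ^ 2 := by rw [eu]; field_simp
    have e2 : u m * (R m / S m) = τ' ^ 2 * R m := by rw [eu]; field_simp
    have e3 : u m ^ 2 * (Q m / S m ^ 2) = τ' ^ 4 * Q m := by rw [eu]; field_simp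
    have e4 : u m * (G m / S m) = τ' ^ 2 * G m := by rw [eu]; field_simp
    have e5 : u m / 2 = τ' ^ 2 / 2 * S m := by rw [eu]; ring
    have e6 : 16 * (τ' ^ 4 * Q m) = (τ' ^ 2) ^ 2 * (16 * Q m) := by ring
    rw [e1, e2, e3, e4, e5, e6, Real.sqrt_sq_eq_abs, Real.sqrt_mul (sq_nonneg _),
      Real.sqrt_mul (by positivity), Real.sqrt_sq_eq_abs, Real.sqrt_sq (sq_nonneg _), abs_mul,
      abs_of_nonneg (hq m)]
    exact (hF τ').trans (le_of_eq (by ring))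
  have hexp : Tendsto (fun m => (Real.exp (-(u m / 2)) : ℂ)) atTop
      (𝓝 (Real.exp (-(τ ^ 2 / 2)) : ℂ)) :=
    (Complex.continuous_ofReal.tendsto _).comp
      ((Real.continuous_exp.tendsto _).comp (hu.div_const 2).neg)
  simpa using hdiff.add hexp

/-- The net quality parameter. -/
def tPar (m : ℕ) : ℕ := Nat.log 2 m / 10

/-- The window parameter. -/
def wPar (m : ℕ) : ℕ := 3 * (Nat.log 2 m + 1)

/-- The number of indices in a window times the bound for the counting functions. -/
def lPar (m : ℕ) : ℝ := ((wPar m + tPar m : ℕ) : ℝ) * 2 ^ tPar m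

lemma tendsto_natLog : Tendsto (fun m : ℕ => Nat.log 2 m) atTop atTop :=
  tendsto_atTop.mpr fun b => (eventually_ge_atTop (2 ^ b)).mono fun m hm =>
    (Nat.le_log_iff_pow_le one_lt_two (by have := Nat.two_pow_pos b; omega)).mpr hm

lemma tendsto_lPar : Tendsto (fun m : ℕ => lPar m ^ 4 / m) atTop (𝓝 0) := by
  have h1 : Tendsto (fun k : ℕ => (8 : ℝ) ^ 4 * 2 * (((k + 1 : ℕ) : ℝ) ^ 4 / 2 ^ (k + 1))) atTop
      (𝓝 0) := by
    have := ((tendsto_pow_const_div_const_pow_of_one_lt 4 (show (1 : ℝ) < 2 by norm_num)).comp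
      (tendsto_add_atTop_nat 1)).const_mul ((8 : ℝ) ^ 4 * 2)
    rw [mul_zero] at this
    exact this
  have h0 : Tendsto (fun n : ℕ => n / 2) atTop atTop :=
    tendsto_atTop.mpr fun b => (eventually_ge_atTop (2 * b)).mono fun n hn => by omega
  have h2 : Tendsto (fun m : ℕ => Nat.log 2 m / 2) atTop atTop := h0.comp tendsto_natLog
  refine squeeze_zero' (Eventually.of_forall fun m => by unfold lPar; positivity) ?_ (h1.comp h2)
  filter_upwards [eventually_ge_atTop 1] with m hm
  simp only [Function.comp_apply]
  set n := Nat.log 2 m with hn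
  have hmn : 2 ^ n ≤ m := Nat.pow_log_le_self 2 (by omega)
  have hpow : (2 : ℝ) ^ (4 * tPar m) * 2 ^ (n / 2) ≤ m := by
    rw [← pow_add]
    refine (pow_le_pow_right₀ (by norm_num) (show 4 * tPar m + n / 2 ≤ n from ?_)).trans
      (by exact_mod_cast hmn)
    rw [tPar]; omega
  have hk : ((wPar m + tPar m : ℕ) : ℝ) ≤ 8 * ((n / 2 + 1 : ℕ) : ℝ) := by
    have : wPar m + tPar m ≤ 8 * (n / 2 + 1) := by rw [wPar, tPar]; omega
    exact_mod_cast this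
  have hm0 : (0 : ℝ) < m := by exact_mod_cast hm
  rw [div_le_iff₀ hm0]
  calc lPar m ^ 4 = ((wPar m + tPar m : ℕ) : ℝ) ^ 4 * 2 ^ (4 * tPar m) := by
        rw [lPar, mul_pow, ← pow_mul, mul_comm 4]
    _ ≤ (8 * ((n / 2 + 1 : ℕ) : ℝ)) ^ 4 * 2 ^ (4 * tPar m) := by gcongr
    _ = (8 ^ 4 * 2 * (((n / 2 + 1 : ℕ) : ℝ) ^ 4 / 2 ^ (n / 2 + 1))) *
        ((2 : ℝ) ^ (4 * tPar m) * 2 ^ (n / 2)) := by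
        rw [pow_succ (2 : ℝ) (n / 2)]; field_simp
    _ ≤ _ := by gcongr

lemma one_le_lPar (m : ℕ) : 1 ≤ lPar m := by
  have h1 : (1 : ℝ) ≤ ((wPar m + tPar m : ℕ) : ℝ) := by
    have : 1 ≤ wPar m + tPar m := by rw [wPar]; omega
    exact_mod_cast this
  exact one_le_mul_of_one_le_of_one_le h1 (one_le_pow₀ (by norm_num))

lemma two_pow_tPar_le (m : ℕ) : (2 : ℝ) ^ tPar m ≤ lPar m := by
  have h1 : (1 : ℝ) ≤ ((wPar m + tPar m : ℕ) : ℝ) := by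
    have : 1 ≤ wPar m + tPar m := by rw [wPar]; omega
    exact_mod_cast this
  exact le_mul_of_one_le_left (by positivity) h1

end

section

lemma tPar_le (m : ℕ) : tPar m ≤ m :=
  (Nat.div_le_self _ _).trans (Nat.log_le_self 2 m)

lemma pow_three_le_two_pow_wPar (m : ℕ) : (m + 1) ^ 3 ≤ 2 ^ wPar m := by
  rw [wPar, mul_comm, pow_mul]
  exact Nat.pow_le_pow_left (Nat.lt_pow_succ_log_self one_lt_two m) 3

lemma tendsto_div_of_le {S X : ℕ → ℝ} {c : ℝ} (hc : 0 ≤ c)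
    (hS : ∀ᶠ m : ℕ in atTop, (m : ℝ) ^ 2 / 2304 ≤ S m)
    (hX : ∀ᶠ m : ℕ in atTop, 0 ≤ X m ∧ X m ≤ c * (m * lPar m ^ 2)) :
    Tendsto (fun m => X m / S m) atTop (𝓝 0) := by
  have h := tendsto_lPar.const_mul (2304 * c)
  rw [mul_zero] at h
  refine squeeze_zero_norm' ?_ h
  filter_upwards [hS, hX, eventually_ge_atTop 1] with m hS hX hm
  have hm0 : (0 : ℝ) < m := by exact_mod_cast hm
  have hL := one_le_lPar m
  have hS0 : 0 < S m := lt_of_lt_of_le (by positivity) hS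
  rw [Real.norm_of_nonneg (div_nonneg hX.1 hS0.le)]
  calc X m / S m ≤ c * (m * lPar m ^ 2) / ((m : ℝ) ^ 2 / 2304) := by
        gcongr
        exact hX.2
    _ = 2304 * c * (lPar m ^ 2 / m) := by field_simp
    _ ≤ _ := by gcongr; norm_num

variable {C : Fin 2 → ℕ → ℕ → ZMod 2}

lemma le_mainVar (m : ℕ) (hm : 2 ≤ m) : (m : ℝ) ^ 2 / 2304 ≤ mainVar (tPar m) (wPar m) m C := by
  have h := le_expect_gramSum (ptDig m C) (tPar m) (W := wPar m) (by rw [wPar]; omega)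
  have h2 : (m : ℝ) ≤ 3 * ((m / 2 : ℕ) : ℝ) := by
    have : m ≤ 3 * (m / 2) := by omega
    exact_mod_cast this
  have h3 : (m : ℝ) ^ 2 ≤ (3 * ((m / 2 : ℕ) : ℝ)) ^ 2 := by gcongr
  rw [mainVar]
  nlinarith

lemma restVar_nonneg (t W m : ℕ) : 0 ≤ restVar t W m C :=
  mul_nonneg (by norm_num) (Finset.sum_nonneg fun A _ => Finset.expect_nonneg fun z _ => sq_nonneg _)

lemma NetUpTo.restVar_le {m : ℕ} (h : NetUpTo (tPar m) m C) (hm : 1 ≤ m) :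
    restVar (tPar m) (wPar m) m C ≤ m * lPar m ^ 2 := by
  have h1 := (h.dnet hm).sum_rest_le (tPar_le m) (pow_three_le_two_pow_wPar m)
  have hq := two_pow_tPar_le m
  have hL := one_le_lPar m
  have hm1 : (1 : ℝ) ≤ m := by exact_mod_cast hm
  have e : 3 * ((m + 1 : ℕ) : ℝ) * ((wPar m + tPar m : ℕ) : ℝ) * 2 ^ (2 * tPar m) =
      3 * ((m + 1 : ℕ) : ℝ) * (lPar m * 2 ^ tPar m) := by rw [lPar]; ring
  have h2 : lPar m * 2 ^ tPar m ≤ lPar m ^ 2 := by rw [sq]; gcongr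
  have h3 : 3 * ((m + 1 : ℕ) : ℝ) * (lPar m * 2 ^ tPar m) ≤ 6 * m * lPar m ^ 2 :=
    mul_le_mul (by push_cast; linarith) h2 (by positivity) (by positivity)
  have h4 : (2 : ℝ) ^ tPar m ≤ m * lPar m ^ 2 := by nlinarith
  rw [e] at h1
  have h5 : restVar (tPar m) (wPar m) m C ≤
      1 / 64 * (2 ^ tPar m + 3 * ((m + 1 : ℕ) : ℝ) * (lPar m * 2 ^ tPar m)) :=
    mul_le_mul_of_nonneg_left h1 (by norm_num)
  nlinarith

lemma NetUpTo.expect_abs_gramSum_sub_le {m : ℕ} (h : NetUpTo (tPar m) m C) (hm : 1 ≤ m) :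
    𝔼 z : Dig m, |gramSum (ptDig m C) (tPar m) (wPar m) z -
      𝔼 z' : Dig m, gramSum (ptDig m C) (tPar m) (wPar m) z'| ≤ 18 * (m * lPar m ^ 2) := by
  refine ((h.nearDigital hm (tPar_le m)).expect_gramSum_sub_le (wPar m)).trans ?_
  have hq := two_pow_tPar_le m
  have hL := one_le_lPar m
  have h1 : Real.sqrt (32 * 2 ^ (4 * tPar m) * (m : ℝ) ^ 2 * ((wPar m + tPar m : ℕ) : ℝ) ^ 4) ≤
      6 * (m * lPar m ^ 2) := by
    refine Real.sqrt_le_iff.mpr ⟨by positivity, ?_⟩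
    have e : 32 * 2 ^ (4 * tPar m) * (m : ℝ) ^ 2 * ((wPar m + tPar m : ℕ) : ℝ) ^ 4 =
        32 * ((m : ℝ) * lPar m ^ 2) ^ 2 := by rw [lPar]; ring
    rw [e]
    nlinarith [sq_nonneg ((m : ℝ) * lPar m ^ 2)]
  have h2 : 12 * 2 ^ (2 * tPar m) * (m : ℝ) ≤ 12 * (m * lPar m ^ 2) := by
    rw [mul_comm 2, pow_mul, mul_assoc, mul_comm (_ ^ 2)]
    gcongr
  linarith

/-- Convergence of the characteristic functions of the normalized discrepancy. -/
theorem tendsto_avg_exp (h : ∀ m, 1 ≤ m → NetUpTo (tPar m) m C) (τ : ℝ) :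
    Tendsto (fun m => avg m fun T Y => Complex.exp
      (((τ / Real.sqrt (secondMoment m C) * shiftDisc m C T Y : ℝ) : ℂ) * Complex.I)) atTop
      (𝓝 (Real.exp (-(τ ^ 2 / 2)) : ℂ)) := by
  have hS : ∀ᶠ m : ℕ in atTop, (m : ℝ) ^ 2 / 2304 ≤ mainVar (tPar m) (wPar m) m C :=
    (eventually_ge_atTop 2).mono fun m hm => le_mainVar m hm
  refine tendsto_charFun_of_bounds (S := fun m => mainVar (tPar m) (wPar m) m C)
    (R := fun m => restVar (tPar m) (wPar m) m C) (q := fun m => 2 ^ tPar m)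
    (Q := fun m => (m : ℝ) ^ 3 * lPar m ^ 4)
    (G := fun m => 𝔼 z : Dig m, |gramSum (ptDig m C) (tPar m) (wPar m) z -
      𝔼 z' : Dig m, gramSum (ptDig m C) (tPar m) (wPar m) z'|)
    (V := fun m => secondMoment m C)
    (F := fun m τ => avg m fun T Y => Complex.exp
      (((τ * shiftDisc m C T Y : ℝ) : ℂ) * Complex.I))
    ?_ (fun m => by positivity) ?_ ?_ ?_ ?_ ?_ ?_ τ
  · filter_upwards [hS, eventually_ge_atTop 1] with m h1 hm
    have hm0 : (0 : ℝ) < m := by exact_mod_cast hm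
    exact lt_of_lt_of_le (by positivity) h1
  · refine tendsto_div_of_le zero_le_one hS ((eventually_ge_atTop 1).mono fun m hm =>
      ⟨restVar_nonneg _ _ _, ?_⟩)
    rw [one_mul]
    exact (h m hm).restVar_le hm
  · refine tendsto_div_of_le zero_le_one hS ((eventually_ge_atTop 1).mono fun m hm =>
      ⟨by positivity, ?_⟩)
    have hm1 : (1 : ℝ) ≤ m := by exact_mod_cast hm
    have h1 : ((2 : ℝ) ^ tPar m) ^ 2 ≤ lPar m ^ 2 := by
      gcongr
      exact two_pow_tPar_le m
    nlinarith [sq_nonneg (lPar m)]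
  · have h1 := tendsto_lPar.const_mul (2304 ^ 2)
    rw [mul_zero] at h1
    refine squeeze_zero_norm' ?_ h1
    filter_upwards [hS, eventually_ge_atTop 1] with m hS hm
    have hm0 : (0 : ℝ) < m := by exact_mod_cast hm
    have hS0 : 0 < mainVar (tPar m) (wPar m) m C := lt_of_lt_of_le (by positivity) hS
    rw [Real.norm_of_nonneg (by positivity)]
    calc (m : ℝ) ^ 3 * lPar m ^ 4 / mainVar (tPar m) (wPar m) m C ^ 2
        ≤ (m : ℝ) ^ 3 * lPar m ^ 4 / ((m : ℝ) ^ 2 / 2304) ^ 2 := by gcongr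
      _ = _ := by field_simp
  · refine tendsto_div_of_le (c := 18) (by norm_num) hS ((eventually_ge_atTop 1).mono fun m hm =>
      ⟨Finset.expect_nonneg fun z _ => abs_nonneg _, ?_⟩)
    exact (h m hm).expect_abs_gramSum_sub_le hm
  · exact (eventually_ge_atTop 1).mono fun m hm =>
      (h m hm).abs_secondMoment_sub_le hm (tPar_le m) (wPar m)
  · exact (eventually_ge_atTop 1).mono fun m hm τ =>
      (h m hm).norm_avg_exp_sub_le hm (tPar_le m) (wPar m) τ

end

section

open ProbabilityTheory

/-- The law of the normalized discrepancy under a random digital shift and a random box. -/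
def discLaw (m : ℕ) (C : Fin 2 → ℕ → ℕ → ZMod 2) : Measure ℝ :=
  ((2 : ENNReal) ^ (3 * m))⁻¹ • ∑ T : Fin 3 → Fin (2 ^ m),
    (volume.restrict unitCube).map fun Y => shiftDisc m C T Y / Real.sqrt (secondMoment m C)

variable {C : Fin 2 → ℕ → ℕ → ZMod 2}

lemma measurable_normDisc (m : ℕ) (T : Fin 3 → Fin (2 ^ m)) :
    Measurable fun Y => shiftDisc m C T Y / Real.sqrt (secondMoment m C) :=
  (measurable_Dloc _).div_const _

lemma discLaw_apply (m : ℕ) {s : Set ℝ} (hs : MeasurableSet s) :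
    discLaw m C s = ((2 : ENNReal) ^ (3 * m))⁻¹ * ∑ T : Fin 3 → Fin (2 ^ m),
      volume {Y | Y ∈ unitCube ∧ shiftDisc m C T Y / Real.sqrt (secondMoment m C) ∈ s} := by
  rw [discLaw, Measure.smul_apply, Measure.finsetSum_apply, smul_eq_mul]
  congr 1
  refine Finset.sum_congr rfl fun T _ => ?_
  rw [Measure.map_apply (measurable_normDisc m T) hs,
    Measure.restrict_apply (measurable_normDisc m T hs)]
  congr 1
  ext Y
  simp [and_comm]

instance (m : ℕ) : IsProbabilityMeasure (discLaw m C) := by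
  constructor
  rw [discLaw_apply m MeasurableSet.univ]
  have : ∀ T : Fin 3 → Fin (2 ^ m), volume {Y | Y ∈ unitCube ∧
      shiftDisc m C T Y / Real.sqrt (secondMoment m C) ∈ Set.univ} = 1 := fun T => by
    simpa using volume_unitCube
  rw [Finset.sum_congr rfl fun T _ => this T]
  simp only [Finset.sum_const, Finset.card_univ, Fintype.card_pi, Fintype.card_fin,
    Finset.prod_const, nsmul_eq_mul, mul_one]
  push_cast
  rw [← pow_mul, mul_comm m]
  exact ENNReal.inv_mul_cancel (by simp) (by simp)

lemma charFun_discLaw (m : ℕ) (τ : ℝ) :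
    charFun (discLaw m C) τ = avg m fun T Y => Complex.exp
      (((τ / Real.sqrt (secondMoment m C) * shiftDisc m C T Y : ℝ) : ℂ) * Complex.I) := by
  have hi : ∀ μ : Measure ℝ, IsFiniteMeasure μ →
      Integrable (fun x : ℝ => Complex.exp (τ * x * Complex.I)) μ := fun μ _ => by
    refine Integrable.of_bound (by fun_prop) 1 (Eventually.of_forall fun x => ?_)
    rw [← Complex.ofReal_mul, Complex.norm_exp_ofReal_mul_I]
  have : IsFiniteMeasure (volume.restrict unitCube) := ⟨by simp [volume_unitCube]⟩
  rw [charFun_apply_real, discLaw, integral_smul_measure,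
    integral_finsetSum_measure fun T _ => hi _ inferInstance, avg]
  congr 1
  · simp
  · refine Finset.sum_congr rfl fun T _ => ?_
    rw [integral_map (measurable_normDisc m T).aemeasurable (by fun_prop)]
    refine integral_congr_ae (Eventually.of_forall fun Y => ?_)
    simp only []
    congr 2
    push_cast
    ring

lemma tendsto_discLaw_Iio (h : ∀ m, 1 ≤ m → NetUpTo (tPar m) m C) (w : ℝ) :
    Tendsto (fun m => discLaw m C (Set.Iio w)) atTop (𝓝 (gaussianReal 0 1 (Set.Iio w))) := by
  let μ : ℕ → ProbabilityMeasure ℝ := fun m => ⟨discLaw m C, inferInstance⟩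
  let γ : ProbabilityMeasure ℝ := ⟨gaussianReal 0 1, inferInstance⟩
  have hμ : Tendsto μ atTop (𝓝 γ) := by
    refine ProbabilityMeasure.tendsto_of_tendsto_charFun fun τ => ?_
    change Tendsto (fun m => charFun (discLaw m C) τ) atTop (𝓝 (charFun (gaussianReal 0 1) τ))
    simp_rw [charFun_discLaw]
    rw [charFun_gaussianReal]
    convert tendsto_avg_exp h τ using 2
    push_cast
    simp
  have : NullSingletonClass (gaussianReal 0 1) := nullSingletonClass_gaussianReal one_ne_zero
  exact ProbabilityMeasure.tendsto_measure_of_null_frontier_of_tendsto' hμ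
    (by rw [frontier_Iio]; exact measure_singleton (μ := gaussianReal 0 1) w)

lemma phiCDF_eq (w : ℝ) : PhiCDF w = (gaussianReal 0 1 (Set.Iio w)).toReal := by
  rw [gaussianReal_apply_eq_integral 0 one_ne_zero, ENNReal.toReal_ofReal
    (integral_nonneg fun x => gaussianPDFReal_nonneg _ _ x), PhiCDF, ← integral_const_mul]
  simp [gaussianPDFReal]

theorem tendsto_measure_normDisc (h : ∀ m, 1 ≤ m → NetUpTo (tPar m) m C) (w : ℝ) :
    Tendsto (fun m : ℕ => (2 : ℝ) ^ (-((2 + 1) * m : ℤ)) * ∑ T : Fin 3 → Fin (2 ^ m),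
      (volume {Y : Fin 3 → ℝ | (∀ i, Y i ∈ Set.Ico (0 : ℝ) 1) ∧
        Dloc (fun n : Fin (2 ^ m) => xorVec (pt m C n) (Qpt m T)) Y /
          Msp 3 m 2 (fun n : Fin (2 ^ m) => pt m C n) < w}).toReal) atTop (𝓝 (PhiCDF w)) := by
  rw [phiCDF_eq]
  refine ((ENNReal.tendsto_toReal (measure_ne_top _ _)).comp (tendsto_discLaw_Iio h w)).congr
    fun m => ?_
  have hfin : ∀ T : Fin 3 → Fin (2 ^ m), volume {Y | Y ∈ unitCube ∧
      shiftDisc m C T Y / Real.sqrt (secondMoment m C) ∈ Set.Iio w} ≠ ⊤ := fun T =>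
    ne_top_of_le_ne_top (by rw [volume_unitCube]; simp) (measure_mono fun Y hY => hY.1)
  rw [Function.comp_apply, discLaw_apply m measurableSet_Iio, ENNReal.toReal_mul,
    ENNReal.toReal_sum fun T _ => hfin T, msp_eq_sqrt]
  congr 1
  rw [zpow_neg]
  simp only [ENNReal.toReal_inv, ENNReal.toReal_pow, ENNReal.toReal_ofNat]
  norm_cast

end

section

lemma ten_mul_le_log {Tf : ℕ → ℕ} (hT : ∀ m, (Tf m : ℝ) ≤ Real.logb 2 m / 10) {m : ℕ} (hm : 1 ≤ m) :
    10 * Tf m ≤ Nat.log 2 m := by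
  rw [Nat.le_log_iff_pow_le one_lt_two (by omega)]
  have h : ((10 * Tf m : ℕ) : ℝ) ≤ Real.logb 2 m := by
    have := hT m
    push_cast
    linarith
  rw [Real.le_logb_iff_rpow_le one_lt_two (by exact_mod_cast hm), Real.rpow_natCast] at h
  exact_mod_cast h

lemma netUpTo_of_isTSeq {Tf : ℕ → ℕ} {C : Fin 2 → ℕ → ℕ → ZMod 2} (hseq : IsTSeq 2 Tf C)
    (hT : ∀ m, (Tf m : ℝ) ≤ Real.logb 2 m / 10) (m : ℕ) : NetUpTo (tPar m) m C :=
  fun M hM hMm k => ⟨Tf M, by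
    have h1 := ten_mul_le_log hT hM
    have h2 : Nat.log 2 M ≤ Nat.log 2 m := Nat.log_mono_right hMm
    rw [tPar]
    omega, hseq.1 M, hseq.2 M hM k⟩

/-- The elementary box at the origin with side lengths `2 ^ (-d i)`. -/
def InCorner {s : ℕ} (d : Fin s → ℕ) (X : Fin s → ℝ) : Prop := ∀ i, 0 ≤ X i ∧ X i < 1 / 2 ^ d i

lemma inCorner_add {s : ℕ} {i j : Fin s} (hij : i ≠ j) (X : Fin s → ℝ) :
    InCorner (Pi.single i 1 + Pi.single j 1) X ↔
      InCorner (Pi.single i 1) X ∧ InCorner (Pi.single j 1) X := by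
  simp only [InCorner, ← forall_and]
  refine forall_congr' fun l => ?_
  by_cases hi : l = i
  · subst hi
    simp [hij]
    intro h0 h
    exact ⟨h0, lt_of_lt_of_le h (by norm_num : (2 : ℝ)⁻¹ ≤ 1)⟩
  · by_cases hj : l = j
    · subst hj
      simp [hi]
      intro h0 h
      exact ⟨h0, lt_of_lt_of_le h (by norm_num : (2 : ℝ)⁻¹ ≤ 1)⟩
    · simp [hi, hj]

lemma card_inCorner {m s k : ℕ} {X : ℕ → Fin s → ℝ}
    (h : IsNet 0 m s fun n : Fin (2 ^ m) => X (k + n)) {d : Fin s → ℕ} (hd : ∑ i, d i = m) :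
    ∑ n ∈ Finset.range (2 ^ m), (if InCorner d (X (k + n)) then 1 else 0) = 1 := by
  have h1 := h d (fun _ => 0) (fun i => Nat.two_pow_pos _) hd
  rw [pow_zero, Finset.card_filter] at h1
  rw [← Fin.sum_univ_eq_sum_range fun n => if InCorner d (X (k + n)) then 1 else 0]
  refine Eq.trans (Finset.sum_congr rfl fun n _ => ?_) h1
  refine if_congr (forall_congr' fun i => ?_) rfl rfl
  rw [Nat.cast_zero, zero_div, zero_add]

/-- In dimension at least three there is no digital sequence of such high quality. -/
lemma not_isTSeq {s : ℕ} (hs : 3 ≤ s) {Tf : ℕ → ℕ} {C : Fin s → ℕ → ℕ → ZMod 2}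
    (hT : ∀ m, (Tf m : ℝ) ≤ Real.logb 2 m / 10) : ¬ IsTSeq s Tf C := by
  intro hseq
  have h1 := ten_mul_le_log hT (m := 1) le_rfl
  have h2 := ten_mul_le_log hT (m := 2) one_le_two
  rw [Nat.log_one_right] at h1
  rw [show Nat.log 2 2 = 1 from Nat.log_pow one_lt_two 1] at h2
  have n1 := fun k => hseq.2 1 le_rfl k
  have n2 := hseq.2 2 one_le_two 0
  rw [show Tf 1 = 0 by omega] at n1
  rw [show Tf 2 = 0 by omega] at n2
  let b : Fin s → ℕ → ℕ := fun i n => if InCorner (Pi.single i 1) (seqPoint s C n) then 1 else 0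
  have hb : ∀ i n, b i n = 0 ∨ b i n = 1 := fun i n => by
    simp only [b]
    split_ifs <;> simp
  have e1 : ∀ i, b i 0 + b i 1 = 1 := fun i => by
    have := card_inCorner (n1 0) (d := Pi.single i 1) (by simp)
    rw [pow_one, Finset.sum_range_succ, Finset.sum_range_one] at this
    exact this
  have e2 : ∀ i, b i 2 + b i 3 = 1 := fun i => by
    have := card_inCorner (n1 1) (d := Pi.single i 1) (by simp)
    rw [pow_one, Finset.sum_range_succ, Finset.sum_range_one] at this
    exact this
  have e3 : ∀ i j, i ≠ j → b j 0 * b i 0 + b j 1 * b i 1 + b j 2 * b i 2 + b j 3 * b i 3 = 1 :=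
    fun i j hij => by
    have := card_inCorner n2 (d := Pi.single i 1 + Pi.single j 1) (by
      simp [Finset.sum_add_distrib])
    rw [show 2 ^ 2 = 3 + 1 from rfl] at this
    simp only [Finset.sum_range_succ, Finset.sum_range_zero] at this
    simpa [b, inCorner_add hij, ite_and] using this
  let i0 : Fin s := ⟨0, by omega⟩
  let i1 : Fin s := ⟨1, by omega⟩
  let i2 : Fin s := ⟨2, by omega⟩
  have a1 := e3 i0 i1 (by simp [i0, i1])
  have a2 := e3 i0 i2 (by simp [i0, i2])
  have a3 := e3 i1 i2 (by simp [i1, i2])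
  have c (i) : b i 1 = 1 - b i 0 := by have := e1 i; omega
  have c' (i) : b i 3 = 1 - b i 2 := by have := e2 i; omega
  simp only [c, c'] at a1 a2 a3
  rcases hb i0 0 with x | x <;> rcases hb i1 0 with y | y <;> rcases hb i2 0 with z | z <;>
    rcases hb i0 2 with x' | x' <;> rcases hb i1 2 with y' | y' <;> rcases hb i2 2 with z' | z' <;>
    simp [x, y, z, x', y', z'] at a1 a2 a3

end

end DigitalCLT

/-- Corollary 1, second part: CLT for the extended point sets
`P̈_m = (n/2^m, X_n)_{n=0}^{2^m-1} ⊂ [0,1)^{s+1}` of a digital `(T,s)`-sequence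
with `T(m) ≤ (1/10) log₂ m`. -/
theorem statement3 (s : ℕ) (hs : 2 ≤ s) (Tf : ℕ → ℕ) (C : Fin s → ℕ → ℕ → ZMod 2)
    (hseq : IsTSeq s Tf C) (hT : ∀ m, (Tf m : ℝ) ≤ Real.logb 2 m / 10) (w : ℝ) :
    Tendsto (fun m : ℕ =>
        (2 : ℝ) ^ (-((s + 1) * m : ℤ)) * ∑ T : Fin (s + 1) → Fin (2 ^ m),
          (volume {Y : Fin (s + 1) → ℝ | (∀ i, Y i ∈ Set.Ico (0 : ℝ) 1) ∧
              Dloc (fun n : Fin (2 ^ m) =>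
                  xorVec (Fin.cons (((n : ℕ) : ℝ) / 2 ^ m) (seqPoint s C (n : ℕ)))
                    (Qpt m T)) Y /
                  Msp (s + 1) m 2 (fun n : Fin (2 ^ m) =>
                    Fin.cons (((n : ℕ) : ℝ) / 2 ^ m) (seqPoint s C (n : ℕ))) < w}).toReal)
      atTop (nhds (PhiCDF w)) := by
  rcases hs.eq_or_lt with rfl | hs
  · simp only [Nat.cast_ofNat]
    exact DigitalCLT.tendsto_measure_normDisc
      (fun m _ => DigitalCLT.netUpTo_of_isTSeq hseq hT m) w
  · exact absurd hseq (DigitalCLT.not_isTSeq hs hT)
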